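/- arXiv:2003.05282 — 2 statements merged into one kernel-verified Lean document; each statement's English description precedes it below -/
import Mathlib

section
/- Let γ be the standard Gaussian measure on ℝⁿ, let r > 0, and let K and L be origin-symmetric convex bodies in ℝⁿ both containing r·B₂ⁿ. If p ∈ [0,1] and q ∈ (0,p] satisfy 4q + (n+1)(1−p)/r² ≤ 2, then for every λ ∈ [0,1], γ(λ·K +_p (1−λ)·L)^{q/n} ≥ λ·γ(K)^{q/n} + (1−λ)·γ(L)^{q/n}. -/
open MeasureTheory
open scoped RealInnerProductSpace ENNReal

noncomputable section

abbrev Euc (n : ℕ) : Type := EuclideanSpace ℝ (Fin n)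

/-- A convex body: a compact convex set with nonempty interior. -/
def IsConvexBody {n : ℕ} (K : Set (Euc n)) : Prop :=
  IsCompact K ∧ Convex ℝ K ∧ (interior K).Nonempty

/-- The support function `h_K(u) = sup_{y ∈ K} ⟨u, y⟩`. -/
def suppFn {n : ℕ} (K : Set (Euc n)) (u : Euc n) : ℝ :=
  sSup ((fun y => ⟪u, y⟫) '' K)

/-- `lpComb p lam K L` is the `L_p` combination `lam·K +_p (1−lam)·L`;
for `p = 0` it is the logarithmic combination. -/
def lpComb {n : ℕ} (p lam : ℝ) (K L : Set (Euc n)) : Set (Euc n) :=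
  if p = 0 then
    {x | ∀ u : Euc n, ‖u‖ = 1 → ⟪x, u⟫ ≤ suppFn K u ^ lam * suppFn L u ^ (1 - lam)}
  else
    {x | ∀ u : Euc n, ‖u‖ = 1 →
      ⟪x, u⟫ ≤ (lam * suppFn K u ^ p + (1 - lam) * suppFn L u ^ p) ^ (1 / p)}


/-- The standard Gaussian measure on `ℝⁿ`, with density `(2π)^{-n/2} e^{-|x|²/2}`. -/
def gaussianMeasure (n : ℕ) : Measure (Euc n) :=
  volume.withDensity fun x =>
    ENNReal.ofReal ((2 * Real.pi) ^ (-(n : ℝ) / 2) * Real.exp (-‖x‖ ^ 2 / 2))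

namespace GaussPQ

variable {n : ℕ}

/-- The `i`-th partial derivative. -/
def pd (i : Fin n) (f : Euc n → ℝ) (x : Euc n) : ℝ :=
  fderiv ℝ f x (EuclideanSpace.single i 1)

/-- Continuous functions of polynomial growth. -/
def PG (g : Euc n → ℝ) : Prop :=
  Continuous g ∧ ∃ (C : ℝ) (k : ℕ), ∀ x, |g x| ≤ C * (1 + ‖x‖) ^ k

/-- The unnormalised Gaussian weight perturbed by the potential `W`. -/
def wt (W : Euc n → ℝ) (x : Euc n) : ℝ := Real.exp (-‖x‖ ^ 2 / 2 - W x)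

/-- The measure with density `wt W`. -/
def mu (W : Euc n → ℝ) : Measure (Euc n) :=
  volume.withDensity fun x => ENNReal.ofReal (wt W x)

lemma inner_single_one (x : Euc n) (i : Fin n) :
    ⟪x, EuclideanSpace.single i (1 : ℝ)⟫ = x i := by
  simp [EuclideanSpace.inner_single_right]

lemma pd_add {f g : Euc n → ℝ} (hf : Differentiable ℝ f) (hg : Differentiable ℝ g)
    (i : Fin n) : pd i (fun x => f x + g x) = fun x => pd i f x + pd i g x := by
  ext x
  simp [pd, fderiv_fun_add (hf x) (hg x)]

lemma pd_sub {f g : Euc n → ℝ} (hf : Differentiable ℝ f) (hg : Differentiable ℝ g)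
    (i : Fin n) : pd i (fun x => f x - g x) = fun x => pd i f x - pd i g x := by
  ext x
  simp [pd, fderiv_fun_sub (hf x) (hg x)]

lemma pd_mul {f g : Euc n → ℝ} (hf : Differentiable ℝ f) (hg : Differentiable ℝ g)
    (i : Fin n) : pd i (fun x => f x * g x) = fun x => pd i f x * g x + f x * pd i g x := by
  ext x
  simp [pd, fderiv_fun_mul (hf x) (hg x)]
  ring

lemma pd_const_mul {f : Euc n → ℝ} (hf : Differentiable ℝ f) (c : ℝ)
    (i : Fin n) : pd i (fun x => c * f x) = fun x => c * pd i f x := by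
  ext x
  simp [pd, fderiv_const_mul (hf x) c]

lemma pd_sum {ι : Type*} (s : Finset ι) {f : ι → Euc n → ℝ}
    (hf : ∀ k, Differentiable ℝ (f k)) (i : Fin n) :
    pd i (fun x => ∑ k ∈ s, f k x) = fun x => ∑ k ∈ s, pd i (f k) x := by
  ext x
  simp [pd, fderiv_fun_sum (fun k _ => hf k x)]

lemma pd_coord (i j : Fin n) :
    pd i (fun x : Euc n => x j) = fun _ => if j = i then 1 else 0 := by
  ext x
  have h : HasFDerivAt (fun x : Euc n => x j) (EuclideanSpace.proj j : Euc n →L[ℝ] ℝ) x :=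
    (EuclideanSpace.proj j : Euc n →L[ℝ] ℝ).hasFDerivAt
  simp [pd, h.fderiv]

lemma hasFDerivAt_ridge {g : ℝ → ℝ} {g' : ℝ} {e x : Euc n} {a : ℝ}
    (hg : HasDerivAt g g' (⟪x, e⟫ + a)) :
    HasFDerivAt (fun x : Euc n => g (⟪x, e⟫ + a)) (g' • innerSL ℝ e) x := by
  have h : HasFDerivAt (fun x : Euc n => ⟪x, e⟫ + a) (innerSL ℝ e : Euc n →L[ℝ] ℝ) x := by
    have h1 : HasFDerivAt (fun x : Euc n => ⟪e, x⟫) (innerSL ℝ e : Euc n →L[ℝ] ℝ) x :=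
      (innerSL ℝ e : Euc n →L[ℝ] ℝ).hasFDerivAt
    simp_rw [real_inner_comm _ e] at h1
    exact h1.add_const a
  exact hg.comp_hasFDerivAt x h

lemma pd_ridge {g g' : ℝ → ℝ} (hg : ∀ s, HasDerivAt g (g' s) s) (e : Euc n) (a : ℝ)
    (i : Fin n) :
    pd i (fun x : Euc n => g (⟪x, e⟫ + a)) = fun x => g' (⟪x, e⟫ + a) * e i := by
  ext x
  simp [pd, (hasFDerivAt_ridge (e := e) (a := a) (hg (⟪x, e⟫ + a))).fderiv, inner_single_one]

lemma differentiable_ridge {g g' : ℝ → ℝ} (hg : ∀ s, HasDerivAt g (g' s) s) (e : Euc n)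
    (a : ℝ) : Differentiable ℝ (fun x : Euc n => g (⟪x, e⟫ + a)) :=
  fun x => (hasFDerivAt_ridge (e := e) (a := a) (hg (⟪x, e⟫ + a))).differentiableAt

namespace PG

lemma of_bounded {g : Euc n → ℝ} (hg : Continuous g) {C : ℝ} (h : ∀ x, |g x| ≤ C) : PG g :=
  ⟨hg, C, 0, by simpa using h⟩

lemma const (c : ℝ) : PG (fun _ : Euc n => c) := of_bounded continuous_const (fun _ => le_rfl)

lemma coord (i : Fin n) : PG (fun x : Euc n => x i) := by
  refine ⟨by fun_prop, 1, 1, fun x => ?_⟩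
  have := PiLp.norm_apply_le x i
  rw [Real.norm_eq_abs] at this
  linarith

lemma add {f g : Euc n → ℝ} (hf : PG f) (hg : PG g) : PG (fun x => f x + g x) := by
  obtain ⟨cf, C, k, hC⟩ := hf
  obtain ⟨cg, D, l, hD⟩ := hg
  refine ⟨cf.add cg, |C| + |D|, max k l, fun x => ?_⟩
  have h1 : (1 : ℝ) ≤ 1 + ‖x‖ := by linarith [norm_nonneg x]
  have hk : (1 + ‖x‖) ^ k ≤ (1 + ‖x‖) ^ max k l := pow_le_pow_right₀ h1 (le_max_left _ _)
  have hl : (1 + ‖x‖) ^ l ≤ (1 + ‖x‖) ^ max k l := pow_le_pow_right₀ h1 (le_max_right _ _)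
  calc |f x + g x| ≤ |f x| + |g x| := abs_add_le _ _
    _ ≤ C * (1 + ‖x‖) ^ k + D * (1 + ‖x‖) ^ l := add_le_add (hC x) (hD x)
    _ ≤ |C| * (1 + ‖x‖) ^ k + |D| * (1 + ‖x‖) ^ l := by
        gcongr <;> exact le_abs_self _
    _ ≤ |C| * (1 + ‖x‖) ^ max k l + |D| * (1 + ‖x‖) ^ max k l := by gcongr
    _ = _ := by ring

lemma mul {f g : Euc n → ℝ} (hf : PG f) (hg : PG g) : PG (fun x => f x * g x) := by
  obtain ⟨cf, C, k, hC⟩ := hf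
  obtain ⟨cg, D, l, hD⟩ := hg
  refine ⟨cf.mul cg, C * D, k + l, fun x => ?_⟩
  calc |f x * g x| = |f x| * |g x| := abs_mul _ _
    _ ≤ (C * (1 + ‖x‖) ^ k) * (D * (1 + ‖x‖) ^ l) :=
        mul_le_mul (hC x) (hD x) (abs_nonneg _) ((abs_nonneg _).trans (hC x))
    _ = _ := by ring

lemma neg {f : Euc n → ℝ} (hf : PG f) : PG (fun x => -f x) := by
  simpa using (const (-1)).mul hf

lemma sub {f g : Euc n → ℝ} (hf : PG f) (hg : PG g) : PG (fun x => f x - g x) := by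
  simpa [sub_eq_add_neg] using hf.add hg.neg

lemma pow {f : Euc n → ℝ} (hf : PG f) (k : ℕ) : PG (fun x => f x ^ k) := by
  induction k with
  | zero => simpa using const (n := n) 1
  | succ k ih => simpa [pow_succ] using ih.mul hf

lemma sum {ι : Type*} (s : Finset ι) {f : ι → Euc n → ℝ} (hf : ∀ k, PG (f k)) :
    PG (fun x => ∑ k ∈ s, f k x) := by
  classical
  induction s using Finset.induction_on with
  | empty => simpa using const (n := n) 0
  | insert a s ha ih => simpa [Finset.sum_insert ha] using (hf a).add ih

end PG

lemma wt_pos (W : Euc n → ℝ) (x : Euc n) : 0 < wt W x := Real.exp_pos _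

lemma continuous_wt {W : Euc n → ℝ} (hW : Continuous W) : Continuous (wt W) := by
  unfold wt; fun_prop

lemma integral_mu {W : Euc n → ℝ} (hW : Continuous W) (g : Euc n → ℝ) :
    ∫ x, g x ∂(mu W) = ∫ x, wt W x * g x := by
  rw [mu, integral_withDensity_eq_integral_toReal_smul]
  · simp [ENNReal.toReal_ofReal (wt_pos W _).le]
  · exact (continuous_wt hW).measurable.ennreal_ofReal
  · simp

lemma integrable_mu_iff {W : Euc n → ℝ} (hW : Continuous W) (g : Euc n → ℝ) :
    Integrable g (mu W) ↔ Integrable (fun x => wt W x * g x) := by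
  rw [mu, integrable_withDensity_iff_integrable_smul']
  · simp [ENNReal.toReal_ofReal (wt_pos W _).le]
  · exact (continuous_wt hW).measurable.ennreal_ofReal
  · simp

lemma exists_poly_mul_exp_le (k : ℕ) :
    ∃ C : ℝ, ∀ t : ℝ, 0 ≤ t → (1 + t) ^ k * Real.exp (-t ^ 2 / 2) ≤ C := by
  refine ⟨k.factorial * Real.exp 2, fun t ht => ?_⟩
  have h1 := Real.pow_div_factorial_le_exp (1 + t) (by linarith) k
  rw [div_le_iff₀ (by positivity)] at h1
  calc (1 + t) ^ k * Real.exp (-t ^ 2 / 2)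
      ≤ (Real.exp (1 + t) * k.factorial) * Real.exp (-t ^ 2 / 2) := by gcongr
    _ = k.factorial * Real.exp ((1 + t) + (-t ^ 2 / 2)) := by rw [Real.exp_add (1 + t)]; ring
    _ ≤ _ := by gcongr; nlinarith [sq_nonneg (t - 1)]

lemma PG.integrable {W : Euc n → ℝ} (hW : Continuous W) (h0 : ∀ x, 0 ≤ W x)
    {g : Euc n → ℝ} (hg : PG g) : Integrable g (mu W) := by
  rw [integrable_mu_iff hW]
  obtain ⟨cg, C, k, hC⟩ := hg
  obtain ⟨D, hD⟩ := exists_poly_mul_exp_le (k + (n + 1))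
  have hint := (integrable_one_add_norm (E := Euc n) (μ := volume) (r := (n + 1 : ℕ))
    (by simp)).const_mul (|C| * D)
  refine hint.mono' (by have := continuous_wt hW; fun_prop) (.of_forall fun x => ?_)
  have h1 : (0 : ℝ) < 1 + ‖x‖ := by linarith [norm_nonneg x]
  rw [Real.norm_eq_abs, abs_mul, abs_of_pos (wt_pos W x), Real.rpow_neg h1.le, Real.rpow_natCast,
    ← div_eq_mul_inv, le_div_iff₀ (by positivity)]
  have hw : wt W x ≤ Real.exp (-‖x‖ ^ 2 / 2) := by
    unfold wt; gcongr; linarith [h0 x]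
  calc wt W x * |g x| * (1 + ‖x‖) ^ (n + 1)
      ≤ Real.exp (-‖x‖ ^ 2 / 2) * (|C| * (1 + ‖x‖) ^ k) * (1 + ‖x‖) ^ (n + 1) := by
        gcongr
        exact (hC x).trans (by gcongr; exact le_abs_self C)
    _ = |C| * ((1 + ‖x‖) ^ (k + (n + 1)) * Real.exp (-‖x‖ ^ 2 / 2)) := by ring
    _ ≤ |C| * D := by gcongr; exact hD _ (norm_nonneg x)

lemma isFiniteMeasure_mu {W : Euc n → ℝ} (hW : Continuous W) (h0 : ∀ x, 0 ≤ W x) :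
    IsFiniteMeasure (mu W) := by
  have := (PG.const (n := n) 1).integrable hW h0
  rw [integrable_const_iff_isFiniteMeasure one_ne_zero] at this
  exact this

lemma hasFDerivAt_wt {W : Euc n → ℝ} (hW : Differentiable ℝ W) (x : Euc n) :
    HasFDerivAt (wt W) (wt W x • (-(innerSL ℝ x : Euc n →L[ℝ] ℝ) - fderiv ℝ W x)) x := by
  have h1 : HasFDerivAt (fun x : Euc n => ‖x‖ ^ 2) (2 • (innerSL ℝ x : Euc n →L[ℝ] ℝ)) x :=
    (hasStrictFDerivAt_norm_sq x).hasFDerivAt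
  have h2 : HasFDerivAt (fun x : Euc n => -‖x‖ ^ 2 / 2)
      (-(innerSL ℝ x : Euc n →L[ℝ] ℝ)) x := by
    have h3 := h1.const_mul (-1 / 2 : ℝ)
    have e1 : (fun x : Euc n => -‖x‖ ^ 2 / 2) = fun x => (-1 / 2 : ℝ) * ‖x‖ ^ 2 := by
      ext; ring
    rw [e1]
    refine h3.congr_fderiv ?_
    ext y
    simp
    ring
  exact (h2.sub (hW x).hasFDerivAt).exp

lemma pd_wt {W : Euc n → ℝ} (hW : Differentiable ℝ W) (i : Fin n) (x : Euc n) :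
    pd i (wt W) x = -(wt W x * (x i + pd i W x)) := by
  rw [pd, (hasFDerivAt_wt hW x).fderiv]
  simp [pd, inner_single_one]
  ring

/-- Integration by parts for `mu W`. -/
lemma integral_pd {W g : Euc n → ℝ} (i : Fin n) (hW : Differentiable ℝ W)
    (h0 : ∀ x, 0 ≤ W x) (hWi : PG (pd i W)) (hg : Differentiable ℝ g) (hg0 : PG g)
    (hg1 : PG (pd i g)) :
    ∫ x, pd i g x ∂(mu W) = ∫ x, g x * (x i + pd i W x) ∂(mu W) := by
  have hc := hW.continuous
  have hp := hg0.mul ((PG.coord i).add hWi)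
  have key := integral_mul_fderiv_eq_neg_fderiv_mul_of_integrable (μ := (volume : Measure (Euc n)))
    (f := wt W) (g := g) (v := EuclideanSpace.single i 1) ?_ ?_ ?_
    (fun x _ => (hasFDerivAt_wt hW x).differentiableAt) (fun x _ => hg x)
  · rw [integral_mu hc, integral_mu hc]
    refine key.trans ?_
    rw [← integral_neg]
    congr 1
    ext x
    have := pd_wt hW i x
    rw [pd] at this
    rw [this]
    ring
  · have := (integrable_mu_iff hc _).1 (hp.integrable hc h0)
    refine this.neg.congr (.of_forall fun x => ?_)
    have h2 := pd_wt hW i x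
    rw [pd] at h2
    simp only [h2, Pi.neg_apply]
    ring
  · exact (integrable_mu_iff hc _).1 (hg1.integrable hc h0)
  · exact (integrable_mu_iff hc _).1 (hg0.integrable hc h0)

end GaussPQ
namespace GaussPQ

variable {n : ℕ}

/-- The plane wave `cos (⟪x, ξ⟫ + θ)`. -/
def trig (ξ : Euc n) (θ : ℝ) (x : Euc n) : ℝ := Real.cos (⟪x, ξ⟫ + θ)

/-- Real trigonometric polynomials with arbitrary frequencies. -/
def TF (n : ℕ) : Submodule ℝ (Euc n → ℝ) :=
  Submodule.span ℝ (Set.range fun a : Euc n × ℝ => trig a.1 a.2)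

lemma trig_mem (ξ : Euc n) (θ : ℝ) : trig ξ θ ∈ TF n := Submodule.subset_span ⟨(ξ, θ), rfl⟩

lemma hasDerivAt_cos_shift (θ s : ℝ) :
    HasDerivAt (fun s => Real.cos (s + θ)) (Real.cos (s + (θ + Real.pi / 2))) s := by
  have := (Real.hasDerivAt_cos (s + θ)).comp_add_const s θ
  rwa [← add_assoc, Real.cos_add_pi_div_two]

lemma pd_trig (ξ : Euc n) (θ : ℝ) (i : Fin n) :
    pd i (trig ξ θ) = fun x => ξ i * trig ξ (θ + Real.pi / 2) x := by
  have := pd_ridge (n := n) (hasDerivAt_cos_shift θ) ξ 0 i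
  simp only [add_zero] at this
  ext x
  rw [show trig ξ θ = fun x : Euc n => Real.cos (⟪x, ξ⟫ + θ) from rfl, this]
  simp only [trig]
  ring

lemma differentiable_trig (ξ : Euc n) (θ : ℝ) : Differentiable ℝ (trig ξ θ) := by
  have := differentiable_ridge (n := n) (hasDerivAt_cos_shift θ) ξ 0
  simp only [add_zero] at this
  exact this

namespace TF

lemma diff_bdd {u : Euc n → ℝ} (hu : u ∈ TF n) :
    Differentiable ℝ u ∧ ∃ C, ∀ x, |u x| ≤ C := by
  induction hu using Submodule.span_induction with
  | mem u h =>
    obtain ⟨a, rfl⟩ := h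
    exact ⟨differentiable_trig _ _, 1, fun x => Real.abs_cos_le_one _⟩
  | zero => exact ⟨differentiable_const _, 0, by simp⟩
  | add u v _ _ hu hv =>
    obtain ⟨du, C, hC⟩ := hu
    obtain ⟨dv, D, hD⟩ := hv
    exact ⟨du.add dv, C + D, fun x => (abs_add_le _ _).trans (add_le_add (hC x) (hD x))⟩
  | smul a u _ hu =>
    obtain ⟨du, C, hC⟩ := hu
    refine ⟨du.const_smul a, |a| * C, fun x => ?_⟩
    simp only [Pi.smul_apply, smul_eq_mul, abs_mul]
    exact mul_le_mul_of_nonneg_left (hC x) (abs_nonneg a)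

lemma diff {u : Euc n → ℝ} (hu : u ∈ TF n) : Differentiable ℝ u := (diff_bdd hu).1

lemma cont {u : Euc n → ℝ} (hu : u ∈ TF n) : Continuous u := (diff hu).continuous

lemma pg {u : Euc n → ℝ} (hu : u ∈ TF n) : PG u :=
  let ⟨_, hC⟩ := (diff_bdd hu).2
  PG.of_bounded (cont hu) hC

lemma pd_add' {u v : Euc n → ℝ} (hu : u ∈ TF n) (hv : v ∈ TF n) (i : Fin n) :
    pd i (u + v) = pd i u + pd i v := pd_add (diff hu) (diff hv) i

lemma pd_smul' {u : Euc n → ℝ} (hu : u ∈ TF n) (a : ℝ) (i : Fin n) :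
    pd i (a • u) = a • pd i u := pd_const_mul (diff hu) a i

lemma pd_zero' (i : Fin n) : pd i (0 : Euc n → ℝ) = 0 := by
  ext x; simp [pd]

lemma pd_mem {u : Euc n → ℝ} (hu : u ∈ TF n) (i : Fin n) : pd i u ∈ TF n := by
  induction hu using Submodule.span_induction with
  | mem u h =>
    obtain ⟨a, rfl⟩ := h
    rw [pd_trig]
    exact (TF n).smul_mem (a.1 i) (trig_mem a.1 _)
  | zero => rw [pd_zero']; exact (TF n).zero_mem
  | add u v hu hv h1 h2 => rw [pd_add' hu hv]; exact (TF n).add_mem h1 h2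
  | smul a u hu h1 => rw [pd_smul' hu]; exact (TF n).smul_mem a h1

lemma pd_comm {u : Euc n → ℝ} (hu : u ∈ TF n) (i j : Fin n) :
    pd i (pd j u) = pd j (pd i u) := by
  induction hu using Submodule.span_induction with
  | mem u h =>
    obtain ⟨a, rfl⟩ := h
    simp only [pd_trig, pd_const_mul (differentiable_trig _ _)]
    ext x
    ring
  | zero => simp only [pd_zero']
  | add u v hu hv h1 h2 =>
    simp only [pd_add' hu hv, pd_add' (pd_mem hu _) (pd_mem hv _), h1, h2]
  | smul a u hu h1 => simp only [pd_smul' hu, pd_smul' (pd_mem hu _), h1]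

lemma comp_neg {u : Euc n → ℝ} (hu : u ∈ TF n) : (fun x => u (-x)) ∈ TF n := by
  induction hu using Submodule.span_induction with
  | mem u h =>
    obtain ⟨a, rfl⟩ := h
    have : (fun x => trig a.1 a.2 (-x)) = trig (-a.1) a.2 := by
      ext x; simp [trig]
    simpa only [this] using trig_mem (-a.1) a.2
  | zero => exact (TF n).zero_mem
  | add u v hu hv h1 h2 => exact (TF n).add_mem h1 h2
  | smul a u hu h1 => exact (TF n).smul_mem a h1

end TF

lemma pd_comp_neg {u : Euc n → ℝ} (hu : Differentiable ℝ u) (i : Fin n) :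
    pd i (fun x => u (-x)) = fun x => -pd i u (-x) := by
  ext x
  have h := (hu (-x)).hasFDerivAt.comp x ((hasFDerivAt_id x).neg)
  have h2 : HasFDerivAt (fun x => u (-x))
    ((fderiv ℝ u (-x)).comp (-ContinuousLinearMap.id ℝ (Euc n))) x := h
  simp [pd, h2.fderiv]

/-- Nonnegative convex `C²` potentials with bounded first and second derivatives. -/
structure Pot (W : Euc n → ℝ) (M : ℝ) : Prop where
  diff : Differentiable ℝ W
  nonneg : ∀ x, 0 ≤ W x
  diff1 : ∀ i, Differentiable ℝ (pd i W)
  cont2 : ∀ i j, Continuous (pd j (pd i W))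
  bd1 : ∀ i x, |pd i W x| ≤ M
  bd2 : ∀ i j x, |pd j (pd i W) x| ≤ M
  psd : ∀ x (v : Fin n → ℝ), 0 ≤ ∑ i, ∑ j, pd j (pd i W) x * v i * v j

/-- The drift Laplacian symmetric with respect to `mu W`. -/
def Lap (W u : Euc n → ℝ) (x : Euc n) : ℝ :=
  ∑ i, (pd i (pd i u) x - (x i + pd i W x) * pd i u x)

namespace Pot

variable {W : Euc n → ℝ} {M : ℝ}

lemma pg1 (hW : Pot W M) (i : Fin n) : PG (pd i W) :=
  .of_bounded (hW.diff1 i).continuous (hW.bd1 i)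

lemma pg2 (hW : Pot W M) (i j : Fin n) : PG (pd j (pd i W)) :=
  .of_bounded (hW.cont2 i j) (hW.bd2 i j)

lemma int (hW : Pot W M) {g : Euc n → ℝ} (hg : PG g) : Integrable g (mu W) :=
  hg.integrable hW.diff.continuous hW.nonneg

lemma pg_lap (hW : Pot W M) {u : Euc n → ℝ} (hu : u ∈ TF n) : PG (Lap W u) :=
  PG.sum _ fun i => (TF.pg (TF.pd_mem (TF.pd_mem hu i) i)).sub
    (((PG.coord i).add (hW.pg1 i)).mul (TF.pg (TF.pd_mem hu i)))

lemma integral_mul_lap (hW : Pot W M) {g u : Euc n → ℝ} (hg : Differentiable ℝ g)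
    (hg0 : PG g) (hg1 : ∀ i, PG (pd i g)) (hu : u ∈ TF n) :
    ∫ x, g x * Lap W u x ∂(mu W) = -∫ x, ∑ i, pd i g x * pd i u x ∂(mu W) := by
  have hui := fun i => TF.pd_mem hu i
  have hi : ∀ i, ∫ x, g x * (pd i (pd i u) x - (x i + pd i W x) * pd i u x) ∂(mu W)
      = -∫ x, pd i g x * pd i u x ∂(mu W) := by
    intro i
    have hm := pd_mul hg (TF.diff (hui i)) i
    have hA := hW.int ((hg1 i).mul (TF.pg (hui i)))
    have hB := hW.int (hg0.mul (TF.pg (TF.pd_mem (hui i) i)))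
    have hC := hW.int ((hg0.mul (TF.pg (hui i))).mul ((PG.coord i).add (hW.pg1 i)))
    have key := integral_pd i hW.diff hW.nonneg (hW.pg1 i) (hg.fun_mul (TF.diff (hui i)))
      (hg0.mul (TF.pg (hui i))) (by
        rw [hm]
        exact ((hg1 i).mul (TF.pg (hui i))).add (hg0.mul (TF.pg (TF.pd_mem (hui i) i))))
    rw [hm, integral_add hA hB] at key
    have : ∀ x, g x * (pd i (pd i u) x - (x i + pd i W x) * pd i u x)
      = g x * pd i (pd i u) x - g x * pd i u x * (x i + pd i W x) := fun x => by ring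
    simp only [this]
    rw [integral_sub hB hC]
    linarith
  simp only [Lap, Finset.mul_sum]
  rw [integral_finsetSum, integral_finsetSum, ← Finset.sum_neg_distrib]
  · exact Finset.sum_congr rfl fun i _ => hi i
  · exact fun i _ => hW.int ((hg1 i).mul (TF.pg (hui i)))
  · exact fun i _ => hW.int (hg0.mul ((TF.pg (TF.pd_mem (hui i) i)).sub
      (((PG.coord i).add (hW.pg1 i)).mul (TF.pg (hui i)))))

lemma integral_lap (hW : Pot W M) {u : Euc n → ℝ} (hu : u ∈ TF n) :
    ∫ x, Lap W u x ∂(mu W) = 0 := by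
  have h0 : ∀ i : Fin n, pd i (fun _ : Euc n => (1 : ℝ)) = fun _ => 0 := by
    intro i; ext x; simp [pd]
  have := hW.integral_mul_lap (g := fun _ => 1) (differentiable_const _) (PG.const 1)
    (fun i => by rw [h0]; exact PG.const 0) hu
  simpa [h0] using this

lemma diff_lap (hW : Pot W M) {u : Euc n → ℝ} (hu : u ∈ TF n) :
    Differentiable ℝ (Lap W u) := by
  unfold Lap
  refine Differentiable.fun_sum fun i _ => ?_
  have h1 := TF.diff (TF.pd_mem (TF.pd_mem hu i) i)
  have h2 := TF.diff (TF.pd_mem hu i)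
  have h3 := hW.diff1 i
  fun_prop

lemma pd_lap (hW : Pot W M) {u : Euc n → ℝ} (hu : u ∈ TF n) (j : Fin n) :
    pd j (Lap W u) = fun x => Lap W (pd j u) x - pd j u x
      - ∑ i, pd j (pd i W) x * pd i u x := by
  have hd : ∀ i : Fin n, Differentiable ℝ (fun x : Euc n => x i + pd i W x) := fun i => by
    have := hW.diff1 i
    fun_prop
  have hx : ∀ i : Fin n, Differentiable ℝ (fun x : Euc n => x i) := fun i => by fun_prop
  have h1 := fun i => TF.diff (TF.pd_mem (TF.pd_mem hu i) i)
  have h2 := fun i => TF.diff (TF.pd_mem hu i)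
  have e : ∀ i, pd j (fun x => pd i (pd i u) x - (x i + pd i W x) * pd i u x)
      = fun x => pd i (pd i (pd j u)) x - (x i + pd i W x) * pd i (pd j u) x
        - (if i = j then pd j u x else 0) - pd j (pd i W) x * pd i u x := by
    intro i
    rw [pd_sub (h1 i) ((hd i).fun_mul (h2 i)), pd_mul (hd i) (h2 i), pd_add (hx i) (hW.diff1 i),
      pd_coord]
    ext x
    rw [TF.pd_comm (TF.pd_mem hu i) j i, TF.pd_comm hu j i]
    by_cases h : i = j
    · subst h; simp; ring
    · simp [h]; ring
  rw [show Lap W u = fun x => ∑ i, (pd i (pd i u) x - (x i + pd i W x) * pd i u x) from rfl,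
    pd_sum _ (fun i => (h1 i).fun_sub ((hd i).fun_mul (h2 i)))]
  ext x
  simp only [e, Lap, Finset.sum_sub_distrib]
  simp

/-- The integrated Bochner formula. -/
lemma bochner (hW : Pot W M) {u : Euc n → ℝ} (hu : u ∈ TF n) :
    ∫ x, Lap W u x ^ 2 ∂(mu W) = ∫ x, ∑ j, ∑ i, pd i (pd j u) x ^ 2 ∂(mu W)
      + ∫ x, ∑ j, pd j u x ^ 2 ∂(mu W)
      + ∫ x, ∑ i, ∑ j, pd j (pd i W) x * pd i u x * pd j u x ∂(mu W) := by
  have hj := fun j => TF.pd_mem hu j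
  have p1 : ∀ j, PG (pd j u) := fun j => TF.pg (hj j)
  have p2 : ∀ j i, PG (pd i (pd j u)) := fun j i => TF.pg (TF.pd_mem (hj j) i)
  have pS : ∀ j, PG (fun x => ∑ i, pd j (pd i W) x * pd i u x) := fun j =>
    PG.sum _ fun i => (hW.pg2 i j).mul (p1 i)
  have pL : ∀ j, PG (pd j (Lap W u)) := fun j => by
    rw [hW.pd_lap hu]
    exact ((hW.pg_lap (hj j)).sub (p1 j)).sub (pS j)
  have h1 := hW.integral_mul_lap (hW.diff_lap hu) (hW.pg_lap hu) pL hu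
  have h2 : ∀ j, ∫ x, pd j (Lap W u) x * pd j u x ∂(mu W)
      = -∫ x, ∑ i, pd i (pd j u) x ^ 2 ∂(mu W) - ∫ x, pd j u x ^ 2 ∂(mu W)
        - ∫ x, ∑ i, pd j (pd i W) x * pd i u x * pd j u x ∂(mu W) := by
    intro j
    have h3 := hW.integral_mul_lap (TF.diff (hj j)) (p1 j) (p2 j) (hj j)
    have e : ∀ x, pd j (Lap W u) x * pd j u x = pd j u x * Lap W (pd j u) x - pd j u x ^ 2
        - ∑ i, pd j (pd i W) x * pd i u x * pd j u x := by
      intro x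
      rw [hW.pd_lap hu, ← Finset.sum_mul]
      ring
    have i1 := hW.int ((p1 j).mul (hW.pg_lap (hj j)))
    have i2 := hW.int ((p1 j).pow 2)
    have i3 := hW.int (PG.sum Finset.univ fun i => ((hW.pg2 i j).mul (p1 i)).mul (p1 j))
    simp only [e]
    have i12 := hW.int (((p1 j).mul (hW.pg_lap (hj j))).sub ((p1 j).pow 2))
    rw [integral_sub i12 i3, integral_sub i1 i2, h3]
    simp only [sq]
  have h4 : ∀ x, Lap W u x ^ 2 = Lap W u x * Lap W u x := fun x => sq _
  simp only [h4]
  rw [h1, integral_finsetSum _ (fun j _ => hW.int ((pL j).mul (p1 j)))]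
  simp only [h2, Finset.sum_sub_distrib, Finset.sum_neg_distrib]
  rw [← integral_finsetSum _ (fun j _ => hW.int (PG.sum _ fun i => (p2 j i).pow 2)),
    ← integral_finsetSum _ (fun j _ => hW.int ((p1 j).pow 2)),
    ← integral_finsetSum _ (fun j _ => hW.int
      (PG.sum _ fun i => ((hW.pg2 i j).mul (p1 i)).mul (p1 j)))]
  have e5 : ∀ x, ∑ j, ∑ i, pd j (pd i W) x * pd i u x * pd j u x
    = ∑ i, ∑ j, pd j (pd i W) x * pd i u x * pd j u x := fun x => Finset.sum_comm
  simp only [e5]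
  ring

lemma integral_grad_sq_le (hW : Pot W M) {u : Euc n → ℝ} (hu : u ∈ TF n) :
    ∫ x, ∑ j, pd j u x ^ 2 ∂(mu W) ≤ ∫ x, Lap W u x ^ 2 ∂(mu W) := by
  rw [hW.bochner hu]
  have h1 : 0 ≤ ∫ x, ∑ j, ∑ i, pd i (pd j u) x ^ 2 ∂(mu W) :=
    integral_nonneg fun x => Finset.sum_nonneg fun j _ => Finset.sum_nonneg fun i _ => sq_nonneg _
  have h2 : 0 ≤ ∫ x, ∑ i, ∑ j, pd j (pd i W) x * pd i u x * pd j u x ∂(mu W) :=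
    integral_nonneg fun x => hW.psd x fun i => pd i u x
  linarith

end Pot

end GaussPQ
namespace GaussPQ

variable {n : ℕ}

lemma pot_zero : Pot (fun _ : Euc n => (0 : ℝ)) 0 := by
  have h0 : ∀ i : Fin n, pd i (fun _ : Euc n => (0 : ℝ)) = fun _ => 0 := by
    intro i; ext x; simp [pd]
  constructor <;> simp [h0, continuous_const]

/-- A finite signed measure whose cosine transforms all vanish is zero. -/
lemma ae_eq_zero_of_integral_cos {ν : Measure (Euc n)} [IsFiniteMeasure ν] {w : Euc n → ℝ}
    (hw : Integrable w ν)
    (h : ∀ (ξ : Euc n) (θ : ℝ), ∫ x, Real.cos (⟪x, ξ⟫ + θ) * w x ∂ν = 0) :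
    w =ᵐ[ν] 0 := by
  have hm := hw.aestronglyMeasurable.aemeasurable
  have mp : AEMeasurable (fun x => ENNReal.ofReal (w x)) ν := hm.ennreal_ofReal
  have mn : AEMeasurable (fun x => ENNReal.ofReal (-w x)) ν := hm.neg.ennreal_ofReal
  have fp : ∫⁻ x, ENNReal.ofReal (w x) ∂ν ≠ ⊤ := hw.lintegral_lt_top.ne
  have fn : ∫⁻ x, ENNReal.ofReal (-w x) ∂ν ≠ ⊤ := hw.neg.lintegral_lt_top.ne
  have : IsFiniteMeasure (ν.withDensity fun x => ENNReal.ofReal (w x)) :=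
    isFiniteMeasure_withDensity fp
  have : IsFiniteMeasure (ν.withDensity fun x => ENNReal.ofReal (-w x)) :=
    isFiniteMeasure_withDensity fn
  have hcf : (ν.withDensity fun x => ENNReal.ofReal (w x))
      = ν.withDensity fun x => ENNReal.ofReal (-w x) := by
    refine Measure.ext_of_charFun (funext fun t => ?_)
    rw [charFun_apply, charFun_apply,
      integral_withDensity_eq_integral_toReal_smul₀ mp (by simp),
      integral_withDensity_eq_integral_toReal_smul₀ mn (by simp), ← sub_eq_zero]
    have hb : ∀ v : Euc n → ℝ, Integrable v ν →
        Integrable (fun x => (ENNReal.ofReal (v x)).toReal • Complex.exp (⟪x, t⟫ * Complex.I)) ν := by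
      intro v hv
      have h1 : Integrable (fun x => (ENNReal.ofReal (v x)).toReal) ν := by
        simpa [ENNReal.toReal_ofReal'] using hv.pos_part
      refine Integrable.mono h1 ?_ (.of_forall fun x => ?_)
      · exact h1.aestronglyMeasurable.smul
          (Continuous.aestronglyMeasurable (by fun_prop))
      · rw [norm_smul, Complex.norm_exp_ofReal_mul_I, mul_one]
    have hn : Integrable (fun x => -w x) ν := hw.neg
    rw [← integral_sub (hb w hw) (hb _ hn)]
    have e : ∀ x, (ENNReal.ofReal (w x)).toReal • Complex.exp (⟪x, t⟫ * Complex.I)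
        - (ENNReal.ofReal (-w x)).toReal • Complex.exp (⟪x, t⟫ * Complex.I)
        = ((Real.cos (⟪x, t⟫ + 0) * w x : ℝ) : ℂ)
          + ((Real.cos (⟪x, t⟫ + (-(Real.pi / 2))) * w x : ℝ) : ℂ) * Complex.I := by
      intro x
      have e1 : (ENNReal.ofReal (w x)).toReal - (ENNReal.ofReal (-w x)).toReal = w x := by
        rw [ENNReal.toReal_ofReal', ENNReal.toReal_ofReal']
        exact max_zero_sub_max_neg_zero_eq_self (w x)
      rw [← sub_smul, e1, Complex.exp_mul_I, ← sub_eq_add_neg, Real.cos_sub_pi_div_two, add_zero,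
        Complex.real_smul, ← Complex.ofReal_cos, ← Complex.ofReal_sin]
      push_cast
      ring
    have hc : ∀ θ, Integrable (fun x => Real.cos (⟪x, t⟫ + θ) * w x) ν := by
      intro θ
      refine hw.mono (Continuous.aestronglyMeasurable (by fun_prop) |>.mul
        hw.aestronglyMeasurable) (.of_forall fun x => ?_)
      rw [norm_mul]
      exact mul_le_of_le_one_left (norm_nonneg _) (Real.abs_cos_le_one _)
    simp only [e]
    rw [integral_add (hc _).ofReal ((hc _).ofReal.mul_const _), integral_mul_const,
      integral_complex_ofReal, integral_complex_ofReal, h, h]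
    simp
  rw [withDensity_eq_iff mp mn fp] at hcf
  filter_upwards [hcf] with x hx
  change w x = 0
  rcases le_total 0 (w x) with h0 | h0
  · rw [ENNReal.ofReal_of_nonpos (by linarith : -w x ≤ 0), ENNReal.ofReal_eq_zero] at hx
    exact le_antisymm hx h0
  · rw [ENNReal.ofReal_of_nonpos h0, eq_comm, ENNReal.ofReal_eq_zero] at hx
    exact le_antisymm h0 (by linarith)

lemma lap_zero_trig (ξ : Euc n) (θ s : ℝ) (x : Euc n) :
    Lap (fun _ => 0) (trig (s • ξ) θ) x
      = s * (⟪x, ξ⟫ * Real.sin (s * ⟪x, ξ⟫ + θ)) - s ^ 2 * ‖ξ‖ ^ 2 * Real.cos (s * ⟪x, ξ⟫ + θ) := by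
  have h0 : ∀ i : Fin n, pd i (fun _ : Euc n => (0 : ℝ)) = fun _ => 0 := by
    intro i; ext x; simp [pd]
  have hx : ⟪x, ξ⟫ = ∑ i, x i * ξ i := by
    simp [PiLp.inner_apply, mul_comm]
  simp only [Lap, pd_trig, pd_const_mul (differentiable_trig _ _), h0]
  simp only [trig, inner_smul_right, PiLp.smul_apply, smul_eq_mul]
  simp only [← add_assoc, Real.cos_add_pi_div_two, Real.sin_add_pi_div_two]
  generalize Real.cos (s * ⟪x, ξ⟫ + θ) = C
  generalize Real.sin (s * ⟪x, ξ⟫ + θ) = S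
  rw [hx, EuclideanSpace.real_norm_sq_eq, Finset.sum_mul, Finset.mul_sum, Finset.mul_sum,
    Finset.sum_mul, ← Finset.sum_sub_distrib]
  refine Finset.sum_congr rfl fun i _ => ?_
  ring

lemma PG.memLp {W : Euc n → ℝ} (hW : Continuous W) (h0 : ∀ x, 0 ≤ W x)
    {g : Euc n → ℝ} (hg : PG g) : MemLp g 2 (mu W) :=
  (memLp_two_iff_integrable_sq hg.1.aestronglyMeasurable).2 ((hg.pow 2).integrable hW h0)

lemma lap_add {W u v : Euc n → ℝ} (hu : u ∈ TF n) (hv : v ∈ TF n) (x : Euc n) :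
    Lap W (u + v) x = Lap W u x + Lap W v x := by
  simp only [Lap, TF.pd_add' hu hv, TF.pd_add' (TF.pd_mem hu _) (TF.pd_mem hv _), Pi.add_apply,
    ← Finset.sum_add_distrib]
  exact Finset.sum_congr rfl fun i _ => by ring

lemma lap_smul {W u : Euc n → ℝ} (hu : u ∈ TF n) (a : ℝ) (x : Euc n) :
    Lap W (a • u) x = a * Lap W u x := by
  simp only [Lap, TF.pd_smul' hu, TF.pd_smul' (TF.pd_mem hu _), Pi.smul_apply, smul_eq_mul,
    Finset.mul_sum]
  exact Finset.sum_congr rfl fun i _ => by ring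

lemma lap_zero {W : Euc n → ℝ} (x : Euc n) : Lap W 0 x = 0 := by
  simp [Lap, TF.pd_zero']

/-- The functions `Lap W u + c` are dense in `L²(mu W)`. -/
def LapDense (W : Euc n → ℝ) : Prop :=
  ∀ f, PG f → ∀ η > 0, ∃ u ∈ TF n, ∃ c : ℝ, ∫ x, (f x - Lap W u x - c) ^ 2 ∂(mu W) ≤ η

lemma hasDerivAt_integral_cos {ν : Measure (Euc n)} {w : Euc n → ℝ} (ξ : Euc n) (θ : ℝ)
    (hw : AEStronglyMeasurable w ν)
    (h0 : ∀ s : ℝ, Integrable (fun x => Real.cos (s * ⟪x, ξ⟫ + θ) * w x) ν)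
    (h1 : Integrable (fun x => ⟪x, ξ⟫ * w x) ν) (s : ℝ) :
    HasDerivAt (fun s : ℝ => ∫ x, Real.cos (s * ⟪x, ξ⟫ + θ) * w x ∂ν)
      (∫ x, -(⟪x, ξ⟫ * Real.sin (s * ⟪x, ξ⟫ + θ)) * w x ∂ν) s := by
  refine (hasDerivAt_integral_of_dominated_loc_of_deriv_le (s := Set.univ)
    (F := fun (s : ℝ) x => Real.cos (s * ⟪x, ξ⟫ + θ) * w x)
    (F' := fun (s : ℝ) x => -(⟪x, ξ⟫ * Real.sin (s * ⟪x, ξ⟫ + θ)) * w x)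
    (bound := fun x => |⟪x, ξ⟫ * w x|) Filter.univ_mem
    (.of_forall fun s => (h0 s).aestronglyMeasurable) (h0 s) ?_
    (.of_forall fun x s _ => ?_) h1.abs (.of_forall fun x s _ => ?_)).2
  · exact (Continuous.aestronglyMeasurable (by fun_prop)).mul hw
  · have hs := Real.abs_sin_le_one (s * ⟪x, ξ⟫ + θ)
    rw [Real.norm_eq_abs, abs_mul, abs_neg, abs_mul, abs_mul, mul_right_comm]
    exact mul_le_of_le_one_right (by positivity) hs
  · have h1 : HasDerivAt (fun s : ℝ => s * ⟪x, ξ⟫ + θ) (⟪x, ξ⟫) s := by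
      simpa using ((hasDerivAt_id s).mul_const (⟪x, ξ⟫)).add_const θ
    have h2 := (h1.cos).mul_const (w x)
    refine h2.congr_deriv ?_
    ring

lemma gaussian_orthogonal {w : Euc n → ℝ} (hw : MemLp w 2 (mu fun _ => 0))
    (h : ∀ u ∈ TF n, ∀ c : ℝ, ∫ x, (Lap (fun _ => 0) u x + c) * w x ∂(mu fun _ => 0) = 0) :
    w =ᵐ[mu fun _ => 0] 0 := by
  set ν : Measure (Euc n) := mu fun _ => 0 with hν
  have hc0 : Continuous (fun _ : Euc n => (0 : ℝ)) := continuous_const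
  have : IsFiniteMeasure ν := isFiniteMeasure_mu hc0 (fun _ => le_rfl)
  have hwi : Integrable w ν := hw.integrable (by norm_num)
  have hpg : ∀ g : Euc n → ℝ, PG g → Integrable (fun x => g x * w x) ν := fun g hg =>
    (hg.memLp hc0 (fun _ => le_rfl)).integrable_mul hw
  have pin : ∀ ξ : Euc n, PG (fun x : Euc n => ⟪x, ξ⟫) := fun ξ =>
    ⟨by fun_prop, ‖ξ‖, 1, fun x => (abs_real_inner_le_norm x ξ).trans (by
      nlinarith [norm_nonneg x, norm_nonneg ξ])⟩
  refine ae_eq_zero_of_integral_cos hwi fun ξ θ => ?_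
  have pcos : ∀ s : ℝ, PG (fun x : Euc n => Real.cos (s * ⟪x, ξ⟫ + θ)) := fun s =>
    .of_bounded (by fun_prop) (fun x => Real.abs_cos_le_one _)
  have psin : ∀ s : ℝ, PG (fun x : Euc n => Real.sin (s * ⟪x, ξ⟫ + θ)) := fun s =>
    .of_bounded (by fun_prop) (fun x => Real.abs_sin_le_one _)
  set g : ℝ → ℝ := fun s => ∫ x, Real.cos (s * ⟪x, ξ⟫ + θ) * w x ∂ν with hg
  set g' : ℝ → ℝ := fun s => ∫ x, -(⟪x, ξ⟫ * Real.sin (s * ⟪x, ξ⟫ + θ)) * w x ∂ν with hg'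
  have hd : ∀ s, HasDerivAt g (g' s) s :=
    hasDerivAt_integral_cos ξ θ hwi.aestronglyMeasurable (fun s => hpg _ (pcos s)) (hpg _ (pin ξ))
  have hode : ∀ s, s ≠ 0 → g' s = -s * ‖ξ‖ ^ 2 * g s := by
    intro s hs
    have h1 := h _ (trig_mem (s • ξ) θ) 0
    have e : ∀ x, (Lap (fun _ => 0) (trig (s • ξ) θ) x + 0) * w x
        = -s * (-(⟪x, ξ⟫ * Real.sin (s * ⟪x, ξ⟫ + θ)) * w x)
          - s ^ 2 * ‖ξ‖ ^ 2 * (Real.cos (s * ⟪x, ξ⟫ + θ) * w x) := by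
      intro x; rw [lap_zero_trig]; ring
    simp only [e] at h1
    rw [integral_sub ((hpg _ ((pin ξ).mul (psin s)).neg).const_mul _)
      ((hpg _ (pcos s)).const_mul _), integral_const_mul, integral_const_mul] at h1
    have h2 : s * (g' s + s * ‖ξ‖ ^ 2 * g s) = 0 := by
      simp only [hg, hg']; linarith
    rcases mul_eq_zero.1 h2 with h3 | h3
    · exact absurd h3 hs
    · linarith
  set G : ℝ → ℝ := fun s => g s * Real.exp (s ^ 2 / 2 * ‖ξ‖ ^ 2) with hG
  have hGd : ∀ s, HasDerivAt G (g' s * Real.exp (s ^ 2 / 2 * ‖ξ‖ ^ 2)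
      + g s * (Real.exp (s ^ 2 / 2 * ‖ξ‖ ^ 2) * (s * ‖ξ‖ ^ 2))) s := by
    intro s
    refine (hd s).mul (HasDerivAt.exp ?_)
    have := (((hasDerivAt_id s).pow 2).div_const 2).mul_const (‖ξ‖ ^ 2)
    refine this.congr_deriv ?_
    simp
  obtain ⟨s, hs, hs2⟩ := exists_hasDerivAt_eq_slope G _ (zero_lt_one)
    (fun s _ => (hGd s).continuousAt.continuousWithinAt) (fun s _ => hGd s)
  rw [hode s hs.1.ne'] at hs2
  have hw0 : ∫ x, w x ∂ν = 0 := by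
    have := h 0 (TF n).zero_mem 1
    simpa [lap_zero] using this
  have hg0 : g 0 = 0 := by
    simp only [hg, zero_mul, zero_add]
    rw [integral_const_mul, hw0, mul_zero]
  have hG1 : G 1 = 0 := by
    have : G 0 = 0 := by simp [hG, hg0]
    rw [this] at hs2
    have e2 : (0 : ℝ) = (G 1 - 0) / (1 - 0) := by
      rw [← hs2]; ring
    simpa using e2.symm
  have hg1 : g 1 = 0 := by
    rcases mul_eq_zero.1 hG1 with h3 | h3
    · exact h3
    · exact absurd h3 (Real.exp_pos _).ne'
  simpa [hg] using hg1

lemma lapDense_zero : LapDense (fun _ : Euc n => (0 : ℝ)) := by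
  intro f hf η hη
  set ν : Measure (Euc n) := mu fun _ => 0 with hν
  have hP := pot_zero (n := n)
  have hc0 : Continuous (fun _ : Euc n => (0 : ℝ)) := continuous_const
  have hL : ∀ u ∈ TF n, ∀ c : ℝ, MemLp (fun x => Lap (fun _ => 0) u x + c) 2 ν :=
    fun u hu c => ((hP.pg_lap hu).add (PG.const c)).memLp hc0 fun _ => le_rfl
  let M : Submodule ℝ (Lp ℝ 2 ν) :=
    { carrier := {m | ∃ u ∈ TF n, ∃ c : ℝ, m =ᵐ[ν] fun x => Lap (fun _ => 0) u x + c}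
      add_mem' := by
        rintro a b ⟨u, hu, c, h1⟩ ⟨v, hv, d, h2⟩
        refine ⟨u + v, (TF n).add_mem hu hv, c + d, ?_⟩
        filter_upwards [Lp.coeFn_add a b, h1, h2] with x h3 h4 h5
        rw [h3, Pi.add_apply, h4, h5, lap_add hu hv]
        ring
      zero_mem' := by
        refine ⟨0, (TF n).zero_mem, 0, ?_⟩
        filter_upwards [Lp.coeFn_zero ℝ 2 ν] with x h3
        rw [h3, lap_zero, add_zero, Pi.zero_apply]
      smul_mem' := by
        rintro a m ⟨u, hu, c, h1⟩
        refine ⟨a • u, (TF n).smul_mem a hu, a * c, ?_⟩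
        filter_upwards [Lp.coeFn_smul a m, h1] with x h3 h4
        rw [h3, Pi.smul_apply, h4, lap_smul hu, smul_eq_mul]
        ring }
  have hMtop : M.topologicalClosure = ⊤ := by
    rw [Submodule.topologicalClosure_eq_top_iff, Submodule.eq_bot_iff]
    intro w hw
    rw [Submodule.mem_orthogonal] at hw
    rw [Lp.eq_zero_iff_ae_eq_zero]
    refine gaussian_orthogonal (Lp.memLp w) fun u hu c => ?_
    have h1 := hw ((hL u hu c).toLp _) ⟨u, hu, c, (hL u hu c).coeFn_toLp⟩
    rw [L2.inner_def] at h1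
    refine Eq.trans (integral_congr_ae ?_) h1
    filter_upwards [(hL u hu c).coeFn_toLp] with x hx
    rw [hx]
    simp [mul_comm]
  have hfm := hf.memLp hc0 (fun _ => le_rfl)
  have hmem : hfm.toLp f ∈ M.topologicalClosure := hMtop ▸ Submodule.mem_top
  have hmem' : hfm.toLp f ∈ closure (M : Set (Lp ℝ 2 ν)) := hmem
  obtain ⟨m, ⟨u, hu, c, hm⟩, hd⟩ := Metric.mem_closure_iff.1 hmem' (√η) (Real.sqrt_pos.2 hη)
  refine ⟨u, hu, c, ?_⟩
  have h2 : ∫ x, (f x - Lap (fun _ => 0) u x - c) ^ 2 ∂ν = ‖hfm.toLp f - m‖ ^ 2 := by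
    rw [← real_inner_self_eq_norm_sq, L2.inner_def]
    refine integral_congr_ae ?_
    filter_upwards [hm, hfm.coeFn_toLp, Lp.coeFn_sub (hfm.toLp f) m] with x h3 h4 h5
    rw [h5, Pi.sub_apply, h3, h4]
    simp
    ring
  rw [h2, ← dist_eq_norm]
  calc dist (hfm.toLp f) m ^ 2 ≤ √η ^ 2 := by gcongr
    _ = η := Real.sq_sqrt hη.le

end GaussPQ
namespace GaussPQ

variable {n : ℕ}

lemma Pot.smul {W : Euc n → ℝ} {M : ℝ} (hW : Pot W M) {a : ℝ} (ha : 0 ≤ a) :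
    Pot (fun x => a * W x) (a * M) := by
  have h1 : ∀ i, pd i (fun x => a * W x) = fun x => a * pd i W x := pd_const_mul hW.diff a
  have h2 : ∀ i j, pd j (pd i (fun x => a * W x)) = fun x => a * pd j (pd i W) x := fun i j => by
    rw [h1, pd_const_mul (hW.diff1 i)]
  refine ⟨hW.diff.const_mul a, fun x => mul_nonneg ha (hW.nonneg x), fun i => ?_, fun i j => ?_,
    fun i x => ?_, fun i j x => ?_, fun x v => ?_⟩
  · rw [h1]; exact (hW.diff1 i).const_mul a
  · rw [h2]; exact (hW.cont2 i j).const_mul a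
  · rw [h1, abs_mul, abs_of_nonneg ha]; exact mul_le_mul_of_nonneg_left (hW.bd1 i x) ha
  · rw [h2, abs_mul, abs_of_nonneg ha]; exact mul_le_mul_of_nonneg_left (hW.bd2 i j x) ha
  · have := mul_nonneg ha (hW.psd x v)
    simp only [Finset.mul_sum] at this
    simpa only [h2, mul_assoc] using this

lemma Pot.integral_add_sq_le {W : Euc n → ℝ} {M : ℝ} (hW : Pot W M) {f g : Euc n → ℝ}
    (hf : PG f) (hg : PG g) :
    ∫ x, (f x + g x) ^ 2 ∂(mu W) ≤ 2 * ∫ x, f x ^ 2 ∂(mu W) + 2 * ∫ x, g x ^ 2 ∂(mu W) := by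
  have hf2 := (hW.int (hf.pow 2)).const_mul 2
  have hg2 := (hW.int (hg.pow 2)).const_mul 2
  rw [← integral_const_mul, ← integral_const_mul, ← integral_add hf2 hg2]
  refine integral_mono (hW.int ((hf.add hg).pow 2)) (hf2.add hg2) fun x => ?_
  simp only
  nlinarith [sq_nonneg (f x - g x)]

lemma integral_mu_anti {W W' : Euc n → ℝ} {M M' : ℝ} (hW : Pot W M) (hW' : Pot W' M')
    (h : ∀ x, W x ≤ W' x) {g : Euc n → ℝ} (hg : PG g) (hg0 : ∀ x, 0 ≤ g x) :
    ∫ x, g x ∂(mu W') ≤ ∫ x, g x ∂(mu W) := by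
  have c := hW.diff.continuous
  have c' := hW'.diff.continuous
  rw [integral_mu c, integral_mu c']
  refine integral_mono ((integrable_mu_iff c' _).1 (hW'.int hg)) ((integrable_mu_iff c _).1 (hW.int hg))
    fun x => ?_
  refine mul_le_mul_of_nonneg_right ?_ (hg0 x)
  simp only [wt]
  gcongr
  exact h x

lemma lap_perturb {W W0 W' : Euc n → ℝ} {δ : ℝ} (hW : Differentiable ℝ W)
    (hW0 : Differentiable ℝ W0) (e : W' = fun x => W x + δ * W0 x) (u : Euc n → ℝ) (x : Euc n) :
    Lap W u x = Lap W' u x + δ * ∑ i, pd i W0 x * pd i u x := by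
  have h1 : ∀ i, pd i W' = fun x => pd i W x + δ * pd i W0 x := fun i => by
    rw [e, pd_add hW (hW0.const_mul δ), pd_const_mul hW0]
  simp only [Lap, h1, Finset.mul_sum, ← Finset.sum_add_distrib]
  exact Finset.sum_congr rfl fun i _ => by ring

lemma Pot.integral_grad_mul_sq_le {W W0 : Euc n → ℝ} {M M0 δ : ℝ} (hW : Pot W M)
    (hW0 : Pot W0 M0) {u : Euc n → ℝ} (hu : u ∈ TF n) :
    ∫ x, (δ * ∑ i, pd i W0 x * pd i u x) ^ 2 ∂(mu W)
      ≤ δ ^ 2 * n * M0 ^ 2 * ∫ x, Lap W u x ^ 2 ∂(mu W) := by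
  have p1 := fun i => TF.pg (TF.pd_mem hu i)
  calc ∫ x, (δ * ∑ i, pd i W0 x * pd i u x) ^ 2 ∂(mu W)
      ≤ ∫ x, δ ^ 2 * n * M0 ^ 2 * ∑ i, pd i u x ^ 2 ∂(mu W) := by
        refine integral_mono (hW.int (((PG.const δ).mul
          (PG.sum _ fun i => (hW0.pg1 i).mul (p1 i))).pow 2))
          ((hW.int (PG.sum _ fun i => (p1 i).pow 2)).const_mul _) fun x => ?_
        have h1 := Finset.sum_mul_sq_le_sq_mul_sq Finset.univ (fun i => pd i W0 x)
          (fun i => pd i u x)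
        have h2 : ∑ i, pd i W0 x ^ 2 ≤ n * M0 ^ 2 := by
          calc ∑ i, pd i W0 x ^ 2 ≤ ∑ _i : Fin n, M0 ^ 2 := Finset.sum_le_sum fun i _ =>
                sq_le_sq' (abs_le.1 (hW0.bd1 i x)).1 (abs_le.1 (hW0.bd1 i x)).2
            _ = n * M0 ^ 2 := by simp
        have h3 : 0 ≤ ∑ i, pd i u x ^ 2 := Finset.sum_nonneg fun i _ => sq_nonneg _
        simp only
        rw [mul_pow, mul_assoc (δ ^ 2), mul_assoc (δ ^ 2)]
        exact mul_le_mul_of_nonneg_left (h1.trans (mul_le_mul_of_nonneg_right h2 h3))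
          (sq_nonneg _)
    _ = δ ^ 2 * n * M0 ^ 2 * ∫ x, ∑ i, pd i u x ^ 2 ∂(mu W) := integral_const_mul _ _
    _ ≤ _ := mul_le_mul_of_nonneg_left (hW.integral_grad_sq_le hu) (by positivity)

lemma Pot.integral_lap_sq_le {W : Euc n → ℝ} {M : ℝ} (hW : Pot W M) {u : Euc n → ℝ}
    (hu : u ∈ TF n) (c : ℝ) :
    ∫ x, Lap W u x ^ 2 ∂(mu W) ≤ ∫ x, (Lap W u x + c) ^ 2 ∂(mu W) := by
  have pL := hW.pg_lap hu
  have h1 : ∫ x, Lap W u x ^ 2 ∂(mu W) = ∫ x, (Lap W u x ^ 2 + 2 * c * Lap W u x) ∂(mu W) := by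
    rw [integral_add (hW.int (pL.pow 2)) ((hW.int pL).const_mul _), integral_const_mul,
      hW.integral_lap hu]
    ring
  rw [h1]
  refine integral_mono ((hW.int (pL.pow 2)).add ((hW.int pL).const_mul _))
    (hW.int ((pL.add (PG.const c)).pow 2)) fun x => ?_
  simp only
  nlinarith [sq_nonneg c]

/-- One step of the continuity method: approximate solvability survives small perturbations. -/
lemma LapDense.perturb {W W0 W' : Euc n → ℝ} {M M0 M' δ : ℝ} (hW : Pot W M) (hW0 : Pot W0 M0)
    (hW' : Pot W' M') (hδ0 : 0 ≤ δ) (hδ : 8 * (δ ^ 2 * n * M0 ^ 2) ≤ 1)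
    (e : W' = fun x => W x + δ * W0 x) (hd : LapDense W) : LapDense W' := by
  have key : ∀ k : ℕ, ∀ f, PG f → ∀ η > 0, ∃ u ∈ TF n, ∃ c : ℝ, ∃ g, PG g ∧
      ∫ x, (f x - Lap W' u x - c - g x) ^ 2 ∂(mu W) ≤ η ∧
      ∫ x, g x ^ 2 ∂(mu W) ≤ (1 / 4) ^ k * (∫ x, f x ^ 2 ∂(mu W)) + η := by
    intro k
    induction k with
    | zero =>
      intro f hf η hη
      refine ⟨0, (TF n).zero_mem, 0, f, hf, ?_, ?_⟩
      · simpa [lap_zero] using hη.le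
      · simpa using hη.le
    | succ k ih =>
      intro f hf η hη
      obtain ⟨u, hu, c, g, hg, h1, h2⟩ := ih f hf (η / 4) (by positivity)
      obtain ⟨u2, hu2, c2, h3⟩ := hd g hg (η / 4) (by positivity)
      have pL := hW.pg_lap hu2
      have p3 := (hg.sub pL).sub (PG.const c2)
      refine ⟨u + u2, (TF n).add_mem hu hu2, c + c2,
        fun x => δ * ∑ i, pd i W0 x * pd i u2 x,
        (PG.const δ).mul (PG.sum _ fun i => (hW0.pg1 i).mul (TF.pg (TF.pd_mem hu2 i))), ?_, ?_⟩
      · have h4 := hW.integral_add_sq_le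
          (((hf.sub (hW'.pg_lap hu)).sub (PG.const c)).sub hg) p3
        have e5 : ∀ x, f x - Lap W' (u + u2) x - (c + c2) - δ * ∑ i, pd i W0 x * pd i u2 x
            = (f x - Lap W' u x - c - g x) + (g x - Lap W u2 x - c2) := fun x => by
          rw [lap_add hu hu2, lap_perturb hW.diff hW0.diff e u2 x]
          ring
        simp only [e5]
        linarith
      · have h4 := hW.integral_grad_mul_sq_le (δ := δ) hW0 hu2
        have h5 := hW.integral_lap_sq_le hu2 c2
        have h6 := hW.integral_add_sq_le hg p3.neg
        have e6 : ∀ x, (g x + -(g x - Lap W u2 x - c2)) = Lap W u2 x + c2 := fun x => by ring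
        simp only [e6, neg_sq] at h6
        have h7 : 0 ≤ ∫ x, Lap W u2 x ^ 2 ∂(mu W) := integral_nonneg fun x => sq_nonneg _
        have h8 := mul_le_mul_of_nonneg_right hδ h7
        rw [pow_succ]
        linarith
  intro f hf η hη
  have hI : 0 ≤ ∫ x, f x ^ 2 ∂(mu W) := integral_nonneg fun x => sq_nonneg _
  obtain ⟨k, hk⟩ : ∃ k : ℕ, (1 / 4 : ℝ) ^ k * (∫ x, f x ^ 2 ∂(mu W)) ≤ η / 8 := by
    have := ((tendsto_pow_atTop_nhds_zero_of_lt_one (r := (1 / 4 : ℝ)) (by norm_num)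
      (by norm_num)).mul_const (∫ x, f x ^ 2 ∂(mu W)))
    rw [zero_mul] at this
    exact (this.eventually (ge_mem_nhds (by positivity))).exists
  obtain ⟨u, hu, c, g, hg, h1, h2⟩ := key k f hf (η / 8) (by positivity)
  have p1 := (hf.sub (hW'.pg_lap hu)).sub (PG.const c)
  refine ⟨u, hu, c, (integral_mu_anti hW hW' (fun x => ?_) (p1.pow 2)
    (fun x => sq_nonneg _)).trans ?_⟩
  · rw [e]
    simpa using mul_nonneg hδ0 (hW0.nonneg x)
  · have h3 := hW.integral_add_sq_le (p1.sub hg) hg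
    simp only [sub_add_cancel] at h3
    linarith

lemma Pot.lapDense {W : Euc n → ℝ} {M : ℝ} (hW : Pot W M) : LapDense W := by
  obtain ⟨N, hN⟩ := exists_nat_gt (8 * (n * M ^ 2))
  have hN0 : (0 : ℝ) < N := lt_of_le_of_lt (by positivity) hN
  have hN1 : (1 : ℝ) ≤ N := by
    have : 0 < N := by exact_mod_cast hN0
    exact_mod_cast this
  have key : ∀ j : ℕ, LapDense fun x => (j / N : ℝ) * W x := by
    intro j
    induction j with
    | zero => simpa using lapDense_zero (n := n)
    | succ j ih =>
      refine ih.perturb (δ := 1 / N) (hW.smul (by positivity)) hW (hW.smul (by positivity))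
        (by positivity) ?_ ?_
      · have : 8 * ((1 / (N : ℝ)) ^ 2 * n * M ^ 2) = 8 * (n * M ^ 2) / N ^ 2 := by
          field_simp
        rw [this, div_le_one (by positivity)]
        nlinarith
      · ext x
        push_cast
        ring
  have := key N
  rw [div_self hN0.ne'] at this
  simpa using this

/-- Approximate solvability of `Lap W u = f` for mean zero `f`. -/
lemma Pot.exists_lap_approx {W : Euc n → ℝ} {M : ℝ} (hW : Pot W M) {f : Euc n → ℝ} (hf : PG f)
    (hf0 : ∫ x, f x ∂(mu W) = 0) {η : ℝ} (hη : 0 < η) :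
    ∃ u ∈ TF n, ∫ x, (f x - Lap W u x) ^ 2 ∂(mu W) ≤ η := by
  obtain ⟨u, hu, c, h⟩ := hW.lapDense f hf η hη
  refine ⟨u, hu, le_trans ?_ h⟩
  have pd := hf.sub (hW.pg_lap hu)
  have h0 : ∫ x, (f x - Lap W u x) ∂(mu W) = 0 := by
    rw [integral_sub (hW.int hf) (hW.int (hW.pg_lap hu)), hf0, hW.integral_lap hu, sub_zero]
  have h1 : ∫ x, (f x - Lap W u x) ^ 2 ∂(mu W)
      = ∫ x, ((f x - Lap W u x) ^ 2 - 2 * c * (f x - Lap W u x)) ∂(mu W) := by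
    rw [integral_sub (hW.int (pd.pow 2)) ((hW.int pd).const_mul _), integral_const_mul, h0]
    ring
  rw [h1]
  refine integral_mono ((hW.int (pd.pow 2)).sub ((hW.int pd).const_mul _))
    (hW.int ((pd.sub (PG.const c)).pow 2)) fun x => ?_
  simp only
  nlinarith [sq_nonneg c]

/-- The Poincaré inequality with constant one. -/
lemma Pot.poincare {W : Euc n → ℝ} {M : ℝ} (hW : Pot W M) {g : Euc n → ℝ} (hg : g ∈ TF n)
    (hg0 : ∫ x, g x ∂(mu W) = 0) :
    ∫ x, g x ^ 2 ∂(mu W) ≤ ∫ x, ∑ i, pd i g x ^ 2 ∂(mu W) := by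
  refine le_of_forall_pos_le_add fun η hη => ?_
  have p0 := TF.pg hg
  have p1 := fun i => TF.pg (TF.pd_mem hg i)
  obtain ⟨u, hu, h⟩ := hW.exists_lap_approx p0 hg0 hη
  have pL := hW.pg_lap hu
  have q1 := fun i => TF.pg (TF.pd_mem hu i)
  have h1 := hW.integral_mul_lap (TF.diff hg) p0 p1 hu
  have h2 := hW.integral_grad_sq_le hu
  have e : ∀ x, g x ^ 2 = (2 * (g x * Lap W u x) + (g x - Lap W u x) ^ 2) - Lap W u x ^ 2 :=
    fun x => by ring
  have h3 : ∫ x, g x ^ 2 ∂(mu W) = 2 * (∫ x, g x * Lap W u x ∂(mu W))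
      + ∫ x, (g x - Lap W u x) ^ 2 ∂(mu W) - ∫ x, Lap W u x ^ 2 ∂(mu W) := by
    have i1 := (hW.int (p0.mul pL)).const_mul 2
    have i2 := hW.int ((p0.sub pL).pow 2)
    have i12 := hW.int (((PG.const 2).mul (p0.mul pL)).add ((p0.sub pL).pow 2))
    simp only [e]
    rw [integral_sub i12 (hW.int (pL.pow 2)), integral_add i1 i2, integral_const_mul]
  have h4 : -2 * (∫ x, ∑ i, pd i g x * pd i u x ∂(mu W))
      ≤ ∫ x, ∑ i, pd i g x ^ 2 ∂(mu W) + ∫ x, ∑ i, pd i u x ^ 2 ∂(mu W) := by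
    have i1 := hW.int (PG.sum Finset.univ fun i => (p1 i).pow 2)
    have i2 := hW.int (PG.sum Finset.univ fun i => (q1 i).pow 2)
    rw [← integral_const_mul, ← integral_add i1 i2]
    refine integral_mono ((hW.int (PG.sum _ fun i => (p1 i).mul (q1 i))).const_mul _) (i1.add i2)
      fun x => ?_
    simp only [Finset.mul_sum, ← Finset.sum_add_distrib]
    refine Finset.sum_le_sum fun i _ => ?_
    nlinarith [sq_nonneg (pd i g x + pd i u x)]
  linarith

lemma map_neg_mu {W : Euc n → ℝ} (hW : Continuous W) (he : ∀ x, W (-x) = W x) (g : Euc n → ℝ) :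
    ∫ x, g (-x) ∂(mu W) = ∫ x, g x ∂(mu W) := by
  rw [integral_mu hW, integral_mu hW, ← integral_neg_eq_self (fun x => wt W x * g x)]
  simp [wt, he]

lemma pd_odd {u : Euc n → ℝ} (hu : Differentiable ℝ u) (he : ∀ x, u (-x) = u x) (i : Fin n)
    (x : Euc n) : pd i u (-x) = -pd i u x := by
  have h1 : (fun x => u (-x)) = u := funext he
  have h2 := congrFun (pd_comp_neg hu i) x
  rw [h1] at h2
  linarith

lemma lap_comp_neg {W u : Euc n → ℝ} (hW : Differentiable ℝ W) (he : ∀ x, W (-x) = W x)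
    (hu : u ∈ TF n) (x : Euc n) : Lap W (fun x => u (-x)) x = Lap W u (-x) := by
  have h1 := fun i => pd_comp_neg (TF.diff hu) i
  have h2 : ∀ i, pd i (fun x => -pd i u (-x)) = fun x => pd i (pd i u) (-x) := fun i => by
    have h3 := pd_comp_neg (TF.diff ((TF n).neg_mem (TF.pd_mem hu i))) i
    have h4 : pd i (-pd i u) = -pd i (pd i u) := by
      have := TF.pd_smul' (TF.pd_mem hu i) (-1) i
      simpa using this
    rw [h4] at h3
    simpa using h3
  simp only [Lap, h1, h2, pd_odd hW he]
  refine Finset.sum_congr rfl fun i _ => ?_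
  simp
  ring

/-- For even data the approximate solution may be chosen even. -/
lemma Pot.exists_even_lap_approx {W : Euc n → ℝ} {M : ℝ} (hW : Pot W M)
    (he : ∀ x, W (-x) = W x) {f : Euc n → ℝ} (hf : PG f) (hfe : ∀ x, f (-x) = f x)
    (hf0 : ∫ x, f x ∂(mu W) = 0) {η : ℝ} (hη : 0 < η) :
    ∃ u ∈ TF n, (∀ x, u (-x) = u x) ∧ ∫ x, (f x - Lap W u x) ^ 2 ∂(mu W) ≤ η := by
  obtain ⟨u, hu, h⟩ := hW.exists_lap_approx hf hf0 hη
  have hu' := TF.comp_neg hu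
  refine ⟨(1 / 2 : ℝ) • (u + fun x => u (-x)),
    (TF n).smul_mem _ ((TF n).add_mem hu hu'), fun x => ?_, ?_⟩
  · simp [add_comm]
  · have p := (PG.const (1 / 2)).mul (hf.sub (hW.pg_lap hu))
    have p' := (PG.const (1 / 2)).mul (hf.sub (hW.pg_lap hu'))
    have h1 := hW.integral_add_sq_le p p'
    have h2 := map_neg_mu hW.diff.continuous he (fun x => (f x - Lap W u x) ^ 2)
    have e2 : ∀ x, f (-x) - Lap W u (-x) = f x - Lap W (fun x => u (-x)) x := fun x => by
      rw [hfe, lap_comp_neg hW.diff he hu]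
    simp only [e2] at h2
    simp only [mul_pow, integral_const_mul, h2] at h1
    have e3 : ∀ x, f x - Lap W ((1 / 2 : ℝ) • (u + fun x => u (-x))) x
      = 1 / 2 * (f x - Lap W u x) + 1 / 2 * (f x - Lap W (fun x => u (-x)) x) := fun x => by
      rw [lap_smul ((TF n).add_mem hu hu'), lap_add hu hu']
      ring
    simp only [e3]
    linarith

end GaussPQ
namespace GaussPQ

variable {n : ℕ}

/-- Second derivative of the penalty profile. -/
def ph2 (s : ℝ) : ℝ := 2 * max s 0 / (1 + max s 0 ^ 2) ^ 2

/-- First derivative of the penalty profile. -/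
def ph1 (s : ℝ) : ℝ := max s 0 ^ 2 / (1 + max s 0 ^ 2)

/-- The penalty profile: convex, of linear growth, vanishing exactly on `(-∞, 0]`. -/
def ph (s : ℝ) : ℝ := ∫ y in (0 : ℝ)..s, ph1 y

lemma ph1_nonneg (s : ℝ) : 0 ≤ ph1 s := by unfold ph1; positivity

lemma ph2_nonneg (s : ℝ) : 0 ≤ ph2 s := by unfold ph2; positivity

lemma ph1_le_one (s : ℝ) : ph1 s ≤ 1 := by
  unfold ph1
  rw [div_le_one (by positivity)]
  linarith

lemma ph2_le_two (s : ℝ) : ph2 s ≤ 2 := by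
  unfold ph2
  rw [div_le_iff₀ (by positivity)]
  nlinarith [sq_nonneg (max s 0 - 1), sq_nonneg (max s 0 ^ 2)]

lemma ph1_of_nonpos {s : ℝ} (hs : s ≤ 0) : ph1 s = 0 := by simp [ph1, max_eq_right hs]

lemma ph2_of_nonpos {s : ℝ} (hs : s ≤ 0) : ph2 s = 0 := by simp [ph2, max_eq_right hs]

lemma continuous_ph1 : Continuous ph1 := by
  unfold ph1
  exact Continuous.div (by fun_prop) (by fun_prop) fun s => by positivity

lemma continuous_ph2 : Continuous ph2 := by
  unfold ph2
  exact Continuous.div (by fun_prop) (by fun_prop) fun s => by positivity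

lemma hasDerivAt_max_sq (s : ℝ) : HasDerivAt (fun s : ℝ => max s 0 ^ 2) (2 * max s 0) s := by
  rcases lt_trichotomy s 0 with hs | rfl | hs
  · have : (fun s : ℝ => max s 0 ^ 2) =ᶠ[nhds s] fun _ => 0 := by
      filter_upwards [Iio_mem_nhds hs] with y hy
      simp [max_eq_right (le_of_lt (Set.mem_Iio.1 hy))]
    rw [max_eq_right hs.le, mul_zero]
    exact (hasDerivAt_const s (0 : ℝ)).congr_of_eventuallyEq this
  · rw [hasDerivAt_iff_isLittleO]
    have h1 : (fun x : ℝ => x ^ 2) =o[nhds 0] fun x => x := by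
      simpa using Asymptotics.isLittleO_pow_id (𝕜 := ℝ) (n := 2) (by norm_num)
    refine (Asymptotics.IsBigO.of_bound 1 (.of_forall fun x => ?_)).trans_isLittleO
      (by simpa using h1)
    rcases le_total x 0 with h | h <;> simp [h, sq_nonneg]
  · have : (fun s : ℝ => max s 0 ^ 2) =ᶠ[nhds s] fun s => s ^ 2 := by
      filter_upwards [Ioi_mem_nhds hs] with y hy
      rw [max_eq_left (le_of_lt (Set.mem_Ioi.1 hy))]
    rw [max_eq_left hs.le]
    exact (by simpa using hasDerivAt_pow 2 s : HasDerivAt (fun s : ℝ => s ^ 2) (2 * s) s)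
      |>.congr_of_eventuallyEq this

lemma hasDerivAt_ph1 (s : ℝ) : HasDerivAt ph1 (ph2 s) s := by
  have h := hasDerivAt_max_sq s
  have h1 := h.div (h.const_add 1) (by positivity : 1 + max s 0 ^ 2 ≠ 0)
  refine h1.congr_deriv ?_
  unfold ph2
  congr 1
  ring

lemma hasDerivAt_ph (s : ℝ) : HasDerivAt ph (ph1 s) s :=
  intervalIntegral.integral_hasDerivAt_right (continuous_ph1.intervalIntegrable _ _)
    continuous_ph1.aestronglyMeasurable.stronglyMeasurableAtFilter continuous_ph1.continuousAt

lemma continuous_ph : Continuous ph :=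
  continuous_iff_continuousAt.2 fun s => (hasDerivAt_ph s).continuousAt

lemma ph_zero : ph 0 = 0 := by simp [ph]

lemma monotone_ph : Monotone ph :=
  monotone_of_deriv_nonneg (fun s => (hasDerivAt_ph s).differentiableAt) fun s => by
    rw [(hasDerivAt_ph s).deriv]; exact ph1_nonneg s

lemma ph_of_nonpos {s : ℝ} (hs : s ≤ 0) : ph s = 0 := by
  unfold ph
  rw [intervalIntegral.integral_congr (g := fun _ => 0), intervalIntegral.integral_zero]
  intro y hy
  rw [Set.uIcc_of_ge hs] at hy
  exact ph1_of_nonpos hy.2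

lemma ph_nonneg (s : ℝ) : 0 ≤ ph s := by
  rcases le_total s 0 with h | h
  · rw [ph_of_nonpos h]
  · rw [← ph_zero]; exact monotone_ph h

lemma ph_pos {s : ℝ} (hs : 0 < s) : 0 < ph s := by
  refine intervalIntegral.intervalIntegral_pos_of_pos_on (continuous_ph1.intervalIntegrable _ _)
    (fun x hx => ?_) hs
  unfold ph1
  have : 0 < max x 0 := lt_max_of_lt_left hx.1
  positivity

lemma ph_le_abs (s : ℝ) : |ph s| ≤ |s| := by
  have := intervalIntegral.norm_integral_le_of_norm_le_const (a := 0) (b := s) (f := ph1) (C := 1)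
    fun y _ => by rw [Real.norm_eq_abs, abs_of_nonneg (ph1_nonneg y)]; exact ph1_le_one y
  simpa [ph] using this

/-- Near zero, `ph1` is negligible against `ph2`. -/
lemma exists_ph1_le {C a : ℝ} (hC : 0 ≤ C) (ha : 0 < a) :
    ∃ δ > 0, ∀ s, s ≤ δ → ph1 s * C ≤ a * ph2 s := by
  refine ⟨min 1 (a / (C + 1)), by positivity, fun s hs => ?_⟩
  rcases le_total s 0 with h | h
  · rw [ph1_of_nonpos h, ph2_of_nonpos h]; simp
  · have h1 : s ≤ 1 := hs.trans (min_le_left _ _)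
    have h2 : s * (C + 1) ≤ a := by
      rw [← le_div_iff₀ (by positivity)]; exact hs.trans (min_le_right _ _)
    unfold ph1 ph2
    rw [max_eq_left h, div_mul_eq_mul_div, mul_div_assoc', div_le_div_iff₀ (by positivity)
      (by positivity)]
    have h3 : s * C * (1 + s ^ 2) ≤ 2 * a := by
      have : s * C ≤ a := by nlinarith
      have h5 : 0 ≤ s * C := mul_nonneg h hC
      have h6 : 1 + s ^ 2 ≤ 2 := by nlinarith
      nlinarith [mul_le_mul_of_nonneg_left h6 h5]
    have h4 : 0 ≤ s * (1 + s ^ 2) := by positivity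
    nlinarith [mul_le_mul_of_nonneg_left h3 h4]

section RidgeSum

lemma differentiable_ridge_sub {g g' : ℝ → ℝ} (hg : ∀ s, HasDerivAt g (g' s) s) (e : Euc n)
    (h : ℝ) : Differentiable ℝ fun x => g (⟪x, e⟫ - h) := by
  simpa only [← sub_eq_add_neg] using differentiable_ridge hg e (-h)

variable {ι : Type*} [Fintype ι]

lemma sum_quadratic (N : ℝ) (c : ι → ℝ) (E : ι → Fin n → ℝ) (v : Fin n → ℝ) :
    ∑ i, ∑ j, N * (∑ k, 1 * E k i * E k j * c k) * v i * v j
      = N * ∑ k, c k * (∑ i, v i * E k i) ^ 2 := by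
  simp only [sq, Finset.mul_sum, Finset.sum_mul]
  rw [Finset.sum_comm (γ := ι)]
  refine Finset.sum_congr rfl fun i _ => ?_
  rw [Finset.sum_comm (γ := ι)]
  exact Finset.sum_congr rfl fun j _ => Finset.sum_congr rfl fun k _ => by ring

/-- Weighted sums of ridge functions. -/
def RS (N : ℝ) (g : ℝ → ℝ) (e : ι → Euc n) (h w : ι → ℝ) (x : Euc n) : ℝ :=
  N * ∑ k, w k * g (⟪x, e k⟫ - h k)

variable {N : ℝ} {g g' : ℝ → ℝ} {e : ι → Euc n} {h w : ι → ℝ}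

lemma differentiable_RS (hg : ∀ s, HasDerivAt g (g' s) s) : Differentiable ℝ (RS N g e h w) := by
  unfold RS
  exact (Differentiable.fun_sum fun k _ => (differentiable_ridge_sub hg (e k) (h k)).const_mul _).const_mul _

lemma pd_RS (hg : ∀ s, HasDerivAt g (g' s) s) (i : Fin n) :
    pd i (RS N g e h w) = RS N g' e h fun k => w k * e k i := by
  have h1 : ∀ k, pd i (fun x => g (⟪x, e k⟫ - h k)) = fun x => g' (⟪x, e k⟫ - h k) * e k i :=
    fun k => by simpa only [← sub_eq_add_neg] using pd_ridge hg (e k) (-h k) i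
  have d := fun k => differentiable_ridge_sub hg (e k) (h k)
  unfold RS
  rw [pd_const_mul (Differentiable.fun_sum fun k _ => (d k).const_mul _),
    pd_sum _ (fun k => (d k).const_mul _)]
  ext x
  congr 1
  refine Finset.sum_congr rfl fun k _ => ?_
  rw [pd_const_mul (d k), h1]
  ring

lemma continuous_RS (hg : Continuous g) : Continuous (RS N g e h w) := by
  unfold RS
  fun_prop

lemma abs_RS_le {C D : ℝ} (hN : 0 ≤ N) (hg : ∀ s, |g s| ≤ C) (hw : ∀ k, |w k| ≤ D) (x : Euc n) :
    |RS N g e h w x| ≤ N * (Fintype.card ι * (D * C)) := by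
  unfold RS
  rw [abs_mul, abs_of_nonneg hN]
  refine mul_le_mul_of_nonneg_left ((Finset.abs_sum_le_sum_abs _ _).trans ?_) hN
  calc ∑ k, |w k * g (⟪x, e k⟫ - h k)| ≤ ∑ _k : ι, D * C := Finset.sum_le_sum fun k _ => by
        rw [abs_mul]
        exact mul_le_mul (hw k) (hg _) (abs_nonneg _) ((abs_nonneg _).trans (hw k))
    _ = _ := by simp

lemma PG.RS_of_bounded {C : ℝ} (hN : 0 ≤ N) (hc : Continuous g) (hg : ∀ s, |g s| ≤ C) :
    PG (RS N g e h w) :=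
  .of_bounded (continuous_RS hc) (abs_RS_le hN hg
    (fun k => Finset.single_le_sum (f := fun k => |w k|) (fun _ _ => abs_nonneg _)
      (Finset.mem_univ k)))

lemma abs_ph1_le (s : ℝ) : |ph1 s| ≤ 1 := by
  rw [abs_of_nonneg (ph1_nonneg s)]; exact ph1_le_one s

lemma abs_ph2_le (s : ℝ) : |ph2 s| ≤ 2 := by
  rw [abs_of_nonneg (ph2_nonneg s)]; exact ph2_le_two s

lemma PG.RS1 (hN : 0 ≤ N) : PG (RS N ph1 e h w) := .RS_of_bounded hN continuous_ph1 abs_ph1_le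

lemma PG.RS2 (hN : 0 ≤ N) : PG (RS N ph2 e h w) := .RS_of_bounded hN continuous_ph2 abs_ph2_le

lemma RS_even {σ : Equiv.Perm ι} (he : ∀ k, e (σ k) = -e k) (hh : ∀ k, h (σ k) = h k)
    (hw : ∀ k, w (σ k) = w k) (x : Euc n) : RS N g e h w (-x) = RS N g e h w x := by
  unfold RS
  rw [← Equiv.sum_comp σ]
  simp [he, hh, hw]

lemma abs_coord_le {v : Euc n} (hv : ‖v‖ = 1) (i : Fin n) : |v i| ≤ 1 := by
  rw [← hv]; exact PiLp.norm_apply_le v i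

lemma pot_RS (hN : 0 ≤ N) (he : ∀ k, ‖e k‖ = 1) :
    Pot (RS N ph e h fun _ => 1) (N * (Fintype.card ι * (1 * 2))) := by
  have hc : ∀ i k, |1 * e k i| ≤ 1 := fun i k => by rw [one_mul]; exact abs_coord_le (he k) i
  have hc2 : ∀ i j k, |1 * e k i * e k j| ≤ 1 := fun i j k => by
    rw [abs_mul]
    exact mul_le_one₀ (hc i k) (abs_nonneg _) (abs_coord_le (he k) j)
  refine ⟨differentiable_RS hasDerivAt_ph, fun x => ?_, fun i => ?_, fun i j => ?_, fun i x => ?_,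
    fun i j x => ?_, fun x v => ?_⟩
  · exact mul_nonneg hN (Finset.sum_nonneg fun k _ => mul_nonneg zero_le_one (ph_nonneg _))
  · rw [pd_RS hasDerivAt_ph]; exact differentiable_RS hasDerivAt_ph1
  · rw [pd_RS hasDerivAt_ph, pd_RS hasDerivAt_ph1]; exact continuous_RS continuous_ph2
  · rw [pd_RS hasDerivAt_ph]
    exact abs_RS_le hN (fun s => (abs_ph1_le s).trans one_le_two) (hc i) x
  · rw [pd_RS hasDerivAt_ph, pd_RS hasDerivAt_ph1]
    exact abs_RS_le hN abs_ph2_le (hc2 i j) x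
  · have : ∑ i, ∑ j, pd j (pd i (RS N ph e h fun _ => 1)) x * v i * v j
        = N * ∑ k, ph2 (⟪x, e k⟫ - h k) * (∑ i, v i * e k i) ^ 2 := by
      simp only [pd_RS hasDerivAt_ph, pd_RS hasDerivAt_ph1, RS]
      exact sum_quadratic N _ (fun k => e k) v
    rw [this]
    exact mul_nonneg hN (Finset.sum_nonneg fun k _ => mul_nonneg (ph2_nonneg _) (sq_nonneg _))

end RidgeSum

end GaussPQ
namespace GaussPQ

variable {n : ℕ} {W : Euc n → ℝ} {M : ℝ}

/-- The integrated squared Hilbert–Schmidt norm of the Hessian. -/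
def hessSq (W u : Euc n → ℝ) : ℝ := ∫ x, ∑ j, ∑ i, pd i (pd j u) x ^ 2 ∂(mu W)

/-- The integrated squared gradient. -/
def gradSq (W u : Euc n → ℝ) : ℝ := ∫ x, ∑ j, pd j u x ^ 2 ∂(mu W)

lemma gradSq_nonneg (W u : Euc n → ℝ) : 0 ≤ gradSq W u :=
  integral_nonneg fun _ => Finset.sum_nonneg fun _ _ => sq_nonneg _

/-- Total mass. -/
def mass (W : Euc n → ℝ) : ℝ := ∫ _x, (1 : ℝ) ∂(mu W)

lemma Pot.mass_pos (hW : Pot W M) : 0 < mass W := by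
  have hc := hW.diff.continuous
  unfold mass
  rw [integral_mu hc, integral_pos_iff_support_of_nonneg]
  · have : Function.support (fun x => wt W x * 1) = Set.univ := by
      ext x; simp [(wt_pos W x).ne']
    rw [this]
    exact Measure.measure_univ_pos.2 (NeZero.ne _)
  · intro x; simpa using (wt_pos W x).le
  · exact (integrable_mu_iff hc _).1 (hW.int (PG.const 1))

lemma Pot.integral_sum_sq_le (hW : Pot W M) (hx : ∀ x, 0 ≤ ∑ i, x i * pd i W x) :
    ∫ x, ∑ i, x i ^ 2 ∂(mu W) ≤ n * mass W := by
  have h1 : ∀ i : Fin n, mass W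
      = ∫ x, x i ^ 2 ∂(mu W) + ∫ x, x i * pd i W x ∂(mu W) := by
    intro i
    have := integral_pd (g := fun x => x i) i hW.diff hW.nonneg (hW.pg1 i) (by fun_prop)
      (PG.coord i) (by rw [pd_coord]; exact PG.const _)
    rw [pd_coord] at this
    rw [← integral_add (hW.int ((PG.coord i).pow 2)) (hW.int ((PG.coord i).mul (hW.pg1 i)))]
    simp only [if_true] at this
    rw [mass, this]
    congr 1
    ext x
    ring
  have h2 : ∑ _i : Fin n, mass W
      = ∫ x, ∑ i, x i ^ 2 ∂(mu W) + ∫ x, ∑ i, x i * pd i W x ∂(mu W) := by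
    rw [integral_finsetSum _ (fun i _ => hW.int ((PG.coord i).pow 2)),
      integral_finsetSum _ (fun i _ => hW.int ((PG.coord i).mul (hW.pg1 i))),
      ← Finset.sum_add_distrib]
    exact Finset.sum_congr rfl fun i _ => h1 i
  have h3 : 0 ≤ ∫ x, ∑ i, x i * pd i W x ∂(mu W) := integral_nonneg hx
  simp only [Finset.sum_const, Finset.card_univ, Fintype.card_fin, nsmul_eq_mul] at h2
  linarith

lemma Pot.integral_drift_le (hW : Pot W M) {u : Euc n → ℝ} (hu : u ∈ TF n) :
    ∫ x, (∑ j, pd j u x ^ 2) * (∑ i, x i * pd i W x) ∂(mu W)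
      ≤ n * gradSq W u + hessSq W u := by
  have hj := fun j => TF.pd_mem hu j
  have p1 : ∀ j, PG (pd j u) := fun j => TF.pg (hj j)
  have p2 : ∀ j i, PG (pd i (pd j u)) := fun j i => TF.pg (TF.pd_mem (hj j) i)
  have d1 : ∀ j, Differentiable ℝ (pd j u) := fun j => TF.diff (hj j)
  have dx : ∀ i : Fin n, Differentiable ℝ (fun x : Euc n => x i) := fun i => by fun_prop
  have hg : ∀ j, pd j (fun x => pd j u x) = pd j (pd j u) := fun _ => rfl
  set G : Euc n → ℝ := fun x => ∑ j, pd j u x * pd j u x with hG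
  have dG : Differentiable ℝ G := Differentiable.fun_sum fun j _ => (d1 j).fun_mul (d1 j)
  have pG : PG G := PG.sum _ fun j => (p1 j).mul (p1 j)
  have hpG : ∀ i, pd i G = fun x => ∑ j, (pd i (pd j u) x * pd j u x + pd j u x * pd i (pd j u) x) := by
    intro i
    rw [hG, pd_sum _ (fun j => (d1 j).fun_mul (d1 j))]
    simp only [pd_mul (d1 _) (d1 _)]
  have ppG : ∀ i, PG (pd i G) := fun i => by
    rw [hpG]
    exact PG.sum _ fun j => ((p2 j i).mul (p1 j)).add ((p1 j).mul (p2 j i))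
  have h1 : ∀ i : Fin n, ∫ x, (G x + x i * pd i G x) ∂(mu W)
      = ∫ x, (x i * G x * (x i + pd i W x)) ∂(mu W) := by
    intro i
    have e : pd i (fun x => x i * G x) = fun x => G x + x i * pd i G x := by
      rw [pd_mul (dx i) dG, pd_coord]
      simp
    have := integral_pd (g := fun x => x i * G x) i hW.diff hW.nonneg (hW.pg1 i)
      ((dx i).fun_mul dG) ((PG.coord i).mul pG)
      (by rw [e]; exact pG.add ((PG.coord i).mul (ppG i)))
    rwa [e] at this
  have h2 : ∫ x, ∑ i : Fin n, (G x + x i * pd i G x) ∂(mu W)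
      = ∫ x, ∑ i : Fin n, (x i * G x * (x i + pd i W x)) ∂(mu W) := by
    rw [integral_finsetSum _ (fun i _ => hW.int (pG.add ((PG.coord i).mul (ppG i)))),
      integral_finsetSum _ (fun i _ => hW.int (((PG.coord i).mul pG).mul
        ((PG.coord i).add (hW.pg1 i))))]
    exact Finset.sum_congr rfl fun i _ => h1 i
  have pGx : PG (fun x => G x * ∑ i, x i * pd i W x) :=
    pG.mul (PG.sum _ fun i => (PG.coord i).mul (hW.pg1 i))
  have pGx2 : PG (fun x => G x * ∑ i, x i ^ 2) := pG.mul (PG.sum _ fun i => (PG.coord i).pow 2)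
  have e3 : ∀ x, ∑ i : Fin n, (x i * G x * (x i + pd i W x))
      = G x * (∑ i, x i ^ 2) + G x * ∑ i, x i * pd i W x := fun x => by
    simp only [Finset.mul_sum, ← Finset.sum_add_distrib]
    exact Finset.sum_congr rfl fun i _ => by ring
  simp only [e3] at h2
  rw [integral_add (hW.int pGx2) (hW.int pGx)] at h2
  have pH : PG (fun x => ∑ j, ∑ i, pd i (pd j u) x ^ 2) :=
    PG.sum _ fun j => PG.sum _ fun i => (p2 j i).pow 2
  have h4 : ∫ x, ∑ i : Fin n, (G x + x i * pd i G x) ∂(mu W)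
      ≤ ∫ x, (n * G x + G x * (∑ i, x i ^ 2) + ∑ j, ∑ i, pd i (pd j u) x ^ 2) ∂(mu W) := by
    refine integral_mono (hW.int (PG.sum _ fun i => pG.add ((PG.coord i).mul (ppG i))))
      (hW.int ((((PG.const n).mul pG).add pGx2).add pH)) fun x => ?_
    simp only [Finset.sum_add_distrib, Finset.sum_const, Finset.card_univ, Fintype.card_fin,
      nsmul_eq_mul, add_assoc, hpG]
    refine add_le_add le_rfl ?_
    have e6 : ∑ i, x i * (∑ j, pd i (pd j u) x * pd j u x + ∑ j, pd j u x * pd i (pd j u) x)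
        = ∑ j, ∑ i, x i * (pd i (pd j u) x * pd j u x + pd j u x * pd i (pd j u) x) := by
      simp only [← Finset.sum_add_distrib, Finset.mul_sum]
      exact Finset.sum_comm
    have e7 : G x * ∑ i, x i ^ 2 = ∑ j, ∑ i, pd j u x * pd j u x * x i ^ 2 := by
      rw [hG, Finset.sum_mul_sum]
    rw [e6, e7, ← Finset.sum_add_distrib]
    refine Finset.sum_le_sum fun j _ => ?_
    rw [← Finset.sum_add_distrib]
    refine Finset.sum_le_sum fun i _ => ?_
    nlinarith [sq_nonneg (x i * pd j u x - pd i (pd j u) x)]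
  rw [integral_add (hW.int (((PG.const n).mul pG).add pGx2)) (hW.int pH),
    integral_add (hW.int ((PG.const n).mul pG)) (hW.int pGx2), integral_const_mul] at h4
  have e5 : ∀ x, ∑ j, pd j u x ^ 2 = G x := fun x => by simp only [hG, sq]
  simp only [gradSq, hessSq, e5]
  linarith

lemma Pot.gradSq_le_hessSq (hW : Pot W M) (he : ∀ x, W (-x) = W x) {u : Euc n → ℝ}
    (hu : u ∈ TF n) (hue : ∀ x, u (-x) = u x) : gradSq W u ≤ hessSq W u := by
  have hj := fun j => TF.pd_mem hu j
  unfold gradSq hessSq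
  rw [integral_finsetSum _ (fun j _ => hW.int ((TF.pg (hj j)).pow 2)),
    integral_finsetSum _ (fun j _ => hW.int (PG.sum _ fun i => (TF.pg (TF.pd_mem (hj j) i)).pow 2))]
  refine Finset.sum_le_sum fun j _ => hW.poincare (hj j) ?_
  have h1 := map_neg_mu hW.diff.continuous he (pd j u)
  simp only [pd_odd (TF.diff hu) hue, integral_neg] at h1
  linarith

lemma Pot.sq_setIntegral_lap_le (hW : Pot W M) (hx : ∀ x, 0 ≤ ∑ i, x i * pd i W x)
    {S : Set (Euc n)} (hS : MeasurableSet S) (hS1 : ∀ x ∈ S, ∀ i, pd i W x = 0)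
    {u : Euc n → ℝ} (hu : u ∈ TF n) :
    (∫ x in S, Lap W u x ∂(mu W)) ^ 2 ≤ 2 * n * mass W * (hessSq W u + gradSq W u) := by
  set y := ∫ x in S, Lap W u x ∂(mu W) with hy
  have hj := fun j => TF.pd_mem hu j
  have p1 : ∀ j, PG (pd j u) := fun j => TF.pg (hj j)
  have p2 : ∀ j i, PG (pd i (pd j u)) := fun j i => TF.pg (TF.pd_mem (hj j) i)
  have pH : PG (fun x => ∑ j, ∑ i, pd i (pd j u) x ^ 2) :=
    PG.sum _ fun j => PG.sum _ fun i => (p2 j i).pow 2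
  have pB : PG (fun x => ∑ j, pd j u x ^ 2) := PG.sum _ fun j => (p1 j).pow 2
  have pX : PG (fun x : Euc n => ∑ i, x i ^ 2) := PG.sum _ fun i => (PG.coord i).pow 2
  have hZ := hW.mass_pos
  have key : ∀ τ : ℝ, 2 * τ * y ≤ 2 * n * mass W * τ ^ 2 + (hessSq W u + gradSq W u) := by
    intro τ
    have pT : PG (fun x => τ ^ 2 * n * 1 + τ ^ 2 * (∑ i, x i ^ 2)
        + ((∑ j, ∑ i, pd i (pd j u) x ^ 2) + ∑ j, pd j u x ^ 2)) :=
      (((PG.const (τ ^ 2 * n)).mul (PG.const 1)).add ((PG.const (τ ^ 2)).mul pX)).add (pH.add pB)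
    have h1 : 2 * τ * y ≤ ∫ x in S, (τ ^ 2 * n * 1 + τ ^ 2 * (∑ i, x i ^ 2)
        + ((∑ j, ∑ i, pd i (pd j u) x ^ 2) + ∑ j, pd j u x ^ 2)) ∂(mu W) := by
      rw [hy, ← integral_const_mul]
      refine setIntegral_mono_on ((hW.int (hW.pg_lap hu)).const_mul _).integrableOn
        (hW.int pT).integrableOn hS fun x hxS => ?_
      have e1 : ∑ i, pd i (pd i u) x ^ 2 ≤ ∑ j, ∑ i, pd i (pd j u) x ^ 2 :=
        Finset.sum_le_sum fun j _ => Finset.single_le_sum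
          (f := fun i => pd i (pd j u) x ^ 2) (fun i _ => sq_nonneg _) (Finset.mem_univ j)
      have e2 : 2 * τ * Lap W u x ≤ τ ^ 2 * n * 1 + τ ^ 2 * (∑ i, x i ^ 2)
          + ((∑ i, pd i (pd i u) x ^ 2) + ∑ j, pd j u x ^ 2) := by
        have : τ ^ 2 * n * 1 = ∑ _i : Fin n, τ ^ 2 := by simp [mul_comm]
        rw [this]
        simp only [Lap, hS1 x hxS, Finset.mul_sum, ← Finset.sum_add_distrib]
        refine Finset.sum_le_sum fun i _ => ?_
        nlinarith [sq_nonneg (τ - pd i (pd i u) x), sq_nonneg (τ * x i + pd i u x)]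
      linarith
    have h2 := setIntegral_le_integral (s := S) (hW.int pT) (.of_forall fun x => by
      simp only [Pi.zero_apply]
      have := Finset.sum_nonneg fun (i : Fin n) (_ : i ∈ Finset.univ) => sq_nonneg (x i)
      have := Finset.sum_nonneg fun (i : Fin n) (_ : i ∈ Finset.univ) => sq_nonneg (pd i u x)
      have : 0 ≤ ∑ j, ∑ i, pd i (pd j u) x ^ 2 :=
        Finset.sum_nonneg fun j _ => Finset.sum_nonneg fun i _ => sq_nonneg _
      positivity)
    have i1 := hW.int ((PG.const (τ ^ 2 * n)).mul (PG.const 1))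
    have i2 := hW.int ((PG.const (τ ^ 2)).mul pX)
    have i12 := hW.int (((PG.const (τ ^ 2 * n)).mul (PG.const 1)).add ((PG.const (τ ^ 2)).mul pX))
    rw [integral_add i12 (hW.int (pH.add pB)), integral_add i1 i2,
      integral_add (hW.int pH) (hW.int pB), integral_const_mul, integral_const_mul] at h2
    have h3 := hW.integral_sum_sq_le hx
    have h4 := mul_le_mul_of_nonneg_left h3 (sq_nonneg τ)
    simp only [hessSq, gradSq]
    have h5 : mass W = ∫ x, 1 ∂(mu W) := rfl
    rw [← h5] at h2
    linarith
  rcases Nat.eq_zero_or_pos n with hn | hn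
  · subst hn
    have : y = 0 := by simp [hy, Lap]
    simp [this]
  · have hn' : (0 : ℝ) < n := by exact_mod_cast hn
    have h1 := key (y / (2 * n * mass W))
    have h2 : 0 < 2 * n * mass W := by positivity
    generalize hQ : 2 * n * mass W = Q at h1 h2 ⊢
    have e1 : 2 * (y / Q) * y = 2 * (y ^ 2 / Q) := by field_simp
    have e2 : Q * (y / Q) ^ 2 = y ^ 2 / Q := by field_simp
    rw [e1, e2] at h1
    rw [← div_le_iff₀' h2]
    linarith

lemma mean_sq_le {ε θ Z s m y z Q η : ℝ} (hε : 0 < ε) (hθ : 0 < θ) (hZ : 0 < Z) (hs : θ * Z ≤ s)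
    (hm : m * s = -y - z) {k : ℝ} (hy : y ^ 2 ≤ k * Z * Q) (hz : z ^ 2 ≤ Z * η) :
    θ ^ 2 * (Z * m ^ 2) ≤ (1 + ε) * (k * Q) + (1 + 1 / ε) * η := by
  have h1 : (θ * Z) ^ 2 * m ^ 2 ≤ (-y - z) ^ 2 := by
    rw [← hm, mul_comm m s, mul_pow s m]
    gcongr
  have h2 : (-y - z) ^ 2 ≤ (1 + ε) * y ^ 2 + (1 + 1 / ε) * z ^ 2 := by
    have h3 : 0 ≤ (ε * y - z) ^ 2 / ε := by positivity
    have h4 : (ε * y - z) ^ 2 / ε = ε * y ^ 2 - 2 * y * z + 1 / ε * z ^ 2 := by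
      field_simp
      ring
    linarith
  have h3 : (1 + ε) * y ^ 2 ≤ (1 + ε) * (k * Z * Q) := by gcongr
  have h4 : (1 + 1 / ε) * z ^ 2 ≤ (1 + 1 / ε) * (Z * η) := by gcongr
  refine le_of_mul_le_mul_left ?_ hZ
  linarith

lemma coeff_nonneg {A B c D : ℝ} {n : ℝ} (hn : 1 ≤ n) (hc : 0 ≤ c) (hBA : B ≤ A) (hB : 0 ≤ B)
    (h : (n + 1) * c + 4 * D ≤ 2) : 0 ≤ (1 - c - 2 * D) * A + (1 - c * n - 2 * D) * B := by
  have h0 : c ≤ n * c := le_mul_of_one_le_left hc hn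
  have h1 : 0 ≤ 1 - c - 2 * D := by linarith
  have h2 := mul_nonneg h1 (sub_nonneg.2 hBA)
  have h3 := mul_nonneg (by linarith : 0 ≤ 2 - (n + 1) * c - 4 * D) hB
  linarith

set_option maxHeartbeats 1000000 in
/-- The local (static) form of the dimensional Brunn–Minkowski inequality. -/
lemma Pot.static (hW : Pot W M) (he : ∀ x, W (-x) = W x) (hn : 1 ≤ n)
    (hx : ∀ x, 0 ≤ ∑ i, x i * pd i W x)
    {S : Set (Euc n)} (hS : MeasurableSet S) (hS1 : ∀ x ∈ S, ∀ i, pd i W x = 0)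
    {W1 W2 T : Euc n → ℝ} (d1 : Differentiable ℝ W1) (p1 : PG W1) (p11 : ∀ i, PG (pd i W1))
    (p2 : PG W2) (pT : PG T) (h1e : ∀ x, W1 (-x) = W1 x) (h1S : ∀ x ∈ S, W1 x = 0)
    {c ε θ κ : ℝ} (hc : 0 ≤ c) (hε : 0 < ε) (hθ : 0 < θ) (hκ : 0 ≤ κ)
    (hmS : θ * mass W ≤ ∫ _x in S, (1 : ℝ) ∂(mu W))
    (hbr : ∀ (x : Euc n) (v : Fin n → ℝ), -(c * ((∑ j, v j ^ 2) * ∑ i, x i * pd i W x)) - T x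
      ≤ W2 x + 2 * (∑ i, pd i W1 x * v i) + ∑ i, ∑ j, pd j (pd i W) x * v i * v j)
    (hcond : (n + 1) * c + 4 * (κ * n * (1 + ε) / θ ^ 2) ≤ 2) :
    (∫ x, W1 x ^ 2 ∂(mu W)) * mass W - (1 - κ) * (∫ x, W1 x ∂(mu W)) ^ 2
      - (∫ x, W2 x ∂(mu W)) * mass W ≤ mass W * ∫ x, T x ∂(mu W) := by
  have hZ := hW.mass_pos
  set Z := mass W with hZd
  set m := (∫ x, W1 x ∂(mu W)) / Z with hm
  have hmZ : ∫ x, W1 x ∂(mu W) = m * Z := by rw [hm]; field_simp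
  have hcint : ∀ a : ℝ, ∫ _x, a ∂(mu W) = a * Z := fun a => by
    rw [hZd, mass, ← integral_const_mul]; simp
  have pf : PG (fun x => W1 x - m) := p1.sub (PG.const m)
  have hf0 : ∫ x, (W1 x - m) ∂(mu W) = 0 := by
    rw [integral_sub (hW.int p1) (hW.int (PG.const m)), hmZ, hcint, sub_self]
  have hff : ∫ x, (W1 x - m) ^ 2 ∂(mu W) = ∫ x, W1 x ^ 2 ∂(mu W) - m ^ 2 * Z := by
    have e : ∀ x, (W1 x - m) ^ 2 = W1 x ^ 2 - (2 * m * (W1 x - m) + m ^ 2) := fun x => by ring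
    simp only [e]
    rw [integral_sub (hW.int (p1.pow 2)) (hW.int (((PG.const (2 * m)).mul pf).add
      (PG.const (m ^ 2)))), integral_add (hW.int ((PG.const (2 * m)).mul pf))
      (hW.int (PG.const (m ^ 2))), integral_const_mul, hf0, hcint]
    ring
  have main : ∀ η > 0, ∫ x, (W1 x - m) ^ 2 ∂(mu W) + κ * Z * m ^ 2 - ∫ x, W2 x ∂(mu W)
      ≤ ∫ x, T x ∂(mu W) + (1 + κ * (1 + 1 / ε) / θ ^ 2) * η := by
    intro η hη
    obtain ⟨u, hu, hue, hη'⟩ := hW.exists_even_lap_approx he pf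
      (fun x => by simp only [h1e]) hf0 hη
    have hj := fun j => TF.pd_mem hu j
    have q1 : ∀ j, PG (pd j u) := fun j => TF.pg (hj j)
    have pL := hW.pg_lap hu
    set A := hessSq W u with hA
    set B := gradSq W u with hB
    have hB0 : 0 ≤ B := gradSq_nonneg W u
    have hBA : B ≤ A := hW.gradSq_le_hessSq he hu hue
    have hbo := hW.bochner hu
    have hdr := hW.integral_drift_le hu
    have hsq := hW.sq_setIntegral_lap_le hx hS hS1 hu
    -- the quadratic form
    have pd1 : ∀ i, pd i (fun x => W1 x - m) = pd i W1 := fun i => by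
      rw [pd_sub d1 (differentiable_const m)]
      ext x
      simp [pd]
    have hIL := hW.integral_mul_lap (g := fun x => W1 x - m) (d1.sub_const m) pf
      (fun i => by rw [pd1]; exact p11 i) hu
    simp only [pd1] at hIL
    have pCross : PG (fun x => ∑ i, pd i W1 x * pd i u x) := PG.sum _ fun i => (p11 i).mul (q1 i)
    have pHess : PG (fun x => ∑ i, ∑ j, pd j (pd i W) x * pd i u x * pd j u x) :=
      PG.sum _ fun i => PG.sum _ fun j => ((hW.pg2 i j).mul (q1 i)).mul (q1 j)
    have pDr : PG (fun x => (∑ j, pd j u x ^ 2) * ∑ i, x i * pd i W x) :=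
      (PG.sum _ fun j => (q1 j).pow 2).mul (PG.sum _ fun i => (PG.coord i).mul (hW.pg1 i))
    have hb : -(c * ∫ x, (∑ j, pd j u x ^ 2) * (∑ i, x i * pd i W x) ∂(mu W)) - ∫ x, T x ∂(mu W)
        ≤ ∫ x, W2 x ∂(mu W) + 2 * (∫ x, ∑ i, pd i W1 x * pd i u x ∂(mu W))
          + ∫ x, ∑ i, ∑ j, pd j (pd i W) x * pd i u x * pd j u x ∂(mu W) := by
      have p2c := (PG.const 2).mul pCross
      rw [← integral_const_mul, ← integral_const_mul, ← integral_neg,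
        ← integral_sub (hW.int ((PG.const c).mul pDr).neg) (hW.int pT),
        ← integral_add (hW.int p2) (hW.int p2c),
        ← integral_add (hW.int (p2.add p2c)) (hW.int pHess)]
      exact integral_mono (hW.int (((PG.const c).mul pDr).neg.sub pT))
        (hW.int ((p2.add p2c).add pHess)) fun x => hbr x fun i => pd i u x
    have hexp : ∫ x, (W1 x - m) ^ 2 ∂(mu W) ≤ 2 * (∫ x, (W1 x - m) * Lap W u x ∂(mu W))
        - ∫ x, Lap W u x ^ 2 ∂(mu W) + η := by
      have e : ∀ x, (W1 x - m) ^ 2 = (2 * ((W1 x - m) * Lap W u x) - Lap W u x ^ 2)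
          + (W1 x - m - Lap W u x) ^ 2 := fun x => by ring
      have pp := (PG.const 2).mul (pf.mul pL)
      have : ∫ x, (W1 x - m) ^ 2 ∂(mu W) = 2 * (∫ x, (W1 x - m) * Lap W u x ∂(mu W))
        - ∫ x, Lap W u x ^ 2 ∂(mu W) + ∫ x, (W1 x - m - Lap W u x) ^ 2 ∂(mu W) := by
        rw [integral_congr_ae (.of_forall e),
          integral_add (hW.int (pp.sub (pL.pow 2))) (hW.int ((pf.sub pL).pow 2)),
          integral_sub (hW.int pp) (hW.int (pL.pow 2)), integral_const_mul]
      linarith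
    -- the mean
    set y := ∫ x in S, Lap W u x ∂(mu W) with hy
    set z := ∫ x in S, (W1 x - m - Lap W u x) ∂(mu W) with hz
    have pE := pf.sub pL
    have hmy : m * (∫ _x in S, (1 : ℝ) ∂(mu W)) = -y - z := by
      rw [hy, hz, ← integral_const_mul, ← integral_neg,
        ← integral_sub (hW.int pL.neg).integrableOn (hW.int pE).integrableOn]
      refine setIntegral_congr_fun hS fun x hxS => ?_
      simp only [h1S x hxS]
      ring
    have hz2 : z ^ 2 ≤ Z * η := by
      have h1 : ∀ τ : ℝ, 2 * τ * z ≤ Z * τ ^ 2 + η := by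
        intro τ
        have pp := (PG.const (τ ^ 2)).add (pE.pow 2)
        have h2 : 2 * τ * z ≤ ∫ x in S, (τ ^ 2 + (W1 x - m - Lap W u x) ^ 2) ∂(mu W) := by
          rw [hz, ← integral_const_mul]
          refine setIntegral_mono_on ((hW.int pE).const_mul _).integrableOn
            (hW.int pp).integrableOn hS fun x _ => ?_
          nlinarith [sq_nonneg (τ - (W1 x - m - Lap W u x))]
        have h3 := setIntegral_le_integral (s := S) (hW.int pp)
          (.of_forall fun x => by simp only [Pi.zero_apply]; positivity)
        rw [integral_add (hW.int (PG.const (τ ^ 2))) (hW.int (pE.pow 2)), hcint] at h3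
        linarith
      have h2 := h1 (z / Z)
      have e1 : 2 * (z / Z) * z = 2 * (z ^ 2 / Z) := by field_simp
      have e2 : Z * (z / Z) ^ 2 = z ^ 2 / Z := by field_simp
      rw [e1, e2] at h2
      rw [← div_le_iff₀' hZ]
      linarith
    have hm2 : θ ^ 2 * (Z * m ^ 2) ≤ (1 + ε) * (2 * n * (A + B)) + (1 + 1 / ε) * η :=
      mean_sq_le hε hθ hZ hmS hmy hsq hz2
    have hm3 : κ * Z * m ^ 2 ≤ 2 * (κ * n * (1 + ε) / θ ^ 2) * (A + B)
        + κ * (1 + 1 / ε) / θ ^ 2 * η := by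
      have h1 : κ * Z * m ^ 2 = κ / θ ^ 2 * (θ ^ 2 * (Z * m ^ 2)) := by field_simp
      rw [h1]
      refine (mul_le_mul_of_nonneg_left hm2 (by positivity)).trans (le_of_eq ?_)
      field_simp
    have hdr' := mul_le_mul_of_nonneg_left hdr hc
    have hn1 : (1 : ℝ) ≤ n := by exact_mod_cast hn
    set D := κ * n * (1 + ε) / θ ^ 2
    have hfin := coeff_nonneg hn1 hc hBA hB0 hcond
    rw [← hA] at hdr'
    simp only [← hB] at hdr'
    have hbo' : ∫ x, Lap W u x ^ 2 ∂(mu W) = A + B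
      + ∫ x, ∑ i, ∑ j, pd j (pd i W) x * pd i u x * pd j u x ∂(mu W) := hbo
    rw [hIL] at hexp
    linarith
  have hlim : ∫ x, (W1 x - m) ^ 2 ∂(mu W) + κ * Z * m ^ 2 - ∫ x, W2 x ∂(mu W)
      ≤ ∫ x, T x ∂(mu W) := by
    refine le_of_forall_pos_le_add fun δ hδ => ?_
    have hC : 0 < 1 + κ * (1 + 1 / ε) / θ ^ 2 := by positivity
    have := main (δ / (1 + κ * (1 + 1 / ε) / θ ^ 2)) (by positivity)
    rwa [mul_div_cancel₀ _ hC.ne'] at this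
  rw [hff] at hlim
  have := mul_le_mul_of_nonneg_left hlim hZ.le
  rw [hmZ]
  linarith

end GaussPQ
namespace GaussPQ

variable {n : ℕ}

lemma ridge_bracket {P r ε δ h d a V Y : ℝ} (hP : 0 ≤ P) (hr : 0 < r) (hε : 0 < ε) (hδ0 : 0 < δ)
    (hδ : ∀ s, s ≤ δ → ph1 s * (P * (1 + 1 / ε)) ≤ r * ph2 s) (hh : r ≤ h) (ha : a ^ 2 ≤ V) :
    -(P / r ^ 2 * (1 + ε) * (V * (ph1 (Y - h) * Y))) - P * d ^ 2 / h * (ph (Y - h) / ph δ) ^ 2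
      ≤ ph2 (Y - h) * (a - d) ^ 2 - ph1 (Y - h) * (P * d ^ 2 / h) := by
  have hh0 : 0 < h := hr.trans_le hh
  have hV : 0 ≤ V := (sq_nonneg a).trans ha
  have hD : 0 ≤ P * d ^ 2 / h := by positivity
  rcases le_or_gt (Y - h) 0 with h0 | h0
  · simp [ph1_of_nonpos h0, ph2_of_nonpos h0, ph_of_nonpos h0]
  have hY : h < Y := by linarith
  have hY0 : 0 < Y := hh0.trans hY
  have h1 := ph1_nonneg (Y - h)
  rcases le_or_gt (Y - h) δ with h2 | h2
  · have e1 : 0 ≤ P * d ^ 2 / h * (ph (Y - h) / ph δ) ^ 2 := by positivity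
    have e2 : d ^ 2 ≤ (1 + ε) * a ^ 2 + (1 + 1 / ε) * (a - d) ^ 2 := by
      have h3 : 0 ≤ (ε * a + (a - d)) ^ 2 / ε := by positivity
      have h4 : (ε * a + (a - d)) ^ 2 / ε
          = ε * a ^ 2 + 2 * a * (a - d) + 1 / ε * (a - d) ^ 2 := by
        field_simp
        ring
      nlinarith
    have e3 : P * d ^ 2 / h ≤ P / h * ((1 + ε) * a ^ 2) + P / h * (1 + 1 / ε) * (a - d) ^ 2 := by
      have := mul_le_mul_of_nonneg_left e2 (by positivity : 0 ≤ P / h)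
      calc P * d ^ 2 / h = P / h * d ^ 2 := by ring
        _ ≤ _ := this
        _ = _ := by ring
    have e4 : 1 / h ≤ Y / r ^ 2 := by
      rw [div_le_div_iff₀ hh0 (by positivity)]
      nlinarith
    have e5 : P / h * ((1 + ε) * a ^ 2) ≤ P / r ^ 2 * (1 + ε) * (V * Y) := by
      calc P / h * ((1 + ε) * a ^ 2) = P * (1 + ε) * (1 / h) * a ^ 2 := by ring
        _ ≤ P * (1 + ε) * (Y / r ^ 2) * V := by gcongr
        _ = _ := by ring
    have e6 : ph1 (Y - h) * (P / h * (1 + 1 / ε) * (a - d) ^ 2) ≤ ph2 (Y - h) * (a - d) ^ 2 := by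
      have h3 : ph1 (Y - h) * (P * (1 + 1 / ε)) ≤ h * ph2 (Y - h) :=
        (hδ _ h2).trans (mul_le_mul_of_nonneg_right hh (ph2_nonneg _))
      have h4 : ph1 (Y - h) * (P * (1 + 1 / ε)) / h ≤ ph2 (Y - h) := by
        rw [div_le_iff₀' hh0]; exact h3
      calc _ = ph1 (Y - h) * (P * (1 + 1 / ε)) / h * (a - d) ^ 2 := by ring
        _ ≤ _ := by gcongr
    have e7 := mul_le_mul_of_nonneg_left (e3.trans (add_le_add_left e5 _)) h1
    linarith
  · have e1 : 0 ≤ P / r ^ 2 * (1 + ε) * (V * (ph1 (Y - h) * Y)) := by positivity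
    have e2 : 0 ≤ ph2 (Y - h) * (a - d) ^ 2 := mul_nonneg (ph2_nonneg _) (sq_nonneg _)
    have e3 : 1 ≤ (ph (Y - h) / ph δ) ^ 2 := by
      refine one_le_pow₀ ?_
      rw [one_le_div (ph_pos hδ0)]
      exact monotone_ph h2.le
    have e4 := mul_le_mul_of_nonneg_left e3 hD
    have e5 := mul_le_mul_of_nonneg_right (ph1_le_one (Y - h)) hD
    linarith

variable {ι : Type*} [Fintype ι] {N : ℝ} {e : ι → Euc n} {h d : ι → ℝ}

lemma PG.ridge_ph {v : Euc n} (hv : ‖v‖ = 1) (a : ℝ) : PG fun x => ph (⟪x, v⟫ - a) := by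
  have hc := continuous_ph
  refine ⟨by fun_prop, 1 + |a|, 1, fun x => (ph_le_abs _).trans ?_⟩
  have h1 := abs_real_inner_le_norm x v
  rw [hv, mul_one] at h1
  have h2 := abs_sub ⟪x, v⟫ a
  nlinarith [abs_nonneg a, norm_nonneg x]

lemma PG.tail (he : ∀ k, ‖e k‖ = 1) (w : ι → ℝ) (b : ℝ) :
    PG (RS N (fun s => (ph s / b) ^ 2) e h w) := by
  unfold RS
  refine (PG.const N).mul (PG.sum _ fun k => (PG.const (w k)).mul ?_)
  simp only [div_eq_mul_inv]
  exact ((PG.ridge_ph (he k) (h k)).mul (PG.const b⁻¹)).pow 2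

lemma integral_tail_le (hN : 0 < N) (he : ∀ k, ‖e k‖ = 1) {w : ι → ℝ} (hw : ∀ k, 0 ≤ w k)
    (b : ℝ) :
    ∫ x, RS N (fun s => (ph s / b) ^ 2) e h w x ∂(mu (RS N ph e h fun _ => 1))
      ≤ (∑ k, w k) / b ^ 2 * (2 / N) * mass (fun _ : Euc n => 0) := by
  have hW := pot_RS (h := h) hN.le he
  have hc := hW.diff.continuous
  have c0 : Continuous fun _ : Euc n => (0 : ℝ) := continuous_const
  rw [integral_mu hc, mass, integral_mu c0, ← integral_const_mul]
  refine integral_mono ((integrable_mu_iff hc _).1 (hW.int (PG.tail he w b)))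
    (((integrable_mu_iff c0 _).1 ((PG.const 1).integrable c0 fun _ => le_rfl)).const_mul _)
    fun x => ?_
  have e1 : ∀ k, Real.exp (-RS N ph e h (fun _ => 1) x)
      * (N * (w k * (ph (⟪x, e k⟫ - h k) / b) ^ 2)) ≤ w k / b ^ 2 * (2 / N) := by
    intro k
    set z := N * ph (⟪x, e k⟫ - h k) with hz
    have hz0 : 0 ≤ z := mul_nonneg hN.le (ph_nonneg _)
    have h1 : z ≤ RS N ph e h (fun _ => 1) x := by
      refine mul_le_mul_of_nonneg_left ?_ hN.le
      simp only [one_mul]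
      exact Finset.single_le_sum (f := fun k => ph (⟪x, e k⟫ - h k)) (fun k _ => ph_nonneg _)
        (Finset.mem_univ k)
    have h2 : Real.exp (-RS N ph e h (fun _ => 1) x) * z ^ 2 ≤ 2 := by
      have h3 : Real.exp (-RS N ph e h (fun _ => 1) x) ≤ Real.exp (-z) :=
        Real.exp_le_exp.2 (by linarith)
      have h4 := Real.quadratic_le_exp_of_nonneg hz0
      have h5 : Real.exp (-z) * Real.exp z = 1 := by rw [← Real.exp_add]; simp
      calc _ ≤ Real.exp (-z) * (2 * Real.exp z) := by
            gcongr
            linarith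
        _ = 2 := by linarith
    have h3 := mul_le_mul_of_nonneg_left h2
      (by have := hw k; positivity : 0 ≤ w k / b ^ 2 * (1 / N))
    calc _ = w k / b ^ 2 * (1 / N) * (Real.exp (-RS N ph e h (fun _ => 1) x) * z ^ 2) := by
          rw [hz]; field_simp
      _ ≤ _ := h3
      _ = _ := by ring
  have e2 : wt (RS N ph e h fun _ => 1) x
      = wt (fun _ => 0) x * Real.exp (-RS N ph e h (fun _ => 1) x) := by
    simp only [wt]
    rw [← Real.exp_add]
    congr 1
    ring
  have e3 : Real.exp (-RS N ph e h (fun _ => 1) x) * RS N (fun s => (ph s / b) ^ 2) e h w x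
      ≤ (∑ k, w k) / b ^ 2 * (2 / N) := by
    have e4 : RS N (fun s => (ph s / b) ^ 2) e h w x
        = ∑ k, N * (w k * (ph (⟪x, e k⟫ - h k) / b) ^ 2) := by rw [RS, Finset.mul_sum]
    rw [e4, Finset.mul_sum, Finset.sum_div, Finset.sum_mul]
    exact Finset.sum_le_sum fun k _ => e1 k
  have e4 := mul_le_mul_of_nonneg_left e3 (wt_pos (fun _ => 0) x).le
  rw [e2]
  linarith

lemma inner_eq_sum_mul (x y : Euc n) : ⟪x, y⟫ = ∑ i, x i * y i := by
  simp [PiLp.inner_apply, mul_comm]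

set_option maxHeartbeats 1000000 in
/-- The static inequality for sums of ridge penalties whose heights move along an `L_p` path. -/
lemma ridge_static (hn : 1 ≤ n) (hN : 0 < N) (he : ∀ k, ‖e k‖ = 1) {σ : Equiv.Perm ι}
    (hσe : ∀ k, e (σ k) = -e k) (hσh : ∀ k, h (σ k) = h k) (hσd : ∀ k, d (σ k) = d k)
    {P r ε δ θ κ : ℝ} (hP : 0 ≤ P) (hr : 0 < r) (hε : 0 < ε) (hδ0 : 0 < δ)
    (hδ : ∀ s, s ≤ δ → ph1 s * (P * (1 + 1 / ε)) ≤ r * ph2 s) (hh : ∀ k, r ≤ h k)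
    (hθ : 0 < θ) (hκ : 0 ≤ κ)
    (hmS : θ * mass (RS N ph e h fun _ => 1)
      ≤ ∫ _x in {x | ∀ k, ⟪x, e k⟫ ≤ h k}, (1 : ℝ) ∂(mu (RS N ph e h fun _ => 1)))
    (hcond : (n + 1) * (P / r ^ 2 * (1 + ε)) + 4 * (κ * n * (1 + ε) / θ ^ 2) ≤ 2) :
    (∫ x, RS N ph1 e h (fun k => -d k) x ^ 2 ∂(mu (RS N ph e h fun _ => 1)))
        * mass (RS N ph e h fun _ => 1)
      - (1 - κ) * (∫ x, RS N ph1 e h (fun k => -d k) x ∂(mu (RS N ph e h fun _ => 1))) ^ 2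
      - (∫ x, (RS N ph2 e h (fun k => d k ^ 2) x
          - RS N ph1 e h (fun k => P * d k ^ 2 / h k) x) ∂(mu (RS N ph e h fun _ => 1)))
        * mass (RS N ph e h fun _ => 1)
      ≤ mass (RS N ph e h fun _ => 1) * ((∑ k, P * d k ^ 2 / h k) / ph δ ^ 2 * (2 / N)
          * mass (fun _ : Euc n => 0)) := by
  have hW := pot_RS (h := h) hN.le he
  have hh0 : ∀ k, 0 < h k := fun k => hr.trans_le (hh k)
  have hdrift : ∀ x, ∑ i, x i * pd i (RS N ph e h fun _ => 1) x
      = N * ∑ k, ph1 (⟪x, e k⟫ - h k) * ⟪x, e k⟫ := by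
    intro x
    simp only [pd_RS hasDerivAt_ph, RS, inner_eq_sum_mul x, Finset.mul_sum]
    rw [Finset.sum_comm]
    exact Finset.sum_congr rfl fun k _ => Finset.sum_congr rfl fun i _ => by ring
  have hz : ∀ k, ∀ x ∈ {x : Euc n | ∀ k, ⟪x, e k⟫ ≤ h k}, ph1 (⟪x, e k⟫ - h k) = 0 :=
    fun k x hx => ph1_of_nonpos (sub_nonpos.2 (hx k))
  have hS : MeasurableSet {x : Euc n | ∀ k, ⟪x, e k⟫ ≤ h k} := by
    rw [Set.ofPred_forall]
    exact MeasurableSet.iInter fun k => (isClosed_le (by fun_prop) continuous_const).measurableSet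
  refine (hW.static (RS_even hσe hσh fun _ => rfl) hn (fun x => ?_) hS (fun x hx i => ?_)
    (W1 := RS N ph1 e h fun k => -d k)
    (W2 := fun x => RS N ph2 e h (fun k => d k ^ 2) x - RS N ph1 e h (fun k => P * d k ^ 2 / h k) x)
    (T := RS N (fun s => (ph s / ph δ) ^ 2) e h fun k => P * d k ^ 2 / h k)
    (differentiable_RS hasDerivAt_ph1) (.RS1 hN.le)
    (fun i => by rw [pd_RS hasDerivAt_ph1]; exact .RS2 hN.le)
    (PG.sub (.RS2 hN.le) (.RS1 hN.le)) (PG.tail he _ _)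
    (RS_even hσe hσh fun k => by rw [hσd]) (fun x hx => ?_)
    (c := P / r ^ 2 * (1 + ε)) (by positivity) hε hθ hκ hmS (fun x v => ?_) hcond).trans ?_
  · rw [hdrift]
    refine mul_nonneg hN.le (Finset.sum_nonneg fun k _ => ?_)
    rcases le_total (⟪x, e k⟫ - h k) 0 with h0 | h0
    · rw [ph1_of_nonpos h0, zero_mul]
    · exact mul_nonneg (ph1_nonneg _) (by linarith [hh0 k])
  · rw [pd_RS hasDerivAt_ph, RS]
    simp [hz _ x hx]
  · rw [RS]
    simp [hz _ x hx]
  · have q1 : ∑ i, ∑ j, pd j (pd i (RS N ph e h fun _ => 1)) x * v i * v j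
        = N * ∑ k, ph2 (⟪x, e k⟫ - h k) * (∑ i, v i * e k i) ^ 2 := by
      simp only [pd_RS hasDerivAt_ph, pd_RS hasDerivAt_ph1, RS]
      exact sum_quadratic N _ (fun k => e k) v
    have q2 : ∑ i, pd i (RS N ph1 e h fun k => -d k) x * v i
        = N * ∑ k, -(d k * ph2 (⟪x, e k⟫ - h k) * ∑ i, v i * e k i) := by
      simp only [pd_RS hasDerivAt_ph1, RS, Finset.mul_sum, Finset.sum_mul, ← Finset.sum_neg_distrib]
      rw [Finset.sum_comm]
      exact Finset.sum_congr rfl fun k _ => Finset.sum_congr rfl fun i _ => by ring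
    rw [q1, q2, hdrift]
    have q3 : ∀ k, (∑ i, v i * e k i) ^ 2 ≤ ∑ i, v i ^ 2 := by
      intro k
      have h1 := Finset.sum_mul_sq_le_sq_mul_sq Finset.univ v (fun i => e k i)
      have h2 : ∑ i, e k i ^ 2 = 1 := by
        have := EuclideanSpace.real_norm_sq_eq (e k)
        rw [← this, he, one_pow]
      rwa [h2, mul_one] at h1
    have q4 := mul_le_mul_of_nonneg_left (Finset.sum_le_sum fun k (_ : k ∈ Finset.univ) =>
      ridge_bracket (d := d k) (Y := ⟪x, e k⟫) hP hr hε hδ0 hδ (hh k) (q3 k)) hN.le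
    simp only [RS]
    refine le_trans (le_of_eq ?_) (q4.trans (le_of_eq ?_))
    · rw [Finset.sum_sub_distrib, Finset.sum_neg_distrib, ← Finset.mul_sum, ← Finset.mul_sum]
      ring
    · have q5 : ∑ k, (ph2 (⟪x, e k⟫ - h k) * (∑ i, v i * e k i - d k) ^ 2
            - ph1 (⟪x, e k⟫ - h k) * (P * d k ^ 2 / h k))
          = ∑ k, d k ^ 2 * ph2 (⟪x, e k⟫ - h k)
            - ∑ k, P * d k ^ 2 / h k * ph1 (⟪x, e k⟫ - h k)
            + 2 * (∑ k, -(d k * ph2 (⟪x, e k⟫ - h k) * ∑ i, v i * e k i))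
            + ∑ k, ph2 (⟪x, e k⟫ - h k) * (∑ i, v i * e k i) ^ 2 := by
        rw [Finset.mul_sum, ← Finset.sum_sub_distrib, ← Finset.sum_add_distrib,
          ← Finset.sum_add_distrib]
        exact Finset.sum_congr rfl fun k _ => by ring
      rw [q5]
      ring
  · exact mul_le_mul_of_nonneg_left (integral_tail_le hN he
      (fun k => div_nonneg (by positivity) (hh0 k).le) _) hW.mass_pos.le

end GaussPQ
namespace GaussPQ

variable {n : ℕ}

/-- An approximate concavity criterion for `F ^ κ`. -/
lemma rpow_concave_approx {F F1 F2 : ℝ → ℝ} (hF : ContinuousOn F (Set.Icc 0 1))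
    (h1 : ∀ t ∈ Set.Ioo (0 : ℝ) 1, HasDerivAt F (F1 t) t)
    (h2 : ∀ t ∈ Set.Ioo (0 : ℝ) 1, HasDerivAt F1 (F2 t) t)
    {m κ τ : ℝ} (hm : 0 < m) (hmF : ∀ t ∈ Set.Icc (0 : ℝ) 1, m ≤ F t) (hκ : 0 ≤ κ) (hκ1 : κ ≤ 1)
    (hτ : 0 ≤ τ)
    (hode : ∀ t ∈ Set.Ioo (0 : ℝ) 1, F t * F2 t - (1 - κ) * F1 t ^ 2 ≤ F t * τ)
    {l : ℝ} (hl : l ∈ Set.Icc (0 : ℝ) 1) :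
    l * F 1 ^ κ + (1 - l) * F 0 ^ κ ≤ F l ^ κ + κ * m ^ (κ - 1) * τ / 2 := by
  set E := κ * m ^ (κ - 1) * τ with hE
  have hE0 : 0 ≤ E := by positivity
  have hpos : ∀ t ∈ Set.Icc (0 : ℝ) 1, 0 < F t := fun t ht => hm.trans_le (hmF t ht)
  have hconc : ConcaveOn ℝ (Set.Icc (0 : ℝ) 1) fun t => F t ^ κ - E * t ^ 2 / 2 := by
    refine concaveOn_of_hasDerivWithinAt2_nonpos (convex_Icc 0 1)
      (f' := fun t => F1 t * κ * F t ^ (κ - 1) - E * t)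
      (f'' := fun t => F2 t * κ * F t ^ (κ - 1)
        + F1 t * κ * (F1 t * (κ - 1) * F t ^ (κ - 1 - 1)) - E) ?_ ?_ ?_ ?_
    · exact (hF.rpow_const fun t ht => Or.inl (hpos t ht).ne').sub (by fun_prop)
    · intro t ht
      rw [interior_Icc] at ht
      have hp := hpos t (Set.Ioo_subset_Icc_self ht)
      have e1 := (h1 t ht).rpow_const (p := κ) (Or.inl hp.ne')
      have e2 : HasDerivAt (fun t : ℝ => E * t ^ 2 / 2) (E * t) t := by
        have := ((hasDerivAt_pow 2 t).const_mul E).div_const 2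
        refine this.congr_deriv ?_
        simp
        ring
      exact (e1.sub e2).hasDerivWithinAt
    · intro t ht
      rw [interior_Icc] at ht
      have hp := hpos t (Set.Ioo_subset_Icc_self ht)
      have e1 := ((h2 t ht).mul_const κ).mul ((h1 t ht).rpow_const (p := κ - 1) (Or.inl hp.ne'))
      have e2 : HasDerivAt (fun t : ℝ => E * t) E t := by
        simpa using (hasDerivAt_id t).const_mul E
      exact (e1.sub e2).hasDerivWithinAt
    · intro t ht
      rw [interior_Icc] at ht
      have hp := hpos t (Set.Ioo_subset_Icc_self ht)
      have e1 : F t ^ (κ - 1) = F t ^ (κ - 1 - 1) * F t := by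
        rw [← Real.rpow_add_one hp.ne']; congr 1; ring
      have e2 := mul_le_mul_of_nonneg_left (hode t ht)
        (by positivity : 0 ≤ κ * F t ^ (κ - 1 - 1))
      have e3 : F t ^ (κ - 1) ≤ m ^ (κ - 1) :=
        Real.rpow_le_rpow_of_nonpos hm (hmF t (Set.Ioo_subset_Icc_self ht)) (by linarith)
      have e4 := mul_le_mul_of_nonneg_left e3 (by positivity : 0 ≤ κ * τ)
      rw [e1] at e4 ⊢
      rw [hE]
      linarith
  have := hconc.2 (Set.right_mem_Icc.2 zero_le_one) (Set.left_mem_Icc.2 zero_le_one) hl.1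
    (sub_nonneg.2 hl.2) (by ring)
  simp only [smul_eq_mul, mul_one, mul_zero, add_zero] at this
  have h3 : E * l ≤ E := mul_le_of_le_one_right hE0 hl.2
  have h4 : 0 ≤ E * l ^ 2 := by positivity
  linarith

/-- Differentiation of `t ↦ ∫ g t ∂(mu (W t))`. -/
lemma hasDerivAt_integral_mu {W W1 g g1 : ℝ → Euc n → ℝ} {C : ℝ} {I : Set ℝ} (hI : IsOpen I)
    (cW : ∀ t, Continuous (W t)) (W0 : ∀ t x, 0 ≤ W t x) (cg : ∀ t, Continuous (g t))
    (pg : ∀ t, PG (g t)) (cW1 : ∀ t, Continuous (W1 t)) (cg1 : ∀ t, Continuous (g1 t))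
    (hW : ∀ t ∈ I, ∀ x, HasDerivAt (fun t => W t x) (W1 t x) t)
    (hg : ∀ t ∈ I, ∀ x, HasDerivAt (fun t => g t x) (g1 t x) t)
    (hC : ∀ t ∈ I, ∀ x, |g1 t x - W1 t x * g t x| ≤ C) {t : ℝ} (ht : t ∈ I) :
    HasDerivAt (fun t => ∫ x, g t x ∂(mu (W t)))
      (∫ x, (g1 t x - W1 t x * g t x) ∂(mu (W t))) t := by
  simp only [integral_mu (cW _)]
  have c0 : Continuous fun _ : Euc n => (0 : ℝ) := continuous_const
  have cw := fun t => continuous_wt (cW t)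
  refine (hasDerivAt_integral_of_dominated_loc_of_deriv_le
    (F := fun t x => wt (W t) x * g t x)
    (F' := fun t x => wt (W t) x * (g1 t x - W1 t x * g t x))
    (bound := fun x => wt (fun _ => 0) x * C) (hI.mem_nhds ht) ?_ ?_ ?_ ?_ ?_ ?_).2
  · exact .of_forall fun t => ((cw t).mul (cg t)).aestronglyMeasurable
  · exact (integrable_mu_iff (cW t) _).1 ((pg t).integrable (cW t) (W0 t))
  · have := cw t
    have := cW1 t
    have := cg t
    have := cg1 t
    exact (by fun_prop : Continuous fun x => wt (W t) x * (g1 t x - W1 t x * g t x))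
      |>.aestronglyMeasurable
  · refine .of_forall fun x s hs => ?_
    rw [norm_mul, Real.norm_eq_abs, Real.norm_eq_abs, abs_of_pos (wt_pos _ _)]
    refine mul_le_mul ?_ (hC s hs x) (abs_nonneg _) (wt_pos _ _).le
    unfold wt
    exact Real.exp_le_exp.2 (by linarith [W0 s x])
  · exact (integrable_mu_iff c0 _).1 ((PG.const C).integrable c0 fun _ => le_rfl)
  · refine .of_forall fun x s hs => ?_
    have e1 : HasDerivAt (fun t => wt (W t) x) (wt (W s) x * (-W1 s x)) s := by
      simpa [wt] using ((hW s hs x).const_sub (-‖x‖ ^ 2 / 2)).exp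
    exact (e1.mul (hg s hs x)).congr_deriv (by ring)

variable {ι : Type*} [Fintype ι] {N : ℝ} {e : ι → Euc n}

lemma hasDerivAt_RS {g g' : ℝ → ℝ} (hg : ∀ s, HasDerivAt g (g' s) s) {h w : ℝ → ι → ℝ}
    {h1 w1 : ι → ℝ} {t : ℝ} (hh : ∀ k, HasDerivAt (fun t => h t k) (h1 k) t)
    (hw : ∀ k, HasDerivAt (fun t => w t k) (w1 k) t) (x : Euc n) :
    HasDerivAt (fun t => RS N g e (h t) (w t) x)
      (RS N g e (h t) w1 x - RS N g' e (h t) (fun k => w t k * h1 k) x) t := by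
  have e1 : ∀ k, HasDerivAt (fun t => w t k * g (⟪x, e k⟫ - h t k))
      (w1 k * g (⟪x, e k⟫ - h t k) + w t k * (g' (⟪x, e k⟫ - h t k) * -h1 k)) t :=
    fun k => (hw k).mul ((hg _).comp t ((hh k).const_sub _))
  refine ((HasDerivAt.fun_sum fun k (_ : k ∈ Finset.univ) => e1 k).const_mul N).congr_deriv ?_
  unfold RS
  rw [← mul_sub, ← Finset.sum_sub_distrib]
  congr 1
  exact Finset.sum_congr rfl fun k _ => by ring

/-- The family of penalised Gaussian masses along a path of heights. -/
def pathMass (N : ℝ) (e : ι → Euc n) (h : ℝ → ι → ℝ) (t : ℝ) : ℝ :=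
  mass (RS N ph e (h t) fun _ => 1)

lemma continuous_pathMass (hN : 0 ≤ N) (he : ∀ k, ‖e k‖ = 1) {h : ℝ → ι → ℝ}
    (hh : ∀ k, Continuous fun t => h t k) : Continuous (pathMass N e h) := by
  have hW := fun t => pot_RS (h := h t) hN he
  have c0 : Continuous fun _ : Euc n => (0 : ℝ) := continuous_const
  unfold pathMass mass
  simp only [integral_mu (hW _).diff.continuous, mul_one]
  refine continuous_of_dominated (bound := fun x => wt (fun _ => 0) x)
    (fun t => (continuous_wt (hW t).diff.continuous).aestronglyMeasurable)
    (fun t => .of_forall fun x => ?_) ?_ (.of_forall fun x => ?_)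
  · rw [Real.norm_eq_abs, abs_of_pos (wt_pos _ _)]
    unfold wt
    exact Real.exp_le_exp.2 (by linarith [(hW t).nonneg x])
  · simpa using (integrable_mu_iff c0 _).1 ((PG.const 1).integrable c0 fun _ => le_rfl)
  · have := continuous_ph
    unfold wt RS
    fun_prop

set_option maxHeartbeats 1000000 in
lemma pathMass_approx (hn : 1 ≤ n) (hN : 0 < N) (he : ∀ k, ‖e k‖ = 1) {σ : Equiv.Perm ι}
    (hσe : ∀ k, e (σ k) = -e k) {h d : ℝ → ι → ℝ} (hσh : ∀ t k, h t (σ k) = h t k)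
    (hσd : ∀ t k, d t (σ k) = d t k) {P r ε δ θ κ D m : ℝ} (hP : 0 ≤ P) (hr : 0 < r) (hε : 0 < ε)
    (hδ0 : 0 < δ) (hδ : ∀ s, s ≤ δ → ph1 s * (P * (1 + 1 / ε)) ≤ r * ph2 s)
    (hc : ∀ k, Continuous fun t => h t k)
    (hh : ∀ t ∈ Set.Icc (0 : ℝ) 1, ∀ k, r ≤ h t k)
    (hd : ∀ t ∈ Set.Ioo (0 : ℝ) 1, ∀ k, HasDerivAt (fun t => h t k) (d t k) t)
    (hd2 : ∀ t ∈ Set.Ioo (0 : ℝ) 1, ∀ k,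
      HasDerivAt (fun t => d t k) (P * d t k ^ 2 / h t k) t)
    (hD : ∀ t ∈ Set.Ioo (0 : ℝ) 1, ∀ k, |d t k| ≤ D)
    (hθ : 0 < θ) (hκ : 0 ≤ κ) (hκ1 : κ ≤ 1)
    (hmS : ∀ t ∈ Set.Ioo (0 : ℝ) 1, θ * pathMass N e h t
      ≤ ∫ _x in {x | ∀ k, ⟪x, e k⟫ ≤ h t k}, (1 : ℝ) ∂(mu (RS N ph e (h t) fun _ => 1)))
    (hm : 0 < m) (hmF : ∀ t ∈ Set.Icc (0 : ℝ) 1, m ≤ pathMass N e h t)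
    (hcond : (n + 1) * (P / r ^ 2 * (1 + ε)) + 4 * (κ * n * (1 + ε) / θ ^ 2) ≤ 2)
    {l : ℝ} (hl : l ∈ Set.Icc (0 : ℝ) 1) :
    l * pathMass N e h 1 ^ κ + (1 - l) * pathMass N e h 0 ^ κ ≤ pathMass N e h l ^ κ
      + κ * m ^ (κ - 1) * ((Fintype.card ι * (P * D ^ 2 / r)) / ph δ ^ 2 * (2 / N)
          * mass (fun _ : Euc n => 0)) / 2 := by
  have hW := fun t => pot_RS (h := h t) hN.le he
  have hmass0 : 0 ≤ mass (fun _ : Euc n => (0 : ℝ)) := integral_nonneg fun _ => zero_le_one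
  have hd2b : ∀ t ∈ Set.Ioo (0 : ℝ) 1, ∀ k,
      0 ≤ P * d t k ^ 2 / h t k ∧ P * d t k ^ 2 / h t k ≤ P * D ^ 2 / r := by
    intro t ht k
    have h1 := hh t (Set.Ioo_subset_Icc_self ht) k
    have h2 : d t k ^ 2 ≤ D ^ 2 := sq_le_sq' (abs_le.1 (hD t ht k)).1 (abs_le.1 (hD t ht k)).2
    exact ⟨div_nonneg (by positivity) (hr.le.trans h1), by gcongr⟩
  have hWt : ∀ t ∈ Set.Ioo (0 : ℝ) 1, ∀ x, HasDerivAt (fun t => RS N ph e (h t) (fun _ => 1) x)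
      (RS N ph1 e (h t) (fun k => -d t k) x) t := by
    intro t ht x
    refine (hasDerivAt_RS hasDerivAt_ph (w := fun _ _ => 1) (w1 := fun _ => 0) (hd t ht)
      (fun k => hasDerivAt_const t (1 : ℝ)) x).congr_deriv ?_
    simp [RS]
  have hW1t : ∀ t ∈ Set.Ioo (0 : ℝ) 1, ∀ x,
      HasDerivAt (fun t => RS N ph1 e (h t) (fun k => -d t k) x)
        (RS N ph2 e (h t) (fun k => d t k ^ 2) x
          - RS N ph1 e (h t) (fun k => P * d t k ^ 2 / h t k) x) t := by
    intro t ht x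
    refine (hasDerivAt_RS hasDerivAt_ph1 (w := fun t k => -d t k) (hd t ht)
      (fun k => (hd2 t ht k).neg) x).congr_deriv ?_
    unfold RS
    simp only [neg_mul, Finset.sum_neg_distrib, mul_neg, sq]
    ring
  have b1 : ∀ t ∈ Set.Ioo (0 : ℝ) 1, ∀ x, |RS N ph1 e (h t) (fun k => -d t k) x|
      ≤ N * (Fintype.card ι * (D * 1)) := fun t ht x =>
    abs_RS_le hN.le abs_ph1_le (fun k => by rw [abs_neg]; exact hD t ht k) x
  have b2 : ∀ t ∈ Set.Ioo (0 : ℝ) 1, ∀ x, |RS N ph2 e (h t) (fun k => d t k ^ 2) x|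
      ≤ N * (Fintype.card ι * (D ^ 2 * 2)) := fun t ht x =>
    abs_RS_le hN.le abs_ph2_le (fun k => by
      rw [abs_pow]
      exact pow_le_pow_left₀ (abs_nonneg _) (hD t ht k) 2) x
  have b3 : ∀ t ∈ Set.Ioo (0 : ℝ) 1, ∀ x, |RS N ph1 e (h t) (fun k => P * d t k ^ 2 / h t k) x|
      ≤ N * (Fintype.card ι * (P * D ^ 2 / r * 1)) := fun t ht x =>
    abs_RS_le hN.le abs_ph1_le (fun k => by
      rw [abs_of_nonneg (hd2b t ht k).1]; exact (hd2b t ht k).2) x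
  have c1 : ∀ {w : ι → ℝ} t, Continuous (RS N ph1 e (h t) w) := fun t => continuous_RS continuous_ph1
  have c2 : ∀ {w : ι → ℝ} t, Continuous (RS N ph2 e (h t) w) := fun t => continuous_RS continuous_ph2
  have D1 : ∀ t ∈ Set.Ioo (0 : ℝ) 1, HasDerivAt (pathMass N e h)
      (∫ x, (0 - RS N ph1 e (h t) (fun k => -d t k) x * 1)
        ∂(mu (RS N ph e (h t) fun _ => 1))) t := fun t ht =>
    hasDerivAt_integral_mu isOpen_Ioo (W := fun t => RS N ph e (h t) fun _ => 1)
      (W1 := fun t => RS N ph1 e (h t) fun k => -d t k) (g := fun _ _ => 1) (g1 := fun _ _ => 0)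
      (fun t => (hW t).diff.continuous) (fun t => (hW t).nonneg) (fun t => continuous_const)
      (fun t => PG.const 1) (fun t => c1 t) (fun t => continuous_const) hWt
      (fun t _ x => hasDerivAt_const t (1 : ℝ))
      (fun t ht x => by simpa using b1 t ht x) ht
  simp only [mul_one, zero_sub] at D1
  have D2 : ∀ t ∈ Set.Ioo (0 : ℝ) 1, HasDerivAt
      (fun t => ∫ x, -RS N ph1 e (h t) (fun k => -d t k) x ∂(mu (RS N ph e (h t) fun _ => 1)))
      (∫ x, (-(RS N ph2 e (h t) (fun k => d t k ^ 2) x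
          - RS N ph1 e (h t) (fun k => P * d t k ^ 2 / h t k) x)
        - RS N ph1 e (h t) (fun k => -d t k) x * -RS N ph1 e (h t) (fun k => -d t k) x)
        ∂(mu (RS N ph e (h t) fun _ => 1))) t := fun t ht =>
    hasDerivAt_integral_mu isOpen_Ioo (W := fun t => RS N ph e (h t) fun _ => 1)
      (W1 := fun t => RS N ph1 e (h t) fun k => -d t k)
      (g := fun t x => -RS N ph1 e (h t) (fun k => -d t k) x)
      (g1 := fun t x => -(RS N ph2 e (h t) (fun k => d t k ^ 2) x
          - RS N ph1 e (h t) (fun k => P * d t k ^ 2 / h t k) x))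
      (C := N * (Fintype.card ι * (D ^ 2 * 2)) + N * (Fintype.card ι * (P * D ^ 2 / r * 1))
        + (N * (Fintype.card ι * (D * 1))) * (N * (Fintype.card ι * (D * 1))))
      (fun t => (hW t).diff.continuous) (fun t => (hW t).nonneg) (fun t => (c1 t).neg)
      (fun t => (PG.RS1 hN.le).neg) (fun t => c1 t) (fun t => ((c2 t).sub (c1 t)).neg) hWt
      (fun t ht x => (hW1t t ht x).neg)
      (fun t ht x => by
        have q1 := b1 t ht x
        have q2 := b2 t ht x
        have q3 := b3 t ht x
        have q4 := mul_le_mul q1 q1 (abs_nonneg _) ((abs_nonneg _).trans q1)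
        rw [← abs_mul] at q4
        rw [mul_neg, sub_neg_eq_add]
        refine (abs_add_le _ _).trans (add_le_add ?_ q4)
        rw [abs_neg]
        exact (abs_sub _ _).trans (add_le_add q2 q3)) ht
  refine rpow_concave_approx (continuous_pathMass hN.le he hc).continuousOn D1 D2 hm hmF hκ hκ1
    (by positivity) (fun t ht => ?_) hl
  have hst := ridge_static (h := h t) (d := d t) hn hN he hσe (hσh t) (hσd t) hP hr hε hδ0 hδ
    (hh t (Set.Ioo_subset_Icc_self ht)) hθ hκ (hmS t ht) hcond
  have i1 := (hW t).int (PG.RS1 (e := e) (h := h t) (w := fun k => -d t k) hN.le)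
  have i2 : Integrable (fun x => RS N ph2 e (h t) (fun k => d t k ^ 2) x
      - RS N ph1 e (h t) (fun k => P * d t k ^ 2 / h t k) x) (mu (RS N ph e (h t) fun _ => 1)) :=
    (hW t).int ((PG.RS2 hN.le).sub (PG.RS1 hN.le))
  have i3 := (hW t).int ((PG.RS1 (e := e) (h := h t) (w := fun k => -d t k) hN.le).pow 2)
  have e1 : ∫ x, (-(RS N ph2 e (h t) (fun k => d t k ^ 2) x
          - RS N ph1 e (h t) (fun k => P * d t k ^ 2 / h t k) x)
        - RS N ph1 e (h t) (fun k => -d t k) x * -RS N ph1 e (h t) (fun k => -d t k) x)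
        ∂(mu (RS N ph e (h t) fun _ => 1))
      = ∫ x, RS N ph1 e (h t) (fun k => -d t k) x ^ 2 ∂(mu (RS N ph e (h t) fun _ => 1))
        - ∫ x, (RS N ph2 e (h t) (fun k => d t k ^ 2) x
          - RS N ph1 e (h t) (fun k => P * d t k ^ 2 / h t k) x)
          ∂(mu (RS N ph e (h t) fun _ => 1)) := by
    rw [← integral_sub i3 i2]
    refine integral_congr_ae (.of_forall fun x => ?_)
    simp only
    ring
  rw [e1, integral_neg, neg_sq]
  have e2 : (∑ k, P * d t k ^ 2 / h t k) ≤ Fintype.card ι * (P * D ^ 2 / r) := by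
    refine (Finset.sum_le_sum fun k _ => (hd2b t ht k).2).trans (le_of_eq ?_)
    simp
  have e3 : pathMass N e h t * ((∑ k, P * d t k ^ 2 / h t k) / ph δ ^ 2 * (2 / N)
      * mass (fun _ : Euc n => 0)) ≤ pathMass N e h t * (Fintype.card ι * (P * D ^ 2 / r)
        / ph δ ^ 2 * (2 / N) * mass (fun _ : Euc n => 0)) := by
    have : 0 ≤ pathMass N e h t := hm.le.trans (hmF t (Set.Ioo_subset_Icc_self ht))
    gcongr
  refine le_trans (le_of_eq ?_) (hst.trans e3)
  unfold pathMass
  ring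

end GaussPQ
namespace GaussPQ

variable {n : ℕ} {ι : Type*} {N : ℝ} {e : ι → Euc n} {h : ι → ℝ}

/-- The polyhedron cut out by half-spaces with normals `e` and heights `h`. -/
def poly (e : ι → Euc n) (h : ι → ℝ) : Set (Euc n) := {x | ∀ k, ⟪x, e k⟫ ≤ h k}

lemma isClosed_poly (e : ι → Euc n) (h : ι → ℝ) : IsClosed (poly e h) := by
  unfold poly
  rw [Set.ofPred_forall]
  exact isClosed_iInter fun k => isClosed_le (by fun_prop) continuous_const

lemma integrable_wt_zero : Integrable (wt fun _ : Euc n => 0) := by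
  have c0 : Continuous fun _ : Euc n => (0 : ℝ) := continuous_const
  simpa using (integrable_mu_iff c0 _).1 ((PG.const 1).integrable c0 fun _ => le_rfl)

/-- The unnormalised Gaussian measure of a set, as a real number. -/
def gm (S : Set (Euc n)) : ℝ := ∫ x in S, wt (fun _ => 0) x

lemma gm_nonneg (S : Set (Euc n)) : 0 ≤ gm S := integral_nonneg fun x => (wt_pos _ x).le

lemma gm_mono {S T : Set (Euc n)} (hT : S ⊆ T) : gm S ≤ gm T :=
  setIntegral_mono_set integrable_wt_zero.integrableOn (.of_forall fun x => (wt_pos _ x).le)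
    hT.eventuallyLE

lemma mass_zero_eq : mass (fun _ : Euc n => 0) = ∫ x : Euc n, wt (fun _ => 0) x := by
  rw [mass, integral_mu continuous_const]
  simp

lemma gm_poly_smul_le (e : ι → Euc n) (h : ι → ℝ) {s : ℝ} (hs : 1 ≤ s) :
    gm (poly e fun k => s * h k) ≤ s ^ n * gm (poly e h) := by
  have hs0 : 0 < s := by linarith
  have m1 := (isClosed_poly e fun k => s * h k).measurableSet
  have m2 := (isClosed_poly e h).measurableSet
  unfold gm
  rw [← integral_indicator m1, ← integral_indicator m2]
  have h1 := Measure.integral_comp_smul (volume : Measure (Euc n))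
    ((poly e fun k => s * h k).indicator (wt fun _ => 0)) s
  rw [finrank_euclideanSpace_fin, abs_of_pos (by positivity), smul_eq_mul,
    eq_inv_mul_iff_mul_eq₀ (by positivity)] at h1
  rw [← h1]
  refine mul_le_mul_of_nonneg_left ?_ (by positivity)
  refine integral_mono ((integrable_wt_zero.indicator m1).comp_smul hs0.ne')
    (integrable_wt_zero.indicator m2) fun x => ?_
  have e1 : s • x ∈ (poly e fun k => s * h k) ↔ x ∈ poly e h := by
    simp only [poly, Set.mem_ofPred_eq, real_inner_smul_left]
    exact forall_congr' fun _ => mul_le_mul_iff_right₀ hs0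
  by_cases hx : x ∈ poly e h
  · simp only [Set.indicator_of_mem hx, Set.indicator_of_mem (e1.2 hx), wt, norm_smul,
      Real.norm_eq_abs, abs_of_pos hs0]
    refine Real.exp_le_exp.2 ?_
    nlinarith [mul_le_mul_of_nonneg_right (one_le_pow₀ hs : 1 ≤ s ^ 2) (sq_nonneg ‖x‖)]
  · simp only [Set.indicator_of_notMem hx, Set.indicator_of_notMem (fun hh => hx (e1.1 hh))]
    exact le_rfl

lemma closedBall_subset_poly (he : ∀ k, ‖e k‖ = 1) {r : ℝ} (hh : ∀ k, r ≤ h k) :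
    Metric.closedBall (0 : Euc n) r ⊆ poly e h := fun x hx k => by
  have h1 := real_inner_le_norm x (e k)
  rw [he, mul_one] at h1
  exact h1.trans ((mem_closedBall_zero_iff.1 hx).trans (hh k))

variable [Fintype ι]

lemma RS_ph_nonneg (hN : 0 ≤ N) (x : Euc n) : 0 ≤ RS N ph e h (fun _ => 1) x :=
  mul_nonneg hN (Finset.sum_nonneg fun _ _ => mul_nonneg zero_le_one (ph_nonneg _))

lemma mass_RS_le (hN : 0 ≤ N) {r a : ℝ} (hr : 0 < r) (ha : 0 < a) (hh : ∀ k, r ≤ h k) :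
    mass (RS N ph e h fun _ => 1)
      ≤ (1 + a / r) ^ n * gm (poly e h) + Real.exp (-(N * ph a)) * mass (fun _ : Euc n => 0) := by
  have hc : Continuous (RS N ph e h fun _ => 1) := continuous_RS continuous_ph
  have m1 := (isClosed_poly e fun k => (1 + a / r) * h k).measurableSet
  refine le_trans ?_ (add_le_add_left (gm_poly_smul_le e h
    (by have : 0 < a / r := by positivity
        linarith)) _)
  rw [mass_zero_eq, ← integral_const_mul, gm, ← integral_indicator m1,
    ← integral_add (integrable_wt_zero.indicator m1) (integrable_wt_zero.const_mul _), mass,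
    integral_mu hc]
  refine integral_mono ((integrable_mu_iff hc _).1 ((PG.const 1).integrable hc (RS_ph_nonneg hN)))
    ((integrable_wt_zero.indicator m1).add (integrable_wt_zero.const_mul _)) fun x => ?_
  have hw := wt_pos (fun _ => 0) x
  have e2 : wt (RS N ph e h fun _ => 1) x
      = Real.exp (-RS N ph e h (fun _ => 1) x) * wt (fun _ => 0) x := by
    simp only [wt]
    rw [← Real.exp_add]
    congr 1
    ring
  simp only [mul_one, e2]
  by_cases hx : x ∈ poly e fun k => (1 + a / r) * h k
  · simp only [Set.indicator_of_mem hx]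
    have h1 : Real.exp (-RS N ph e h (fun _ => 1) x) ≤ 1 :=
      Real.exp_le_one_iff.2 (by linarith [RS_ph_nonneg (e := e) (h := h) hN x])
    have h2 := mul_le_mul_of_nonneg_right h1 hw.le
    have h3 := mul_pos (Real.exp_pos (-(N * ph a))) hw
    linarith
  · simp only [Set.indicator_of_notMem hx, zero_add]
    refine mul_le_mul_of_nonneg_right (Real.exp_le_exp.2 (neg_le_neg ?_)) hw.le
    simp only [poly, Set.mem_ofPred_eq, not_forall, not_le] at hx
    obtain ⟨k, hk⟩ := hx
    refine mul_le_mul_of_nonneg_left ?_ hN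
    have h1 : a ≤ ⟪x, e k⟫ - h k := by
      have : a ≤ a / r * h k := by
        rw [div_mul_eq_mul_div, le_div_iff₀ hr]
        exact mul_le_mul_of_nonneg_left (hh k) ha.le
      linarith
    simp only [one_mul]
    exact (monotone_ph h1).trans (Finset.single_le_sum (f := fun k => ph (⟪x, e k⟫ - h k))
      (fun k _ => ph_nonneg _) (Finset.mem_univ k))

lemma setIntegral_poly :
    ∫ _x in poly e h, (1 : ℝ) ∂(mu (RS N ph e h fun _ => 1)) = gm (poly e h) := by
  have hc : Continuous (RS N ph e h fun _ => 1) := continuous_RS continuous_ph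
  have m1 := (isClosed_poly e h).measurableSet
  rw [← integral_indicator m1, integral_mu hc, gm, ← integral_indicator m1]
  refine integral_congr_ae (.of_forall fun x => ?_)
  by_cases hx : x ∈ poly e h
  · have h1 : RS N ph e h (fun _ => 1) x = 0 := by
      unfold RS
      rw [Finset.sum_eq_zero fun k _ => ?_, mul_zero]
      rw [ph_of_nonpos (sub_nonpos.2 (hx k)), mul_zero]
    simp only [Set.indicator_of_mem hx, mul_one, wt, h1]
  · simp [Set.indicator_of_notMem hx]

lemma gm_poly_le_mass (hN : 0 ≤ N) : gm (poly e h) ≤ mass (RS N ph e h fun _ => 1) := by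
  have hc : Continuous (RS N ph e h fun _ => 1) := continuous_RS continuous_ph
  rw [← setIntegral_poly (N := N)]
  exact setIntegral_le_integral ((PG.const 1).integrable hc (RS_ph_nonneg hN))
    (.of_forall fun _ => zero_le_one)

lemma gm_closedBall_pos {r : ℝ} (hr : 0 < r) : 0 < gm (Metric.closedBall (0 : Euc n) r) := by
  unfold gm
  rw [setIntegral_pos_iff_support_of_nonneg_ae (.of_forall fun x => (wt_pos _ x).le)
    integrable_wt_zero.integrableOn]
  have : Function.support (wt fun _ : Euc n => 0) = Set.univ :=
    Set.eq_univ_of_forall fun x => (wt_pos _ x).ne'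
  rw [this, Set.univ_inter]
  exact Metric.measure_closedBall_pos _ _ hr

section LpPath

variable {p A B r : ℝ}

lemma lpPath_base_pos (hp : 0 < p) (hr : 0 < r) (hA : r ≤ A) (hB : r ≤ B) {t : ℝ}
    (ht : t ∈ Set.Icc (0 : ℝ) 1) : r ^ p ≤ t * A ^ p + (1 - t) * B ^ p := by
  have h1 := Real.rpow_le_rpow hr.le hA hp.le
  have h2 := Real.rpow_le_rpow hr.le hB hp.le
  have h3 := mul_le_mul_of_nonneg_left h1 ht.1
  have h4 := mul_le_mul_of_nonneg_left h2 (sub_nonneg.2 ht.2)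
  linarith

/-- The `L_p` path between two heights. -/
def lpPath (p A B t : ℝ) : ℝ := (t * A ^ p + (1 - t) * B ^ p) ^ (1 / p)

/-- The velocity of the `L_p` path. -/
def lpVel (p A B t : ℝ) : ℝ :=
  (A ^ p - B ^ p) * (1 / p) * (t * A ^ p + (1 - t) * B ^ p) ^ (1 / p - 1)

lemma continuous_lpPath (hp : 0 < p) : Continuous (lpPath p A B) :=
  (Real.continuous_rpow_const (by positivity)).comp (by fun_prop)

lemma le_lpPath (hp : 0 < p) (hr : 0 < r) (hA : r ≤ A) (hB : r ≤ B) {t : ℝ}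
    (ht : t ∈ Set.Icc (0 : ℝ) 1) : r ≤ lpPath p A B t := by
  have := Real.rpow_le_rpow (by positivity) (lpPath_base_pos hp hr hA hB ht)
    (by positivity : 0 ≤ 1 / p)
  rwa [← Real.rpow_mul hr.le, mul_one_div_cancel hp.ne', Real.rpow_one] at this

lemma hasDerivAt_lp_base (t : ℝ) :
    HasDerivAt (fun t => t * A ^ p + (1 - t) * B ^ p) (A ^ p - B ^ p) t := by
  have h1 := (hasDerivAt_id t).mul_const (A ^ p)
  have h2 := ((hasDerivAt_id t).const_sub 1).mul_const (B ^ p)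
  exact (h1.add h2).congr_deriv (by ring)

lemma hasDerivAt_lpPath (hp : 0 < p) (hr : 0 < r) (hA : r ≤ A) (hB : r ≤ B) {t : ℝ}
    (ht : t ∈ Set.Icc (0 : ℝ) 1) : HasDerivAt (lpPath p A B) (lpVel p A B t) t :=
  (hasDerivAt_lp_base t).rpow_const
    (Or.inl ((by positivity : 0 < r ^ p).trans_le (lpPath_base_pos hp hr hA hB ht)).ne')

lemma hasDerivAt_lpVel (hp : 0 < p) (hr : 0 < r) (hA : r ≤ A) (hB : r ≤ B) {t : ℝ}
    (ht : t ∈ Set.Icc (0 : ℝ) 1) :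
    HasDerivAt (lpVel p A B) ((1 - p) * lpVel p A B t ^ 2 / lpPath p A B t) t := by
  have hb := (by positivity : 0 < r ^ p).trans_le (lpPath_base_pos hp hr hA hB ht)
  refine (((hasDerivAt_lp_base t).rpow_const (p := 1 / p - 1) (Or.inl hb.ne')).const_mul
    ((A ^ p - B ^ p) * (1 / p))).congr_deriv ?_
  unfold lpVel lpPath
  set b := t * A ^ p + (1 - t) * B ^ p
  have e1 : b ^ (1 / p - 1 - 1) * b ^ (1 / p) = (b ^ (1 / p - 1)) ^ 2 := by
    rw [sq, ← Real.rpow_add hb, ← Real.rpow_add hb]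
    congr 1
    ring
  have hb1 : 0 < b ^ (1 / p) := by positivity
  rw [eq_div_iff hb1.ne', mul_pow, ← e1]
  field_simp

lemma exists_lpVel_le (hp : 0 < p) (hr : 0 < r) (hA : r ≤ A) (hB : r ≤ B) :
    ∃ D, ∀ t ∈ Set.Icc (0 : ℝ) 1, |lpVel p A B t| ≤ D :=
  isCompact_Icc.exists_bound_of_continuousOn fun _ ht =>
    (hasDerivAt_lpVel hp hr hA hB ht).continuousAt.continuousWithinAt

end LpPath

open Filter Topology in
set_option maxHeartbeats 1000000 in
/-- The inequality for symmetric polyhedra. -/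
lemma poly_concave (hn : 1 ≤ n) (he : ∀ k, ‖e k‖ = 1) {σ : Equiv.Perm ι}
    (hσe : ∀ k, e (σ k) = -e k) {A B : ι → ℝ} (hσA : ∀ k, A (σ k) = A k)
    (hσB : ∀ k, B (σ k) = B k) {p r κ : ℝ} (hp : 0 < p) (hp1 : p ≤ 1) (hr : 0 < r)
    (hA : ∀ k, r ≤ A k) (hB : ∀ k, r ≤ B k) (hκ : 0 ≤ κ) (hκ1 : κ ≤ 1)
    (hcond : (n + 1) * ((1 - p) / r ^ 2) + 4 * (κ * n) < 2) {l : ℝ}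
    (hl : l ∈ Set.Icc (0 : ℝ) 1) :
    l * gm (poly e A) ^ κ + (1 - l) * gm (poly e B) ^ κ
      ≤ gm (poly e fun k => lpPath p (A k) (B k) l) ^ κ := by
  set h : ℝ → ι → ℝ := fun t k => lpPath p (A k) (B k) t with hh
  set m := gm (Metric.closedBall (0 : Euc n) r) with hm
  have hm0 : 0 < m := gm_closedBall_pos hr
  have hhr : ∀ t ∈ Set.Icc (0 : ℝ) 1, ∀ k, r ≤ h t k :=
    fun t ht k => le_lpPath hp hr (hA k) (hB k) ht
  have hmS : ∀ t ∈ Set.Icc (0 : ℝ) 1, m ≤ gm (poly e (h t)) :=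
    fun t ht => gm_mono (closedBall_subset_poly he (hhr t ht))
  have h1 : h 1 = A := by
    ext k
    simp only [hh, lpPath]
    rw [one_mul, sub_self, zero_mul, add_zero, ← Real.rpow_mul (hr.le.trans (hA k)),
      mul_one_div_cancel hp.ne', Real.rpow_one]
  have h0 : h 0 = B := by
    ext k
    simp only [hh, lpPath]
    rw [sub_zero, one_mul, zero_mul, zero_add, ← Real.rpow_mul (hr.le.trans (hB k)),
      mul_one_div_cancel hp.ne', Real.rpow_one]
  choose D hD using fun k => exists_lpVel_le hp hr (hA k) (hB k)
  have hP : 0 ≤ 1 - p := by linarith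
  have hmass0 : 0 ≤ mass (fun _ : Euc n => (0 : ℝ)) := integral_nonneg fun _ => zero_le_one
  have key : ∀ θ : ℝ, 0 < θ → θ < 1 →
      (n + 1) * ((1 - p) / r ^ 2 * (1 + (1 - θ))) + 4 * (κ * n * (1 + (1 - θ)) / θ ^ 2) ≤ 2 →
      l * gm (poly e A) ^ κ + (1 - l) * gm (poly e B) ^ κ ≤ (gm (poly e (h l)) / θ) ^ κ := by
    intro θ hθ hθ1 hc
    have hε : 0 < 1 - θ := by linarith
    obtain ⟨δ, hδ0, hδ⟩ := exists_ph1_le (C := (1 - p) * (1 + 1 / (1 - θ))) (by positivity) hr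
    obtain ⟨a, ha, haθ⟩ : ∃ a : ℝ, 0 < a ∧ θ * (1 + a / r) ^ n < 1 := by
      have hcont : Tendsto (fun a : ℝ => θ * (1 + a / r) ^ n) (𝓝[>] 0) (𝓝 (θ * (1 + 0 / r) ^ n)) :=
        (by fun_prop : Continuous fun a : ℝ => θ * (1 + a / r) ^ n).continuousAt.tendsto.mono_left
          nhdsWithin_le_nhds
      have h2 := hcont.eventually_lt_const (by simpa using hθ1 : θ * (1 + 0 / r) ^ n < 1)
      obtain ⟨a, ha1, ha2⟩ := (h2.and self_mem_nhdsWithin).exists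
      exact ⟨a, ha2, ha1⟩
    have hexp : Tendsto (fun N : ℝ => θ * (Real.exp (-(N * ph a)) * mass (fun _ : Euc n => (0 : ℝ))))
        atTop (𝓝 (θ * (0 * mass (fun _ : Euc n => (0 : ℝ))))) := by
      have h2 : Tendsto (fun N : ℝ => Real.exp (-(N * ph a))) atTop (𝓝 0) :=
        Real.tendsto_exp_neg_atTop_nhds_zero.comp (tendsto_id.atTop_mul_const (ph_pos ha))
      exact (h2.mul_const _).const_mul _
    have hev := hexp.eventually_le_const (u := (1 - θ * (1 + a / r) ^ n) * m)
      (by rw [zero_mul, mul_zero]; exact mul_pos (by linarith) hm0)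
    set c := κ * m ^ (κ - 1) * (Fintype.card ι * ((1 - p) * (∑ k, |D k|) ^ 2 / r) / ph δ ^ 2 * 2
      * mass (fun _ : Euc n => (0 : ℝ))) / 2 with hcdef
    have hbound : ∀ᶠ N : ℝ in atTop, l * gm (poly e A) ^ κ + (1 - l) * gm (poly e B) ^ κ
        ≤ (gm (poly e (h l)) / θ) ^ κ + c / N := by
      filter_upwards [hev, eventually_gt_atTop 0] with N hN1 hN
      have hmS' : ∀ t ∈ Set.Icc (0 : ℝ) 1, θ * pathMass N e h t ≤ gm (poly e (h t)) := by
        intro t ht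
        have q1 := mul_le_mul_of_nonneg_left
          (mass_RS_le (e := e) (h := h t) hN.le hr ha (hhr t ht)) hθ.le
        have q2 := mul_le_mul_of_nonneg_left (hmS t ht)
          (by linarith : 0 ≤ 1 - θ * (1 + a / r) ^ n)
        unfold pathMass
        linarith
      have hp1 := pathMass_approx hn hN he hσe (h := h)
        (d := fun t k => lpVel p (A k) (B k) t) (fun t k => by simp only [hh, hσA, hσB])
        (fun t k => by simp only [hσA, hσB]) hP hr hε hδ0 hδ
        (fun k => continuous_lpPath hp) hhr
        (fun t ht k => hasDerivAt_lpPath hp hr (hA k) (hB k) (Set.Ioo_subset_Icc_self ht))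
        (fun t ht k => hasDerivAt_lpVel hp hr (hA k) (hB k) (Set.Ioo_subset_Icc_self ht))
        (D := ∑ k, |D k|)
        (fun t ht k => ((hD k t (Set.Ioo_subset_Icc_self ht)).trans (le_abs_self _)).trans
          (Finset.single_le_sum (f := fun k => |D k|) (fun _ _ => abs_nonneg _)
            (Finset.mem_univ k)))
        hθ hκ hκ1
        (fun t ht => (hmS' t (Set.Ioo_subset_Icc_self ht)).trans_eq setIntegral_poly.symm)
        hm0 (fun t ht => (hmS t ht).trans (gm_poly_le_mass hN.le)) hc hl
      have q1 : gm (poly e A) ^ κ ≤ pathMass N e h 1 ^ κ := by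
        rw [← h1]
        exact Real.rpow_le_rpow (gm_nonneg _) (gm_poly_le_mass hN.le) hκ
      have q0 : gm (poly e B) ^ κ ≤ pathMass N e h 0 ^ κ := by
        rw [← h0]
        exact Real.rpow_le_rpow (gm_nonneg _) (gm_poly_le_mass hN.le) hκ
      have ql : pathMass N e h l ^ κ ≤ (gm (poly e (h l)) / θ) ^ κ := by
        refine Real.rpow_le_rpow ((gm_nonneg _).trans (gm_poly_le_mass hN.le)) ?_ hκ
        rw [le_div_iff₀' hθ]
        exact hmS' l hl
      have q1' := mul_le_mul_of_nonneg_left q1 hl.1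
      have q0' := mul_le_mul_of_nonneg_left q0 (sub_nonneg.2 hl.2)
      have qc : c / N = κ * m ^ (κ - 1) * (Fintype.card ι * ((1 - p) * (∑ k, |D k|) ^ 2 / r)
          / ph δ ^ 2 * (2 / N) * mass (fun _ : Euc n => (0 : ℝ))) / 2 := by
        rw [hcdef]; ring
      rw [qc]
      linarith
    have hlim : Tendsto (fun N : ℝ => (gm (poly e (h l)) / θ) ^ κ + c / N) atTop
        (𝓝 ((gm (poly e (h l)) / θ) ^ κ + 0)) :=
      tendsto_const_nhds.add (tendsto_const_nhds.div_atTop tendsto_id)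
    rw [add_zero] at hlim
    exact ge_of_tendsto hlim hbound
  have hc1 : Tendsto (fun θ : ℝ => (n + 1) * ((1 - p) / r ^ 2 * (1 + (1 - θ)))
      + 4 * (κ * n * (1 + (1 - θ)) / θ ^ 2)) (𝓝[<] 1)
      (𝓝 ((n + 1) * ((1 - p) / r ^ 2 * (1 + (1 - 1))) + 4 * (κ * n * (1 + (1 - 1)) / 1 ^ 2))) := by
    refine Tendsto.mono_left (ContinuousAt.tendsto ?_) nhdsWithin_le_nhds
    exact ContinuousAt.add (by fun_prop) (ContinuousAt.mul continuousAt_const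
      (ContinuousAt.div (by fun_prop) (by fun_prop) (by norm_num)))
  have hc2 := hc1.eventually_le_const (u := 2)
    (by simp only [sub_self, add_zero, mul_one, one_pow, div_one]; exact hcond)
  have hlim : Tendsto (fun θ : ℝ => (gm (poly e (h l)) / θ) ^ κ) (𝓝[<] 1)
      (𝓝 ((gm (poly e (h l)) / 1) ^ κ)) := by
    refine Tendsto.mono_left (ContinuousAt.tendsto ?_) nhdsWithin_le_nhds
    exact ContinuousAt.rpow_const (ContinuousAt.div continuousAt_const continuousAt_id one_ne_zero)
      (Or.inr hκ)
  rw [div_one] at hlim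
  refine ge_of_tendsto hlim ?_
  filter_upwards [hc2, self_mem_nhdsWithin,
    mem_nhdsWithin_of_mem_nhds (Ioi_mem_nhds zero_lt_one)] with θ q1 q2 q3
  exact key θ q3 q2 q1

end GaussPQ
namespace GaussPQ

variable {n : ℕ}

section SuppFn

variable {K : Set (Euc n)}

lemma inner_le_suppFn (hK : IsCompact K) {x : Euc n} (hx : x ∈ K) (u : Euc n) :
    ⟪x, u⟫ ≤ suppFn K u := by
  rw [real_inner_comm]
  have hc : Continuous fun y : Euc n => ⟪u, y⟫ := by fun_prop
  exact le_csSup (hK.bddAbove_image hc.continuousOn) ⟨x, hx, rfl⟩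

lemma continuous_suppFn (hK : IsCompact K) : Continuous (suppFn K) :=
  hK.continuous_sSup (f := fun u y : Euc n => ⟪u, y⟫)
    (by fun_prop : Continuous fun z : Euc n × Euc n => ⟪z.1, z.2⟫)

lemma suppFn_neg (hs : K = -K) (u : Euc n) : suppFn K (-u) = suppFn K u := by
  unfold suppFn
  congr 1
  ext s
  constructor
  · rintro ⟨y, hy, rfl⟩
    refine ⟨-y, ?_, by simp⟩
    rw [hs]
    simpa using hy
  · rintro ⟨y, hy, rfl⟩
    refine ⟨-y, ?_, by simp⟩
    rw [hs]
    simpa using hy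

lemma le_suppFn (hK : IsCompact K) {r : ℝ} (hr : 0 ≤ r) (hKr : Metric.closedBall (0 : Euc n) r ⊆ K)
    {u : Euc n} (hu : ‖u‖ = 1) : r ≤ suppFn K u := by
  have h1 : r • u ∈ K := hKr (by simp [norm_smul, hu, abs_of_nonneg hr])
  simpa [real_inner_smul_left, hu] using inner_le_suppFn hK h1 u

end SuppFn

lemma gaussianMeasure_apply {S : Set (Euc n)} (hS : MeasurableSet S) :
    gaussianMeasure n S = ENNReal.ofReal ((2 * Real.pi) ^ (-(n : ℝ) / 2) * gm S) := by
  have h1 : ∀ x : Euc n, (2 * Real.pi) ^ (-(n : ℝ) / 2) * Real.exp (-‖x‖ ^ 2 / 2)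
      = (2 * Real.pi) ^ (-(n : ℝ) / 2) * wt (fun _ => 0) x := fun x => by simp [wt]
  have h2 : (0 : ℝ) < (2 * Real.pi) ^ (-(n : ℝ) / 2) := by positivity
  rw [gaussianMeasure, withDensity_apply _ hS, gm, ← integral_const_mul,
    ofReal_integral_eq_lintegral_ofReal (integrable_wt_zero.const_mul _).integrableOn
      (.of_forall fun x => (mul_pos h2 (wt_pos _ x)).le)]
  simp only [h1]

lemma lpComb_eq {p l : ℝ} (hp : 0 < p) (K L : Set (Euc n)) :
    lpComb p l K L = {x | ∀ u : Euc n, ‖u‖ = 1 → ⟪x, u⟫ ≤ lpPath p (suppFn K u) (suppFn L u) l} := by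
  rw [lpComb, if_neg hp.ne']
  rfl

open Filter Topology in
/-- The inequality for the unnormalised Gaussian measure, with strict slack in the exponent. -/
lemma gm_concave (hn : 1 ≤ n) {K L : Set (Euc n)} (hK : IsCompact K) (hL : IsCompact L)
    (hKs : K = -K) (hLs : L = -L) {r : ℝ} (hr : 0 < r)
    (hKr : Metric.closedBall (0 : Euc n) r ⊆ K) (hLr : Metric.closedBall (0 : Euc n) r ⊆ L)
    {p κ : ℝ} (hp : 0 < p) (hp1 : p ≤ 1) (hκ : 0 ≤ κ) (hκ1 : κ ≤ 1)
    (hcond : (n + 1) * ((1 - p) / r ^ 2) + 4 * (κ * n) < 2) {l : ℝ}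
    (hl : l ∈ Set.Icc (0 : ℝ) 1) :
    MeasurableSet (lpComb p l K L) ∧
      l * gm K ^ κ + (1 - l) * gm L ^ κ ≤ gm (lpComb p l K L) ^ κ := by
  have : Nonempty (Metric.sphere (0 : Euc n) 1) :=
    ⟨⟨EuclideanSpace.single ⟨0, hn⟩ 1, by simp⟩⟩
  set u : ℕ → Metric.sphere (0 : Euc n) 1 := TopologicalSpace.denseSeq _ with hu
  have hu1 : ∀ j, ‖(u j : Euc n)‖ = 1 := fun j => by simp
  set e : (m : ℕ) → Fin m × Bool → Euc n := fun m k => if k.2 then u k.1 else -u k.1 with he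
  have he1 : ∀ m k, ‖e m k‖ = 1 := fun m k => by
    simp only [he]
    split_ifs
    · exact hu1 _
    · rw [norm_neg]; exact hu1 _
  have hσe : ∀ m k, e m ((Equiv.prodCongrRight fun _ => Equiv.boolNot) k) = -e m k :=
    fun m k => by rcases k with ⟨j, _ | _⟩ <;> simp [he]
  set H : Euc n → ℝ := fun v => lpPath p (suppFn K v) (suppFn L v) l with hH
  have hHc : Continuous H := by
    have h1 := continuous_suppFn hK
    have h2 := continuous_suppFn hL
    refine (Real.continuous_rpow_const (by positivity)).comp ?_
    have h3 := (Real.continuous_rpow_const hp.le).comp h1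
    have h4 := (Real.continuous_rpow_const hp.le).comp h2
    exact (continuous_const.mul h3).add (continuous_const.mul h4)
  set S : ℕ → Set (Euc n) := fun m => poly (e m) fun k => H (e m k) with hS
  have hSm : ∀ m, MeasurableSet (S m) := fun m => (isClosed_poly _ _).measurableSet
  have hle : ∀ m, l * gm K ^ κ + (1 - l) * gm L ^ κ ≤ gm (S m) ^ κ := by
    intro m
    have h1 := poly_concave hn (he1 m) (hσe m) (A := fun k => suppFn K (e m k))
      (B := fun k => suppFn L (e m k)) (fun k => by rw [hσe, suppFn_neg hKs])
      (fun k => by rw [hσe, suppFn_neg hLs]) hp hp1 hr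
      (fun k => le_suppFn hK hr.le hKr (he1 m k)) (fun k => le_suppFn hL hr.le hLr (he1 m k))
      hκ hκ1 hcond hl
    have q1 := mul_le_mul_of_nonneg_left (Real.rpow_le_rpow (gm_nonneg K)
      (gm_mono fun x hx k => inner_le_suppFn hK hx (e m k)) hκ) hl.1
    have q0 := mul_le_mul_of_nonneg_left (Real.rpow_le_rpow (gm_nonneg L)
      (gm_mono fun x hx k => inner_le_suppFn hL hx (e m k)) hκ) (sub_nonneg.2 hl.2)
    exact (add_le_add q1 q0).trans h1
  have hanti : Antitone S := by
    intro m m' hmm x hx k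
    have := hx (Fin.castLE hmm k.1, k.2)
    simpa [he] using this
  have hInter : ⋂ m, S m = lpComb p l K L := by
    rw [lpComb_eq hp]
    ext x
    simp only [Set.mem_iInter, Set.mem_ofPred_eq]
    refine ⟨fun hx v hv => ?_, fun hx m k => hx _ (he1 m k)⟩
    have hcl : IsClosed {v : Metric.sphere (0 : Euc n) 1 | ⟪x, (v : Euc n)⟫ ≤ H v} :=
      isClosed_le (by fun_prop) (hHc.comp continuous_subtype_val)
    have hsub : Set.range u ⊆ {v : Metric.sphere (0 : Euc n) 1 | ⟪x, (v : Euc n)⟫ ≤ H v} := by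
      rintro _ ⟨j, rfl⟩
      have := hx (j + 1) (⟨j, j.lt_succ_self⟩, true)
      simpa [he] using this
    have hd : closure (Set.range u) = Set.univ :=
      (TopologicalSpace.denseRange_denseSeq (Metric.sphere (0 : Euc n) 1)).closure_range
    have := closure_minimal hsub hcl
    rw [hd] at this
    exact this (Set.mem_univ (⟨v, by simpa using hv⟩ : Metric.sphere (0 : Euc n) 1))
  refine ⟨hInter ▸ MeasurableSet.iInter hSm, ?_⟩
  have hlim : Tendsto (fun m => gm (S m)) atTop (𝓝 (gm (lpComb p l K L))) := by
    rw [← hInter]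
    exact tendsto_setIntegral_of_antitone hSm hanti ⟨0, integrable_wt_zero.integrableOn⟩
  exact ge_of_tendsto' ((hlim.rpow_const (Or.inr hκ))) hle

end GaussPQ
/-- Corollary 1.7(3): for the Gaussian measure and origin-symmetric convex bodies
`K, L ⊇ rB₂ⁿ`, if `4q + (n+1)(1-p)/r² ≤ 2` with `p ∈ [0,1]`, `q ∈ (0,p]`, then
`γ(λK +_p (1-λ)L)^{q/n} ≥ λ γ(K)^{q/n} + (1-λ) γ(L)^{q/n}`. -/
theorem gaussian_pq_BM (n : ℕ) (hn : 1 ≤ n) (r : ℝ) (hr : 0 < r)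
    (K L : Set (Euc n)) (hK : IsConvexBody K) (hL : IsConvexBody L)
    (hKsym : K = -K) (hLsym : L = -L)
    (hKr : Metric.closedBall (0 : Euc n) r ⊆ K)
    (hLr : Metric.closedBall (0 : Euc n) r ⊆ L)
    (p q : ℝ) (hp : p ∈ Set.Icc (0:ℝ) 1) (hq0 : 0 < q) (hqp : q ≤ p)
    (hcond : 4 * q + ((n : ℝ) + 1) * (1 - p) / r ^ 2 ≤ 2) :
    ∀ lam ∈ Set.Icc (0:ℝ) 1,
      ENNReal.ofReal lam * gaussianMeasure n K ^ (q / (n : ℝ))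
          + ENNReal.ofReal (1 - lam) * gaussianMeasure n L ^ (q / (n : ℝ))
        ≤ gaussianMeasure n (lpComb p lam K L) ^ (q / (n : ℝ)) := by
  intro l hl
  have hn1 : (1 : ℝ) ≤ n := by exact_mod_cast hn
  have hn0 : (0 : ℝ) < n := by linarith
  have hp0 : 0 < p := hq0.trans_le hqp
  have hκ0 : 0 < q / n := by positivity
  have hc0 : 0 ≤ ((n : ℝ) + 1) * (1 - p) / r ^ 2 := by
    have := sub_nonneg.2 hp.2
    positivity
  have hκ1 : q / n ≤ 1 := by
    rw [div_le_one hn0]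
    linarith
  have key : ∀ κ, 0 ≤ κ → κ < q / n → MeasurableSet (lpComb p l K L) ∧
      l * GaussPQ.gm K ^ κ + (1 - l) * GaussPQ.gm L ^ κ ≤ GaussPQ.gm (lpComb p l K L) ^ κ := by
    intro κ h0 h1
    refine GaussPQ.gm_concave hn hK.1 hL.1 hKsym hLsym hr hKr hLr hp0 hp.2 h0 (h1.le.trans hκ1)
      ?_ hl
    rw [lt_div_iff₀ hn0] at h1
    rw [mul_div_assoc']
    linarith
  have hmeas := (key 0 le_rfl hκ0).1
  have hreal : l * GaussPQ.gm K ^ (q / n) + (1 - l) * GaussPQ.gm L ^ (q / n)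
      ≤ GaussPQ.gm (lpComb p l K L) ^ (q / n) := by
    have hc : ∀ a : ℝ, Filter.Tendsto (fun κ => a ^ κ) (nhdsWithin (q / n) (Set.Iio (q / n)))
        (nhds (a ^ (q / n))) := fun a =>
      (Real.continuousAt_const_rpow' hκ0.ne').tendsto.mono_left nhdsWithin_le_nhds
    refine le_of_tendsto_of_tendsto (((hc _).const_mul l).add ((hc _).const_mul (1 - l))) (hc _) ?_
    filter_upwards [self_mem_nhdsWithin, mem_nhdsWithin_of_mem_nhds (Ioi_mem_nhds hκ0)]
      with κ h1 h2
    exact (key κ (le_of_lt h2) h1).2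
  have hl' := sub_nonneg.2 hl.2
  set c : ℝ := (2 * Real.pi) ^ (-(n : ℝ) / 2) with hc
  have hc0 : 0 ≤ c := by positivity
  have hg : ∀ S : Set (Euc n), 0 ≤ GaussPQ.gm S := GaussPQ.gm_nonneg
  have hcg : ∀ S : Set (Euc n), 0 ≤ c * GaussPQ.gm S := fun S => mul_nonneg hc0 (hg S)
  rw [GaussPQ.gaussianMeasure_apply hmeas, GaussPQ.gaussianMeasure_apply hK.1.measurableSet,
    GaussPQ.gaussianMeasure_apply hL.1.measurableSet, ← hc,
    ENNReal.ofReal_rpow_of_nonneg (hcg _) hκ0.le, ENNReal.ofReal_rpow_of_nonneg (hcg _) hκ0.le,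
    ENNReal.ofReal_rpow_of_nonneg (hcg _) hκ0.le, ← ENNReal.ofReal_mul hl.1,
    ← ENNReal.ofReal_mul hl', ← ENNReal.ofReal_add (mul_nonneg hl.1 (Real.rpow_nonneg (hcg _) _))
      (mul_nonneg hl' (Real.rpow_nonneg (hcg _) _))]
  refine ENNReal.ofReal_le_ofReal ?_
  rw [Real.mul_rpow hc0 (hg _), Real.mul_rpow hc0 (hg _), Real.mul_rpow hc0 (hg _)]
  have := mul_le_mul_of_nonneg_left hreal (Real.rpow_nonneg hc0 (q / n))
  linarith

end
end

section
/- Let K be an origin-symmetric convex body in ℝⁿ, let γ be the standard Gaussian measure, and set m = (1/γ(K)) ∫_K |x|² dγ(x) and s = (1/γ(K)) ∫_K |x|⁴ dγ(x). Then for every p ∈ [0,1], n + m ≥ (s − m²) + (p/n)(n − m)² + (1 − p)(n − m). -/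
open MeasureTheory
open scoped RealInnerProductSpace ENNReal

noncomputable section

instance (n : ℕ) : SFinite (gaussianMeasure n) := by
  unfold gaussianMeasure; infer_instance

instance (n : ℕ) : IsLocallyFiniteMeasure (gaussianMeasure n) :=
  IsLocallyFiniteMeasure.withDensity_ofReal (by fun_prop)

/-- The orthogonal involution `(u, v) ↦ ((u + v)/√2, (u - v)/√2)`. -/
def hadamard (n : ℕ) : Euc n × Euc n →ₗ[ℝ] Euc n × Euc n :=
  (√2)⁻¹ • ((LinearMap.fst ℝ (Euc n) (Euc n) + LinearMap.snd ℝ (Euc n) (Euc n)).prod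
    (LinearMap.fst ℝ (Euc n) (Euc n) - LinearMap.snd ℝ (Euc n) (Euc n)))

lemma hadamard_apply {n : ℕ} (z : Euc n × Euc n) :
    hadamard n z = ((√2)⁻¹ • (z.1 + z.2), (√2)⁻¹ • (z.1 - z.2)) := rfl

lemma inv_sqrt_two_mul_self : (√2)⁻¹ * (√2)⁻¹ = (1 / 2 : ℝ) := by
  rw [← mul_inv, Real.mul_self_sqrt (by norm_num)]; norm_num

lemma hadamard_comp_self (n : ℕ) : hadamard n ∘ₗ hadamard n = LinearMap.id := by
  ext1 <;> ext x i <;> simp [hadamard_apply, ← mul_assoc, inv_sqrt_two_mul_self] <;> ring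

lemma continuous_hadamard (n : ℕ) : Continuous (hadamard n) :=
  (hadamard n).continuous_of_finiteDimensional

lemma norm_sq_add_norm_sq_hadamard {n : ℕ} (z : Euc n × Euc n) :
    ‖(hadamard n z).1‖ ^ 2 + ‖(hadamard n z).2‖ ^ 2 = ‖z.1‖ ^ 2 + ‖z.2‖ ^ 2 := by
  simp only [hadamard_apply, norm_smul, mul_pow, norm_add_sq_real, norm_sub_sq_real,
    Real.norm_eq_abs, sq_abs]
  rw [sq (√2)⁻¹, inv_sqrt_two_mul_self]
  ring

lemma norm_sq_sub_norm_sq_hadamard {n : ℕ} (z : Euc n × Euc n) :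
    ‖(hadamard n z).1‖ ^ 2 - ‖(hadamard n z).2‖ ^ 2 = 2 * ⟪z.1, z.2⟫ := by
  simp only [hadamard_apply, norm_smul, mul_pow, norm_add_sq_real, norm_sub_sq_real,
    Real.norm_eq_abs, sq_abs]
  rw [sq (√2)⁻¹, inv_sqrt_two_mul_self]
  ring

lemma hadamard_fst_add_snd {n : ℕ} (z : Euc n × Euc n) :
    (hadamard n z).1 + (hadamard n z).2 = √2 • z.1 := by
  have h : (√2)⁻¹ + (√2)⁻¹ = √2 := by
    field_simp; rw [Real.sq_sqrt (by norm_num)]; norm_num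
  conv_rhs => rw [← h]
  simp only [hadamard_apply]
  module

lemma hadamard_fst_sub_snd {n : ℕ} (z : Euc n × Euc n) :
    (hadamard n z).1 - (hadamard n z).2 = √2 • z.2 := by
  have h : (√2)⁻¹ + (√2)⁻¹ = √2 := by
    field_simp; rw [Real.sq_sqrt (by norm_num)]; norm_num
  conv_rhs => rw [← h]
  simp only [hadamard_apply]
  module

lemma measurePreserving_hadamard_volume (n : ℕ) :
    MeasurePreserving (hadamard n) ((volume : Measure (Euc n)).prod volume)
      ((volume : Measure (Euc n)).prod volume) := by
  have h : LinearMap.det (hadamard n) * LinearMap.det (hadamard n) = 1 := by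
    rw [← LinearMap.det_comp, hadamard_comp_self, LinearMap.det_id]
  have habs : |(LinearMap.det (hadamard n))⁻¹| = 1 := by
    rcases mul_self_eq_one_iff.mp h with h | h <;> simp [h]
  refine ⟨(continuous_hadamard n).measurable, ?_⟩
  rw [Measure.map_linearMap_addHaar_eq_smul_addHaar _ (left_ne_zero_of_mul_eq_one h), habs]
  simp

lemma measurePreserving_hadamard (n : ℕ) :
    MeasurePreserving (hadamard n) ((gaussianMeasure n).prod (gaussianMeasure n))
      ((gaussianMeasure n).prod (gaussianMeasure n)) := by
  refine ⟨(continuous_hadamard n).measurable, ?_⟩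
  have hm := (continuous_hadamard n).measurable
  rw [gaussianMeasure, prod_withDensity (by fun_prop) (by fun_prop)]
  ext s hs
  rw [Measure.map_apply hm hs, withDensity_apply _ hs, withDensity_apply _ (hm hs),
    ← (measurePreserving_hadamard_volume n).setLIntegral_comp_preimage hs (by fun_prop)]
  refine lintegral_congr fun z => ?_
  have key (c a b : ℝ) : c * Real.exp a * (c * Real.exp b) = c * c * Real.exp (a + b) := by
    rw [Real.exp_add]; ring
  rw [← ENNReal.ofReal_mul (by positivity), ← ENNReal.ofReal_mul (by positivity), key, key, ← add_div, ← add_div,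
    ← neg_add, ← neg_add, norm_sq_add_norm_sq_hadamard]

/-- Compact, convex sets symmetric about the origin (possibly empty or degenerate). -/
structure IsSymmCompactConvex {n : ℕ} (K : Set (Euc n)) : Prop where
  isCompact : IsCompact K
  convex : Convex ℝ K
  neg_mem : ∀ x ∈ K, -x ∈ K

/-- The section at height `v` of `K × K` seen in the coordinates given by `hadamard`. -/
def hadamardSection {n : ℕ} (K : Set (Euc n)) (v : Euc n) : Set (Euc n) :=
  {u | hadamard n (u, v) ∈ K ×ˢ K}

lemma IsSymmCompactConvex.hadamardSection {n : ℕ} {K : Set (Euc n)} (hK : IsSymmCompactConvex K)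
    (v : Euc n) : IsSymmCompactConvex (hadamardSection K v) where
  isCompact := by
    have h : IsCompact ((fun z : Euc n × Euc n => (hadamard n z).1) '' (K ×ˢ K)) :=
      (hK.isCompact.prod hK.isCompact).image (by have := continuous_hadamard n; fun_prop)
    refine h.of_isClosed_subset ?_ fun u hu => ⟨hadamard n (u, v), hu, ?_⟩
    · exact (hK.isCompact.prod hK.isCompact).isClosed.preimage
        ((continuous_hadamard n).comp (by fun_prop : Continuous fun u : Euc n => (u, v)))
    · exact congrArg Prod.fst (LinearMap.congr_fun (hadamard_comp_self n) (u, v))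
  convex := by
    intro x hx y hy a b ha hb hab
    have h := (hK.convex.prod hK.convex) hx hy ha hb hab
    rw [← map_smul, ← map_smul, ← map_add] at h
    have hv : a • v + b • v = v := by rw [← add_smul, hab, one_smul]
    simpa [_root_.hadamardSection, hv] using h
  neg_mem := by
    rintro x ⟨h1, h2⟩
    rw [hadamard_apply] at h1 h2
    refine ⟨?_, ?_⟩
    · convert hK.neg_mem _ h2 using 1
      simp only [hadamard_apply]; module
    · convert hK.neg_mem _ h1 using 1
      simp only [hadamard_apply]; module

lemma setLIntegral_prod_self_eq {n : ℕ} {K : Set (Euc n)} (hK : IsSymmCompactConvex K)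
    {f : Euc n × Euc n → ℝ≥0∞} (hf : Measurable f) :
    ∫⁻ z in K ×ˢ K, f z ∂(gaussianMeasure n).prod (gaussianMeasure n) =
      ∫⁻ v, ∫⁻ u in hadamardSection K v, f (hadamard n (u, v)) ∂gaussianMeasure n
        ∂gaussianMeasure n := by
  have hs : MeasurableSet (K ×ˢ K) := (hK.isCompact.prod hK.isCompact).measurableSet
  have hm := (continuous_hadamard n).measurable
  rw [← (measurePreserving_hadamard n).setLIntegral_comp_preimage hs hf,
    ← lintegral_indicator (hm hs),
    lintegral_prod_symm' _ ((by fun_prop : Measurable fun z => f (hadamard n z)).indicator (hm hs))]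
  refine lintegral_congr fun v => ?_
  rw [← lintegral_indicator (hK.hadamardSection v).isCompact.measurableSet]
  rfl

lemma lintegral_comp_half_smul_sub {n : ℕ} {g : Euc n → ℝ≥0∞} (hg : Measurable g) (p : Euc n) :
    ∫⁻ u, g ((1 / 2 : ℝ) • (u - p)) = 2 ^ n * ∫⁻ u, g u := by
  rw [lintegral_sub_right_eq_self (fun u => g ((1 / 2 : ℝ) • u)) p,
    ← lintegral_map hg (measurable_const_smul (1 / 2 : ℝ)),
    Measure.map_addHaar_smul _ (by norm_num), lintegral_smul_measure]
  simp [abs_of_pos]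

/-- Up to the factor `2 ^ n`, translating a symmetric convex body does not increase its Gaussian
measure: subtract the nearest point of the translate and halve. -/
lemma setLIntegral_exp_inner_le_two_pow_mul {n : ℕ} {K : Set (Euc n)} (hK : IsSymmCompactConvex K)
    (y : Euc n) :
    ∫⁻ u in K, ENNReal.ofReal (Real.exp ⟪u, y⟫) ∂gaussianMeasure n ≤
      ENNReal.ofReal (Real.exp (‖y‖ ^ 2 / 2)) * (2 ^ n * gaussianMeasure n K) := by
  rcases K.eq_empty_or_nonempty with rfl | hne
  · simp
  have hKm := hK.isCompact.measurableSet
  obtain ⟨p, hp, hpmin⟩ :=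
    exists_norm_eq_iInf_of_complete_convex hne hK.isCompact.isComplete hK.convex y
  rw [norm_eq_iInf_iff_real_inner_le_zero hK.convex hp] at hpmin
  set w : Euc n → ℝ≥0∞ := fun x =>
    ENNReal.ofReal ((2 * Real.pi) ^ (-(n : ℝ) / 2) * Real.exp (-‖x‖ ^ 2 / 2)) with hw
  have hwm : Measurable w := by fun_prop
  have hγK : gaussianMeasure n K = ∫⁻ u, K.indicator w u := by
    rw [gaussianMeasure, withDensity_apply _ hKm, lintegral_indicator hKm]
  rw [hγK, ← lintegral_comp_half_smul_sub (hwm.indicator hKm) p, gaussianMeasure,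
    setLIntegral_withDensity_eq_setLIntegral_mul _ hwm (by fun_prop) hKm,
    ← lintegral_const_mul _ (by
      have := hwm.indicator hKm
      fun_prop), ← lintegral_indicator hKm]
  refine lintegral_mono fun u => ?_
  by_cases hu : u ∈ K
  · have hmem : (1 / 2 : ℝ) • (u - p) ∈ K := by
      have := hK.convex hu (hK.neg_mem p hp) (by norm_num : (0 : ℝ) ≤ 1 / 2)
        (by norm_num : (0 : ℝ) ≤ 1 / 2) (by norm_num)
      rwa [← smul_add, ← sub_eq_add_neg] at this
    have hnorm : ‖(1 / 2 : ℝ) • (u - p)‖ ^ 2 ≤ ‖u - y‖ ^ 2 := by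
      have h1 := hpmin u hu
      have h2 : ‖u - y‖ ^ 2 = ‖u - p‖ ^ 2 - 2 * ⟪y - p, u - p⟫ + ‖y - p‖ ^ 2 := by
        rw [← sub_sub_sub_cancel_right u y p, norm_sub_sq_real (u - p), real_inner_comm]
      rw [norm_smul, mul_pow]
      norm_num
      nlinarith [sq_nonneg ‖u - p‖, sq_nonneg ‖y - p‖]
    rw [Set.indicator_of_mem hu, Set.indicator_of_mem hmem, Pi.mul_apply, hw]
    simp only
    rw [← ENNReal.ofReal_mul (by positivity), ← ENNReal.ofReal_mul (by positivity)]
    refine ENNReal.ofReal_le_ofReal ?_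
    rw [mul_assoc, ← Real.exp_add, mul_left_comm, ← Real.exp_add]
    refine mul_le_mul_of_nonneg_left (Real.exp_le_exp.mpr ?_) (by positivity)
    rw [norm_sub_sq_real] at hnorm
    linarith
  · rw [Set.indicator_of_notMem hu]
    exact bot_le

/-- Tensorization: applying the bound to the sections of `K × K` halves the exponent `t`. -/
lemma setLIntegral_exp_inner_le_of_double {n : ℕ} {t : ℝ}
    (h : ∀ (K : Set (Euc n)), IsSymmCompactConvex K → ∀ y : Euc n,
      ∫⁻ u in K, ENNReal.ofReal (Real.exp ⟪u, y⟫) ∂gaussianMeasure n ≤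
        ENNReal.ofReal (Real.exp (‖y‖ ^ 2 / 2 + t)) * gaussianMeasure n K)
    {K : Set (Euc n)} (hK : IsSymmCompactConvex K) (y : Euc n) :
    ∫⁻ u in K, ENNReal.ofReal (Real.exp ⟪u, y⟫) ∂gaussianMeasure n ≤
      ENNReal.ofReal (Real.exp (‖y‖ ^ 2 / 2 + t / 2)) * gaussianMeasure n K := by
  set γ := gaussianMeasure n
  rw [← ENNReal.pow_le_pow_left_iff two_ne_zero, mul_pow, ← ENNReal.ofReal_pow (by positivity),
    ← Real.exp_nat_mul]
  have hvol : γ K ^ 2 = ∫⁻ v, γ (hadamardSection K v) ∂γ := by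
    rw [sq, ← Measure.prod_prod, ← setLIntegral_one, setLIntegral_prod_self_eq hK (by fun_prop)]
    simp [γ]
  have hexp : (∫⁻ u in K, ENNReal.ofReal (Real.exp ⟪u, y⟫) ∂γ) ^ 2 =
      ∫⁻ z in K ×ˢ K, ENNReal.ofReal (Real.exp ⟪z.1 + z.2, y⟫) ∂γ.prod γ := by
    rw [sq, ← Measure.prod_restrict, ← lintegral_prod_mul (by fun_prop) (by fun_prop)]
    refine lintegral_congr fun z => ?_
    rw [← ENNReal.ofReal_mul (by positivity), ← Real.exp_add, inner_add_left]
  rw [hvol, hexp, setLIntegral_prod_self_eq hK (by fun_prop), ← lintegral_const_mul' _ _ (by simp)]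
  refine lintegral_mono fun v => ?_
  convert h _ (hK.hadamardSection v) (√2 • y) using 3 with u
  · rw [hadamard_fst_add_snd, real_inner_smul_left, real_inner_smul_right]
  · rw [norm_smul, mul_pow, Real.norm_eq_abs, sq_abs, Real.sq_sqrt (by norm_num)]
    congr 1
    push_cast
    ring

/-- The Gaussian measure of a symmetric convex body does not increase under translation. -/
lemma setLIntegral_exp_inner_le {n : ℕ} {K : Set (Euc n)} (hK : IsSymmCompactConvex K)
    (y : Euc n) :
    ∫⁻ u in K, ENNReal.ofReal (Real.exp ⟪u, y⟫) ∂gaussianMeasure n ≤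
      ENNReal.ofReal (Real.exp (‖y‖ ^ 2 / 2)) * gaussianMeasure n K := by
  have key (k : ℕ) : ∀ (K : Set (Euc n)), IsSymmCompactConvex K → ∀ y : Euc n,
      ∫⁻ u in K, ENNReal.ofReal (Real.exp ⟪u, y⟫) ∂gaussianMeasure n ≤
        ENNReal.ofReal (Real.exp (‖y‖ ^ 2 / 2 + n * Real.log 2 * (1 / 2) ^ k)) *
          gaussianMeasure n K := by
    induction k with
    | zero =>
      intro K hK y
      refine (setLIntegral_exp_inner_le_two_pow_mul hK y).trans_eq ?_
      rw [← mul_assoc, pow_zero, mul_one, Real.exp_add, Real.exp_nat_mul,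
        Real.exp_log (by norm_num), ENNReal.ofReal_mul (by positivity),
        ENNReal.ofReal_pow (by norm_num), ENNReal.ofReal_ofNat]
    | succ k ih =>
      intro K hK y
      convert setLIntegral_exp_inner_le_of_double ih hK y using 5
      ring
  have hlim : Filter.Tendsto (fun k : ℕ => ‖y‖ ^ 2 / 2 + n * Real.log 2 * (1 / 2) ^ k)
      Filter.atTop (nhds (‖y‖ ^ 2 / 2)) := by
    simpa using ((tendsto_pow_atTop_nhds_zero_of_lt_one (by norm_num) (by norm_num :
      (1 / 2 : ℝ) < 1)).const_mul (n * Real.log 2)).const_add (‖y‖ ^ 2 / 2)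
  exact ge_of_tendsto' (ENNReal.Tendsto.mul_const
    (ENNReal.tendsto_ofReal ((Real.continuous_exp.tendsto _).comp hlim))
    (Or.inr hK.isCompact.measure_lt_top.ne)) fun k => key k K hK y

lemma two_add_sq_le_exp_add_exp_neg (x : ℝ) : 2 + x ^ 2 ≤ Real.exp x + Real.exp (-x) := by
  have h1 : (x / 2) ^ 2 ≤ Real.sinh (x / 2) ^ 2 := by
    rw [sq_le_sq, Real.abs_sinh]
    exact Real.self_le_sinh_iff.mpr (abs_nonneg _)
  have h2 := Real.cosh_two_mul (x / 2)
  rw [Real.cosh_sq, mul_div_cancel₀ x two_ne_zero, Real.cosh_eq] at h2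
  linarith

lemma setIntegral_exp_inner_le {n : ℕ} {K : Set (Euc n)} (hK : IsSymmCompactConvex K)
    (y : Euc n) :
    ∫ u in K, Real.exp ⟪u, y⟫ ∂gaussianMeasure n ≤
      Real.exp (‖y‖ ^ 2 / 2) * (gaussianMeasure n).real K := by
  rw [integral_eq_lintegral_of_nonneg_ae (.of_forall fun u => Real.exp_nonneg _)
    (by fun_prop)]
  refine (ENNReal.toReal_mono ?_ (setLIntegral_exp_inner_le hK y)).trans_eq ?_
  · exact ENNReal.mul_ne_top ENNReal.ofReal_ne_top hK.isCompact.measure_lt_top.ne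
  · rw [ENNReal.toReal_mul, ENNReal.toReal_ofReal (by positivity), measureReal_def]

lemma setIntegral_inner_sq_le {n : ℕ} {K : Set (Euc n)} (hK : IsSymmCompactConvex K)
    (y : Euc n) :
    ∫ u in K, ⟪u, y⟫ ^ 2 ∂gaussianMeasure n ≤ ‖y‖ ^ 2 * (gaussianMeasure n).real K := by
  set γ := gaussianMeasure n
  have hint {f : Euc n → ℝ} (hf : Continuous f) : IntegrableOn f K γ :=
    hf.continuousOn.integrableOn_compact hK.isCompact
  have key (t : ℝ) : 2 * γ.real K + t ^ 2 * ∫ u in K, ⟪u, y⟫ ^ 2 ∂γ ≤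
      2 * (Real.exp (t ^ 2 * (‖y‖ ^ 2 / 2)) * γ.real K) := by
    calc 2 * γ.real K + t ^ 2 * ∫ u in K, ⟪u, y⟫ ^ 2 ∂γ
        = ∫ u in K, (2 + t ^ 2 * ⟪u, y⟫ ^ 2) ∂γ := by
          rw [integral_add (hint (by fun_prop)) (hint (by fun_prop)), integral_const_mul,
            setIntegral_const, smul_eq_mul, mul_comm 2]
      _ ≤ ∫ u in K, (Real.exp ⟪u, t • y⟫ + Real.exp ⟪u, -(t • y)⟫) ∂γ := by
          refine integral_mono (hint (by fun_prop)) (hint (by fun_prop)) fun u => ?_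
          simp only [inner_neg_right, real_inner_smul_right]
          rw [← mul_pow]
          exact two_add_sq_le_exp_add_exp_neg _
      _ ≤ 2 * (Real.exp (t ^ 2 * (‖y‖ ^ 2 / 2)) * γ.real K) := by
          rw [integral_add (hint (by fun_prop)) (hint (by fun_prop))]
          have h1 := setIntegral_exp_inner_le hK (t • y)
          have h2 := setIntegral_exp_inner_le hK (-(t • y))
          rw [norm_neg] at h2
          rw [norm_smul, mul_pow, Real.norm_eq_abs, sq_abs, mul_div_assoc] at h1 h2
          linarith
  have hlim : Filter.Tendsto
      (fun r : ℝ => 2 * (r⁻¹ * (Real.exp (r * (‖y‖ ^ 2 / 2)) - 1) * γ.real K))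
      (nhdsWithin 0 (Set.Ioi 0)) (nhds (‖y‖ ^ 2 * γ.real K)) := by
    have hd : HasDerivAt (fun r : ℝ => Real.exp (r * (‖y‖ ^ 2 / 2))) (‖y‖ ^ 2 / 2) 0 := by
      simpa using ((hasDerivAt_id (0 : ℝ)).mul_const (‖y‖ ^ 2 / 2)).exp
    have := ((hd.tendsto_slope_zero_right).mul_const (γ.real K)).const_mul 2
    simp only [zero_add, zero_mul, Real.exp_zero, smul_eq_mul] at this
    convert this using 2
    ring
  refine ge_of_tendsto hlim ?_
  filter_upwards [self_mem_nhdsWithin] with r hr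
  have hr : 0 < r := hr
  have h := key √r
  rw [Real.sq_sqrt hr.le] at h
  rw [mul_assoc, mul_left_comm, ← div_eq_inv_mul, le_div_iff₀ hr]
  linarith

lemma setIntegral_norm_sq_le {n : ℕ} {K : Set (Euc n)} (hK : IsSymmCompactConvex K) :
    ∫ u in K, ‖u‖ ^ 2 ∂gaussianMeasure n ≤ n * (gaussianMeasure n).real K := by
  have h (u : Euc n) : ‖u‖ ^ 2 = ∑ i, ⟪u, EuclideanSpace.basisFun (Fin n) ℝ i⟫ ^ 2 := by
    rw [EuclideanSpace.real_norm_sq_eq]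
    simp [EuclideanSpace.inner_single_right]
  simp_rw [h]
  rw [integral_finsetSum _ fun i _ =>
    (Continuous.continuousOn (by fun_prop)).integrableOn_compact hK.isCompact]
  refine (Finset.sum_le_sum fun i _ => setIntegral_inner_sq_le hK _).trans_eq ?_
  simp

lemma setIntegral_prod_sq_sub_le {n : ℕ} {K : Set (Euc n)} (hK : IsSymmCompactConvex K) :
    ∫ z in K ×ˢ K, ((‖z.1‖ ^ 2 - ‖z.2‖ ^ 2) / 2) ^ 2
        ∂(gaussianMeasure n).prod (gaussianMeasure n) ≤
      ∫ z in K ×ˢ K, ‖z.1 - z.2‖ ^ 2 / 2 ∂(gaussianMeasure n).prod (gaussianMeasure n) := by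
  set γ := gaussianMeasure n
  have hKK := hK.isCompact.prod hK.isCompact
  have hint {f : Euc n × Euc n → ℝ} (hf : Continuous f) : IntegrableOn f (K ×ˢ K) (γ.prod γ) :=
    hf.continuousOn.integrableOn_compact hKK
  rw [← ENNReal.ofReal_le_ofReal_iff (integral_nonneg fun z => by positivity),
    ofReal_integral_eq_lintegral_ofReal (hint (by fun_prop)) (.of_forall fun z => by positivity),
    ofReal_integral_eq_lintegral_ofReal (hint (by fun_prop)) (.of_forall fun z => by positivity),
    setLIntegral_prod_self_eq hK (by fun_prop), setLIntegral_prod_self_eq hK (by fun_prop)]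
  refine lintegral_mono fun v => ?_
  have hv := hK.hadamardSection v
  simp only [norm_sq_sub_norm_sq_hadamard, hadamard_fst_sub_snd, mul_div_cancel_left₀ _
    (two_ne_zero (α := ℝ)), norm_smul, mul_pow, Real.norm_eq_abs, sq_abs,
    Real.sq_sqrt (zero_le_two (α := ℝ)), setLIntegral_const]
  rw [← ofReal_integral_eq_lintegral_ofReal
    ((Continuous.continuousOn (by fun_prop)).integrableOn_compact hv.isCompact)
    (.of_forall fun z => by positivity)]
  refine (ENNReal.ofReal_le_ofReal (setIntegral_inner_sq_le hv v)).trans_eq ?_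
  rw [ENNReal.ofReal_mul (by positivity), ofReal_measureReal hv.isCompact.measure_lt_top.ne]

/-- The (B) inequality in infinitesimal form: `Var |X|² ≤ 2 𝔼 |X|²`, without normalization. -/
lemma setIntegral_norm_pow_four_mul_sub_sq_le {n : ℕ} {K : Set (Euc n)}
    (hK : IsSymmCompactConvex K) :
    (∫ x in K, ‖x‖ ^ 4 ∂gaussianMeasure n) * (gaussianMeasure n).real K -
        (∫ x in K, ‖x‖ ^ 2 ∂gaussianMeasure n) ^ 2 ≤
      2 * ((∫ x in K, ‖x‖ ^ 2 ∂gaussianMeasure n) * (gaussianMeasure n).real K) := by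
  set γ := gaussianMeasure n
  have hKK := hK.isCompact.prod hK.isCompact
  have hint {f : Euc n × Euc n → ℝ} (hf : Continuous f) : IntegrableOn f (K ×ˢ K) (γ.prod γ) :=
    hf.continuousOn.integrableOn_compact hKK
  have hone : ∫ _ in K, (1 : ℝ) ∂γ = γ.real K := by simp
  have hprod (f g : Euc n → ℝ) := setIntegral_prod_mul (μ := γ) (ν := γ) f g K K
  have hinner : 0 ≤ ∫ z in K ×ˢ K, ⟪z.1, z.2⟫ ∂γ.prod γ := by
    have hid : IntegrableOn (fun x : Euc n => x) K γ :=
      continuousOn_id.integrableOn_compact hK.isCompact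
    rw [setIntegral_prod _ (hint (by fun_prop))]
    simp_rw [integral_inner hid, fun x => real_inner_comm (∫ y in K, y ∂γ) x]
    rw [integral_inner hid]
    exact real_inner_self_nonneg
  have h := setIntegral_prod_sq_sub_le hK
  have hl : ∫ z in K ×ˢ K, ((‖z.1‖ ^ 2 - ‖z.2‖ ^ 2) / 2) ^ 2 ∂γ.prod γ =
      ((∫ x in K, ‖x‖ ^ 4 ∂γ) * γ.real K - (∫ x in K, ‖x‖ ^ 2 ∂γ) ^ 2) / 2 := by
    have : ∀ z : Euc n × Euc n, ((‖z.1‖ ^ 2 - ‖z.2‖ ^ 2) / 2) ^ 2 =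
        (‖z.1‖ ^ 4 * 1 + 1 * ‖z.2‖ ^ 4) / 4 - ‖z.1‖ ^ 2 * ‖z.2‖ ^ 2 / 2 := fun z => by ring
    simp_rw [this]
    rw [integral_sub (hint (by fun_prop)) (hint (by fun_prop)), integral_div, integral_div,
      integral_add (hint (by fun_prop)) (hint (by fun_prop)), hprod (fun x => ‖x‖ ^ 4) fun _ => 1,
      hprod (fun _ => 1) fun x => ‖x‖ ^ 4, hprod (fun x => ‖x‖ ^ 2) fun x => ‖x‖ ^ 2, hone]
    ring
  have hr : ∫ z in K ×ˢ K, ‖z.1 - z.2‖ ^ 2 / 2 ∂γ.prod γ =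
      (∫ x in K, ‖x‖ ^ 2 ∂γ) * γ.real K - ∫ z in K ×ˢ K, ⟪z.1, z.2⟫ ∂γ.prod γ := by
    have : ∀ z : Euc n × Euc n, ‖z.1 - z.2‖ ^ 2 / 2 =
        (‖z.1‖ ^ 2 * 1 + 1 * ‖z.2‖ ^ 2) / 2 - ⟪z.1, z.2⟫ := fun z => by
      rw [norm_sub_sq_real]; ring
    simp_rw [this]
    rw [integral_sub (hint (by fun_prop)) (hint (by fun_prop)), integral_div,
      integral_add (hint (by fun_prop)) (hint (by fun_prop)), hprod (fun x => ‖x‖ ^ 2) fun _ => 1,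
      hprod (fun _ => 1) fun x => ‖x‖ ^ 2, hone]
    ring
  rw [hl, hr] at h
  linarith

/-- Lemma 10.2 (analytic core): for an origin-symmetric convex body `K`, with
`m = ⨍_K |x|² dγ` and `s = ⨍_K |x|⁴ dγ`, for every `p ∈ [0,1]`,
`n + m ≥ (s - m²) + (p/n)(n - m)² + (1 - p)(n - m)`. -/
theorem gaussian_moment_inequality (n : ℕ) (hn : 1 ≤ n)
    (K : Set (Euc n)) (hK : IsConvexBody K) (hKsym : K = -K)
    (m s : ℝ)
    (hm : m = (gaussianMeasure n K).toReal⁻¹ * ∫ x in K, ‖x‖ ^ 2 ∂(gaussianMeasure n))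
    (hs : s = (gaussianMeasure n K).toReal⁻¹ * ∫ x in K, ‖x‖ ^ 4 ∂(gaussianMeasure n))
    (p : ℝ) (hp : p ∈ Set.Icc (0:ℝ) 1) :
    (s - m ^ 2) + (p / n) * ((n : ℝ) - m) ^ 2 + (1 - p) * ((n : ℝ) - m) ≤ (n : ℝ) + m := by
  have hS : IsSymmCompactConvex K := ⟨hK.1, hK.2.1, fun x hx => by
    rw [hKsym]; simpa using hx⟩
  rw [← measureReal_def] at hm hs
  set γ := gaussianMeasure n
  set M := ∫ x in K, ‖x‖ ^ 2 ∂γ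
  set S := ∫ x in K, ‖x‖ ^ 4 ∂γ
  have hM : M ≤ n * γ.real K := setIntegral_norm_sq_le hS
  have hM0 : 0 ≤ M := integral_nonneg fun x => by positivity
  have hB : S * γ.real K - M ^ 2 ≤ 2 * (M * γ.real K) :=
    setIntegral_norm_pow_four_mul_sub_sq_le hS
  have hn0 : (0 : ℝ) < n := by exact_mod_cast hn
  have hm0 : 0 ≤ m := by rw [hm]; positivity
  obtain ⟨hmn, hvar⟩ : m ≤ n ∧ s - m ^ 2 ≤ 2 * m := by
    rcases (measureReal_nonneg (μ := γ) (s := K)).eq_or_lt with hg | hg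
    · rw [← hg, inv_zero, zero_mul] at hm hs
      simp [hm, hs]
    · have hmM : M = m * γ.real K := by rw [hm]; field_simp
      have hsS : S = s * γ.real K := by rw [hs]; field_simp
      rw [hmM] at hM hB
      rw [hsS] at hB
      refine ⟨le_of_mul_le_mul_right hM hg, le_of_mul_le_mul_right ?_ (mul_pos hg hg)⟩
      linarith
  have hp' : 0 ≤ p * ((n - m) * m) / n :=
    div_nonneg (mul_nonneg hp.1 (mul_nonneg (sub_nonneg.mpr hmn) hm0)) hn0.le
  have key : p / n * ((n : ℝ) - m) ^ 2 = p * (n - m) - p * ((n - m) * m) / n := by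
    field_simp
  rw [key]
  linarith

end
end
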